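/- arXiv:1306.2410 — 2 statements merged into one kernel-verified Lean document; each statement's English description precedes it below -/
import Mathlib

section
/- Let n, m, n₁,…,n_m ≤ n be positive integers and p₁,…,p_m real numbers with ∑_{i=1}^m nᵢ/pᵢ = n. For each i let Uᵢ be an nᵢ×n real matrix of rank nᵢ, set N = ∑nᵢ, let U be the N×n matrix with block rows U₁,…,U_m, let B be an n×n real symmetric positive definite matrix, and set P = diag(p₁I_{n₁},…,p_mI_{n_m}) and D_{UBU*} = diag(U₁BU₁*,…,U_mBU_m*). If UBU* ≥ P·D_{UBU*}, then for all nonnegative fᵢ ∈ L_{pᵢ}(ℝ^{nᵢ}), ∫_{ℝⁿ} ∏_{i=1}^m fᵢ(Uᵢx) dx ≥ ( det(B) / ∏_{i=1}^m det(UᵢBUᵢ*)^{1/pᵢ} )^{1/2} · ∏_{i=1}^m ‖fᵢ‖_{pᵢ}. -/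
open MeasureTheory Matrix
open scoped ENNReal

namespace RevYoung
open Filter Topology

lemma exp_lower (s : ℝ) : 1 + s + s ^ 2 / 2 - |s| ^ 3 ≤ Real.exp s := by
  rcases le_or_gt |s| 1 with h | h
  · have := Real.exp_bound h (n := 3) (by norm_num)
    have h2 := (abs_le.1 this).1
    simp [Finset.sum_range_succ, Nat.factorial] at h2
    have h3 : 0 ≤ |s| ^ 3 := by positivity
    linarith
  · rcases le_or_gt 0 s with h0 | h0
    · have := Real.quadratic_le_exp_of_nonneg h0
      have h3 : 0 ≤ |s| ^ 3 := by positivity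
      linarith
    · rw [abs_of_neg h0] at *
      have := Real.exp_pos s
      nlinarith [sq_nonneg s, mul_pos (neg_pos.2 h0) (neg_pos.2 h0)]

lemma log_upper {t : ℝ} (ht : 0 < t) :
    Real.log t ≤ (t - 1) - (t - 1) ^ 2 / 2 + (t - 1) ^ 3 / 3 := by
  set g : ℝ → ℝ := fun t => (t - 1) - (t - 1) ^ 2 / 2 + (t - 1) ^ 3 / 3 - Real.log t with hg
  have hd : ∀ x : ℝ, 0 < x → HasDerivAt g ((x - 1) ^ 3 / x) x := by
    intro x hx
    have h1 : HasDerivAt (fun t : ℝ => t - 1) 1 x := (hasDerivAt_id x).sub_const 1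
    have := ((h1.sub ((h1.pow 2).div_const 2)).add ((h1.pow 3).div_const 3)).sub
      (Real.hasDerivAt_log hx.ne')
    refine HasDerivAt.congr_deriv this ?_
    field_simp
    push_cast
    ring
  have g1 : g 1 = 0 := by simp [hg]
  have key : 0 ≤ g t := by
    rw [← g1]
    rcases le_total 1 t with h | h
    · have : MonotoneOn g (Set.Ici 1) := by
        apply monotoneOn_of_deriv_nonneg (convex_Ici 1)
        · intro x hx
          exact (hd x (lt_of_lt_of_le one_pos hx)).continuousAt.continuousWithinAt
        · intro x hx
          rw [interior_Ici] at hx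
          exact (hd x (lt_trans one_pos hx)).differentiableAt.differentiableWithinAt
        · intro x hx
          rw [interior_Ici] at hx
          have hx' : (1 : ℝ) < x := hx
          rw [(hd x (lt_trans one_pos hx)).deriv]
          have : 0 ≤ x - 1 := by linarith
          positivity
      exact this (Set.mem_Ici.2 le_rfl) h h
    · have : AntitoneOn g (Set.Ioc 0 1) := by
        apply antitoneOn_of_deriv_nonpos (convex_Ioc 0 1)
        · intro x hx
          exact (hd x hx.1).continuousAt.continuousWithinAt
        · intro x hx
          rw [interior_Ioc] at hx
          exact (hd x hx.1).differentiableAt.differentiableWithinAt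
        · intro x hx
          rw [interior_Ioc] at hx
          rw [(hd x hx.1).deriv]
          apply div_nonpos_of_nonpos_of_nonneg _ hx.1.le
          have : x - 1 ≤ 0 := by linarith [hx.2]
          exact Odd.pow_nonpos (by decide) this
      exact this ⟨ht, h⟩ ⟨one_pos, le_rfl⟩ h
  simp only [hg] at key
  linarith

lemma log_bounds {δ : ℝ} (hδ : 0 < δ) : ∃ C : ℝ, 0 ≤ C ∧ ∀ r : ℝ, δ ≤ 1 + r →
    |Real.log (1 + r)| ≤ C * |r| ∧ |Real.log (1 + r) - r| ≤ C * |r| ^ 2 ∧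
    |Real.log (1 + r) - r + r ^ 2 / 2| ≤ C * |r| ^ 3 := by
  refine ⟨1 + δ⁻¹ + (δ⁻¹) ^ 3, by positivity, ?_⟩
  intro r hr
  have ht : 0 < 1 + r := lt_of_lt_of_le hδ hr
  have hδ' : 0 < δ⁻¹ := by positivity
  have hinv : (1 + r)⁻¹ ≤ δ⁻¹ := inv_anti₀ hδ hr
  have hinv0 : 0 < (1 + r)⁻¹ := by positivity
  have up1 : Real.log (1 + r) ≤ r := by linarith [Real.log_le_sub_one_of_pos ht]
  have lo1 : r * (1 + r)⁻¹ ≤ Real.log (1 + r) := by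
    have := Real.one_sub_inv_le_log_of_pos ht
    have e : r * (1 + r)⁻¹ = 1 - (1 + r)⁻¹ := by field_simp; ring
    linarith
  have up3 : Real.log (1 + r) ≤ r - r ^ 2 / 2 + r ^ 3 / 3 := by
    have := log_upper ht
    simpa using this
  have lo3 : r - r ^ 2 / 2 + r ^ 3 * ((1 + r)⁻¹) ^ 3 / 3 ≤ Real.log (1 + r) := by
    have := log_upper (inv_pos.2 ht)
    rw [Real.log_inv] at this
    have e : r - r ^ 2 / 2 + r ^ 3 * ((1 + r)⁻¹) ^ 3 / 3 + r ^ 2 / 2 * (r * (1 + r)⁻¹) ^ 2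
      = -(((1 + r)⁻¹ - 1) - ((1 + r)⁻¹ - 1) ^ 2 / 2 + ((1 + r)⁻¹ - 1) ^ 3 / 3) := by
      field_simp
      ring
    have : 0 ≤ r ^ 2 / 2 * (r * (1 + r)⁻¹) ^ 2 := by positivity
    linarith
  have habs : 0 ≤ |r| := abs_nonneg r
  have hA : (1 : ℝ) ≤ 1 + δ⁻¹ + (δ⁻¹) ^ 3 := by
    have : 0 < (δ⁻¹) ^ 3 := by positivity
    linarith
  have hB : δ⁻¹ ≤ 1 + δ⁻¹ + (δ⁻¹) ^ 3 := by
    have : 0 < (δ⁻¹) ^ 3 := by positivity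
    linarith
  have hC : (δ⁻¹) ^ 3 ≤ 1 + δ⁻¹ + (δ⁻¹) ^ 3 := by
    linarith
  have hcub : |r ^ 3| = |r| ^ 3 := abs_pow r 3
  have hp2 : 0 ≤ |r| ^ 2 := by positivity
  have hp3 : 0 ≤ |r| ^ 3 := by positivity
  refine ⟨?_, ?_, ?_⟩
  · rw [abs_le]
    constructor
    · have : -(|r| * δ⁻¹) ≤ r * (1 + r)⁻¹ := by
        have h1 : |r * (1 + r)⁻¹| ≤ |r| * δ⁻¹ := by
          rw [abs_mul, abs_of_pos hinv0]; gcongr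
        linarith [(abs_le.1 h1).1]
      nlinarith
    · have := le_abs_self r
      nlinarith
  · rw [abs_le]
    constructor
    · have e : r - r * (1 + r)⁻¹ = |r| ^ 2 * (1 + r)⁻¹ := by rw [sq_abs]; field_simp; ring
      have : |r| ^ 2 * (1 + r)⁻¹ ≤ |r| ^ 2 * δ⁻¹ := by gcongr
      nlinarith
    · have : 0 ≤ (1 + δ⁻¹ + (δ⁻¹) ^ 3) * |r| ^ 2 := by positivity
      linarith
  · rw [abs_le]
    constructor
    · have h1 : |r ^ 3 * ((1 + r)⁻¹) ^ 3| ≤ |r| ^ 3 * (δ⁻¹) ^ 3 := by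
        rw [abs_mul, hcub, abs_of_pos (pow_pos hinv0 3)]; gcongr
      have := (abs_le.1 h1).1
      nlinarith [pow_pos hδ' 3]
    · have := le_abs_self (r ^ 3)
      rw [hcub] at this
      nlinarith

lemma sum_bound {ι : Type*} [Fintype ι] (c g : ι → ℝ) {K : ℝ} (h : ∀ i, |g i| ≤ K) :
    |∑ i, c i * g i| ≤ (∑ i, |c i|) * K := by
  rw [Finset.sum_mul]
  refine (Finset.abs_sum_le_sum_abs _ _).trans (Finset.sum_le_sum fun i _ => ?_)
  rw [abs_mul]
  exact mul_le_mul_of_nonneg_left (h i) (abs_nonneg _)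

lemma prod_lower {ι : Type*} [Fintype ι] (c : ι → ℝ) {δ : ℝ} (hδ : 0 < δ) :
    ∃ C : ℝ, 0 ≤ C ∧ ∀ (r : ι → ℝ) (R : ℝ), 0 ≤ R → (∀ i, δ ≤ 1 + r i) → (∀ i, |r i| ≤ R) →
    1 + ∑ i, c i * r i + ((∑ i, c i * r i) ^ 2 - ∑ i, c i * (r i) ^ 2) / 2 - C * R ^ 3
      ≤ ∏ i, (1 + r i) ^ (c i) := by
  obtain ⟨C, hC, hlog⟩ := log_bounds hδ
  set A := ∑ i, |c i| with hA
  have hA0 : 0 ≤ A := Finset.sum_nonneg fun i _ => abs_nonneg _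
  refine ⟨A * C + A * C * (A * C + A) + (A * C) ^ 3, by positivity, ?_⟩
  intro r R hR hr hrR
  have hprod : ∏ i, (1 + r i) ^ (c i) = Real.exp (∑ i, c i * Real.log (1 + r i)) := by
    rw [Real.exp_sum]
    refine Finset.prod_congr rfl fun i _ => ?_
    rw [Real.rpow_def_of_pos (lt_of_lt_of_le hδ (hr i)), mul_comm]
  rw [hprod]
  set s := ∑ i, c i * Real.log (1 + r i) with hs
  set S := ∑ i, c i * r i with hS
  set T := ∑ i, c i * (r i) ^ 2 with hT
  have b1 : |s| ≤ A * (C * R) := sum_bound _ _ fun i =>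
    ((hlog _ (hr i)).1).trans (by gcongr; exact hrR i)
  have b2 : |s - S| ≤ A * (C * R ^ 2) := by
    have : s - S = ∑ i, c i * (Real.log (1 + r i) - r i) := by
      rw [hs, hS, ← Finset.sum_sub_distrib]; exact Finset.sum_congr rfl fun i _ => by ring
    rw [this]
    exact sum_bound _ _ fun i => ((hlog _ (hr i)).2.1).trans (by gcongr; exact hrR i)
  have b3 : |s - S + T / 2| ≤ A * (C * R ^ 3) := by
    have : s - S + T / 2 = ∑ i, c i * (Real.log (1 + r i) - r i + r i ^ 2 / 2) := by
      rw [hs, hS, hT, ← Finset.sum_sub_distrib, Finset.sum_div, ← Finset.sum_add_distrib]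
      exact Finset.sum_congr rfl fun i _ => by ring
    rw [this]
    exact sum_bound _ _ fun i => ((hlog _ (hr i)).2.2).trans (by gcongr; exact hrR i)
  have b4 : |S| ≤ A * R := sum_bound _ _ hrR
  have b5 : |s ^ 2 - S ^ 2| ≤ (A * (C * R ^ 2)) * (A * (C * R) + A * R) := by
    have : s ^ 2 - S ^ 2 = (s - S) * (s + S) := by ring
    rw [this, abs_mul]
    gcongr
    exact (abs_add_le _ _).trans (add_le_add b1 b4)
  have b6 : |s| ^ 3 ≤ (A * (C * R)) ^ 3 := by gcongr
  have := exp_lower s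
  have h3 := (abs_le.1 b3).1
  have h5 := (abs_le.1 b5).1
  have hx : 0 ≤ (A * (C * R ^ 2)) * (A * (C * R) + A * R) := by positivity
  nlinarith

lemma step_pointwise {ι : Type*} [Fintype ι] (c : ι → ℝ) {δ K : ℝ} (hδ : 0 < δ) (hK : 0 ≤ K) :
    ∃ C : ℝ, 0 ≤ C ∧ ∀ (r β : ι → ℝ) (σ ρ : ℝ), 0 ≤ σ → 1 ≤ ρ → (∀ i, δ ≤ 1 + r i) →
      (∀ i, |r i| ≤ K * (σ * ρ)) → (∀ i, |β i| ≤ K * ρ) →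
      (∀ i, |r i - σ * β i| ≤ K * (σ ^ 2 * ρ)) →
    1 + ∑ i, c i * r i + σ ^ 2 * ((∑ i, c i * β i) ^ 2 - ∑ i, c i * (β i) ^ 2) / 2
      - C * (σ ^ 3 * ρ ^ 3)
      ≤ ∏ i, (1 + r i) ^ (c i) := by
  obtain ⟨C, hC, hprod⟩ := prod_lower c hδ
  set A := ∑ i, |c i| with hA
  have hA0 : 0 ≤ A := Finset.sum_nonneg fun i _ => abs_nonneg _
  refine ⟨C * K ^ 3 + A * K * (A * K) + A * (K * K), by positivity, ?_⟩
  intro r β σ ρ hσ hρ hr hrK hβ he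
  have h1 := hprod r (K * (σ * ρ)) (by positivity) hr hrK
  set S := ∑ i, c i * r i with hS
  set S' := ∑ i, c i * β i with hS'
  set T := ∑ i, c i * (r i) ^ 2 with hT
  set T' := ∑ i, c i * (β i) ^ 2 with hT'
  have b1 : |S - σ * S'| ≤ A * (K * (σ ^ 2 * ρ)) := by
    have : S - σ * S' = ∑ i, c i * (r i - σ * β i) := by
      rw [hS, hS', Finset.mul_sum, ← Finset.sum_sub_distrib]
      exact Finset.sum_congr rfl fun i _ => by ring
    rw [this]; exact sum_bound _ _ he
  have b2 : |S| ≤ A * (K * (σ * ρ)) := sum_bound _ _ hrK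
  have b3 : |S'| ≤ A * (K * ρ) := sum_bound _ _ hβ
  have b4 : |S ^ 2 - σ ^ 2 * S' ^ 2| ≤
      (A * (K * (σ ^ 2 * ρ))) * (A * (K * (σ * ρ)) + σ * (A * (K * ρ))) := by
    have : S ^ 2 - σ ^ 2 * S' ^ 2 = (S - σ * S') * (S + σ * S') := by ring
    rw [this, abs_mul]
    gcongr
    refine (abs_add_le _ _).trans (add_le_add b2 ?_)
    rw [abs_mul, abs_of_nonneg hσ]; gcongr
  have b5 : |T - σ ^ 2 * T'| ≤
      A * ((K * (σ ^ 2 * ρ)) * (K * (σ * ρ) + σ * (K * ρ))) := by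
    have : T - σ ^ 2 * T' = ∑ i, c i * ((r i) ^ 2 - σ ^ 2 * β i ^ 2) := by
      rw [hT, hT', Finset.mul_sum, ← Finset.sum_sub_distrib]
      exact Finset.sum_congr rfl fun i _ => by ring
    rw [this]
    refine sum_bound _ _ fun i => ?_
    have : (r i) ^ 2 - σ ^ 2 * β i ^ 2 = (r i - σ * β i) * (r i + σ * β i) := by ring
    rw [this, abs_mul]
    gcongr
    · exact he i
    refine (abs_add_le _ _).trans (add_le_add (hrK i) ?_)
    rw [abs_mul, abs_of_nonneg hσ]; gcongr; exact hβ i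
  have h4 := (abs_le.1 b4).1
  have h5 := (abs_le.1 b5).2
  have hρ3 : σ ^ 3 * ρ ^ 2 ≤ σ ^ 3 * ρ ^ 3 := by
    gcongr
    norm_num
  have e1 : (A * (K * (σ ^ 2 * ρ))) * (A * (K * (σ * ρ)) + σ * (A * (K * ρ)))
    = 2 * (A * K * (A * K)) * (σ ^ 3 * ρ ^ 2) := by ring
  have e2 : A * ((K * (σ ^ 2 * ρ)) * (K * (σ * ρ) + σ * (K * ρ)))
    = 2 * (A * (K * K)) * (σ ^ 3 * ρ ^ 2) := by ring
  rw [e1] at h4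
  rw [e2] at h5
  have f1 : (A * K * (A * K)) * (σ ^ 3 * ρ ^ 2) ≤ (A * K * (A * K)) * (σ ^ 3 * ρ ^ 3) := by gcongr
  have f2 : (A * (K * K)) * (σ ^ 3 * ρ ^ 2) ≤ (A * (K * K)) * (σ ^ 3 * ρ ^ 3) := by gcongr
  have e3 : C * (K * (σ * ρ)) ^ 3 = C * K ^ 3 * (σ ^ 3 * ρ ^ 3) := by ring
  rw [e3] at h1
  linarith

end RevYoung

namespace RevYoung
open Filter Topology ProbabilityTheory
open scoped RealInnerProductSpace

section gauss

variable {E : Type*} [NormedAddCommGroup E] [InnerProductSpace ℝ E] [FiniteDimensional ℝ E]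
  [MeasurableSpace E] [BorelSpace E]

lemma integrable_norm_pow_gauss (k : ℕ) :
    Integrable (fun y : E => ‖y‖ ^ k) (stdGaussian E) := by
  have := (IsGaussian.memLp_id (stdGaussian E) k (by simp)).integrable_norm_pow'
  simpa using this

lemma integrable_rho (k : ℕ) :
    Integrable (fun y : E => (1 + ‖y‖ ^ 2) ^ k) (stdGaussian E) := by
  simp_rw [add_comm (1 : ℝ), add_pow, one_pow, mul_one, ← pow_mul]
  exact integrable_finsetSum _ fun i _ => (integrable_norm_pow_gauss _).mul_const _

lemma integral_inner_gauss (b : E) : ∫ y, ⟪b, y⟫ ∂(stdGaussian E) = 0 := by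
  have := integral_strongDual_stdGaussian (E := E) (innerSL ℝ b)
  simpa using this

lemma integrable_inner_gauss (b : E) : Integrable (fun y => ⟪b, y⟫) (stdGaussian E) := by
  have := IsGaussian.integrable_dual (stdGaussian E) (innerSL ℝ b)
  simpa using this

lemma integrable_inner_sq_gauss (b : E) :
    Integrable (fun y => ⟪b, y⟫ ^ 2) (stdGaussian E) := by
  have := (IsGaussian.memLp_dual (stdGaussian E) (innerSL ℝ b) 2 (by simp)).integrable_sq
  simpa using this

lemma integral_inner_sq_gauss (b : E) : ∫ y, ⟪b, y⟫ ^ 2 ∂(stdGaussian E) = ‖b‖ ^ 2 := by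
  have h := variance_dual_stdGaussian (E := E) (innerSL ℝ b)
  rw [variance_of_integral_eq_zero] at h
  · simpa using h
  · exact (innerSL ℝ b).continuous.aemeasurable
  · exact integral_strongDual_stdGaussian _

lemma map_add_gauss (s t : ℝ) :
    ((stdGaussian E).prod (stdGaussian E)).map (fun z : E × E => s • z.1 + t • z.2)
      = (stdGaussian E).map (fun y => Real.sqrt (s ^ 2 + t ^ 2) • y) := by
  have h1 : ((stdGaussian E).prod (stdGaussian E)).map (fun z : E × E => s • z.1 + t • z.2)
      = ((stdGaussian E).map (fun y => s • y)).conv ((stdGaussian E).map (fun y => t • y)) := by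
    rw [Measure.conv, Measure.map_prod_map _ _ (by fun_prop) (by fun_prop),
      Measure.map_map (by fun_prop) (by fun_prop)]
    rfl
  rw [h1]
  have : IsProbabilityMeasure ((stdGaussian E).map (fun y => s • y)) :=
    Measure.isProbabilityMeasure_map (by fun_prop)
  have : IsProbabilityMeasure ((stdGaussian E).map (fun y => t • y)) :=
    Measure.isProbabilityMeasure_map (by fun_prop)
  have : IsProbabilityMeasure ((stdGaussian E).map (fun y => Real.sqrt (s ^ 2 + t ^ 2) • y)) :=
    Measure.isProbabilityMeasure_map (by fun_prop)
  apply Measure.ext_of_charFun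
  ext ξ
  rw [charFun_conv]
  simp only [charFun_map_smul, charFun_stdGaussian, norm_smul]
  rw [← Complex.exp_add]
  congr 1
  have : (‖√(s ^ 2 + t ^ 2)‖ * ‖ξ‖) ^ 2 = (‖s‖ * ‖ξ‖) ^ 2 + (‖t‖ * ‖ξ‖) ^ 2 := by
    simp only [mul_pow, Real.norm_eq_abs, sq_abs]
    rw [Real.sq_sqrt (by positivity)]; ring
  norm_cast
  rw [this]
  ring

lemma bdd_integrable {Ω : Type*} [MeasurableSpace Ω] {μ : Measure Ω} [IsFiniteMeasure μ]
    {F : Type*} [NormedAddCommGroup F] {g : Ω → F} (hg : AEStronglyMeasurable g μ) {K : ℝ}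
    (h : ∀ y, ‖g y‖ ≤ K) : Integrable g μ :=
  Integrable.of_bound hg K (ae_of_all _ h)

lemma semigroup {u : E → ℝ} (hu : Measurable u) {K : ℝ} (hK : ∀ x, ‖u x‖ ≤ K) (s t : ℝ) (x : E) :
    ∫ y, ∫ z, u (x + s • y + t • z) ∂(stdGaussian E) ∂(stdGaussian E)
      = ∫ y, u (x + Real.sqrt (s ^ 2 + t ^ 2) • y) ∂(stdGaussian E) := by
  have hint : Integrable (fun z : E × E => u (x + s • z.1 + t • z.2))
      ((stdGaussian E).prod (stdGaussian E)) := by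
    refine bdd_integrable (Measurable.aestronglyMeasurable ?_) (fun z => hK _)
    exact hu.comp (by fun_prop)
  have h1 := integral_prod _ hint
  rw [← h1]
  have h2 := integral_map (μ := (stdGaussian E).prod (stdGaussian E))
    (φ := fun z : E × E => s • z.1 + t • z.2) (by fun_prop) (f := fun y => u (x + y))
    ((hu.comp (measurable_const_add x)).aestronglyMeasurable)
  have h3 := integral_map (μ := (stdGaussian E))
    (φ := fun y : E => Real.sqrt (s ^ 2 + t ^ 2) • y) (by fun_prop) (f := fun y => u (x + y))
    ((hu.comp (measurable_const_add x)).aestronglyMeasurable)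
  rw [map_add_gauss] at h2
  rw [← h3, h2]
  simp_rw [add_assoc]

/-- Class of functions stable under the heat flow. -/
structure Nice (V : Submodule ℝ E) (ε M L : ℝ) (u : E → ℝ) (a : E → E) : Prop where
  meas : Measurable u
  ameas : Measurable a
  lo : ∀ x, ε ≤ u x
  hi : ∀ x, u x ≤ M
  abd : ∀ x, ‖a x‖ ≤ L
  lip : ∀ x y, |u (x + y) - u x| ≤ L * ‖y‖
  tay : ∀ x y, |u (x + y) - u x - ⟪a x, y⟫| ≤ L * ‖y‖ ^ 2
  mem : ∀ x, a x ∈ V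

lemma Nice.shift_integrable {V : Submodule ℝ E} {ε M L : ℝ} {u : E → ℝ} {a : E → E}
    (hε : 0 < ε) (h : Nice V ε M L u a) (σ : ℝ) (x : E) :
    Integrable (fun y => u (x + σ • y)) (stdGaussian E) := by
  refine bdd_integrable (K := M) (Measurable.aestronglyMeasurable ?_) (fun z => ?_)
  · exact h.meas.comp (by fun_prop)
  · rw [Real.norm_eq_abs, abs_of_nonneg (hε.le.trans (h.lo _))]; exact h.hi _

lemma Nice.shift_aintegrable {V : Submodule ℝ E} {ε M L : ℝ} {u : E → ℝ} {a : E → E}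
    (h : Nice V ε M L u a) (σ : ℝ) (x : E) :
    Integrable (fun y => a (x + σ • y)) (stdGaussian E) := by
  refine bdd_integrable (K := L) (Measurable.aestronglyMeasurable ?_) (fun z => h.abd _)
  exact h.ameas.comp (by fun_prop)

lemma Nice.heat {V : Submodule ℝ E} {ε M L : ℝ} {u : E → ℝ} {a : E → E}
    (hε : 0 < ε) (h : Nice V ε M L u a) (σ : ℝ) :
    Nice V ε M L (fun x => ∫ y, u (x + σ • y) ∂(stdGaussian E))
      (fun x => ∫ y, a (x + σ • y) ∂(stdGaussian E)) := by
  have bint : ∀ {g : E → ℝ} {K : ℝ}, (∀ y, |g y| ≤ K) → |∫ y, g y ∂(stdGaussian E)| ≤ K := by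
    intro g K hg
    have := norm_integral_le_of_norm_le_const (μ := stdGaussian E) (C := K) (f := g)
      (ae_of_all _ hg)
    simpa using this
  have i1 := h.shift_integrable hε σ
  have i2 := h.shift_aintegrable σ
  have comm : ∀ x y z : E, x + y + σ • z = (x + σ • z) + y := fun x y z => by abel
  refine ⟨?_, ?_, ?_, ?_, ?_, ?_, ?_, ?_⟩
  · have : Measurable (fun z : E × E => u (z.1 + σ • z.2)) := h.meas.comp (by fun_prop)
    exact this.stronglyMeasurable.integral_prod_right'.measurable
  · have : Measurable (fun z : E × E => a (z.1 + σ • z.2)) := h.ameas.comp (by fun_prop)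
    exact this.stronglyMeasurable.integral_prod_right'.measurable
  · intro x
    have := integral_mono (integrable_const (μ := stdGaussian E) ε) (i1 x) (fun y => h.lo _)
    simpa using this
  · intro x
    have := integral_mono (i1 x) (integrable_const (μ := stdGaussian E) M) (fun y => h.hi _)
    simpa using this
  · intro x
    have := norm_integral_le_of_norm_le_const (μ := stdGaussian E) (C := L)
      (f := fun y => a (x + σ • y)) (ae_of_all _ fun y => h.abd _)
    simpa using this
  · intro x y
    rw [← integral_sub (i1 _) (i1 _)]
    refine bint fun z => ?_
    rw [comm]
    exact h.lip _ _
  · intro x y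
    have e : ⟪∫ z, a (x + σ • z) ∂(stdGaussian E), y⟫
        = ∫ z, ⟪a (x + σ • z), y⟫ ∂(stdGaussian E) := by
      rw [real_inner_comm, ← integral_inner (i2 x)]
      simp_rw [real_inner_comm]
    have e2 := integral_sub' ((i1 (x + y)).sub (i1 x)) ((i2 x).inner_const y)
    rw [integral_sub' (i1 (x + y)) (i1 x)] at e2
    rw [e, ← e2]
    refine bint fun z => ?_
    have := h.tay (x + σ • z) y
    rw [← comm] at this
    exact this
  · intro x
    exact (V.convex).integral_mem (V.closed_of_finiteDimensional) (ae_of_all _ fun y => h.mem _)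
      (i2 x)

lemma rpow_two_bound {ε M c w : ℝ} (hε : 0 < ε) (h1 : ε ≤ w) (h2 : w ≤ M) :
    w ^ c ≤ ε ^ c + M ^ c := by
  have hw : 0 < w := lt_of_lt_of_le hε h1
  have hM : 0 < M := lt_of_lt_of_le hw h2
  rcases le_total 0 c with h | h
  · have := Real.rpow_le_rpow hw.le h2 h
    have : 0 < ε ^ c := by positivity
    linarith
  · have := Real.rpow_le_rpow_of_nonpos hε h1 h
    have : 0 < M ^ c := by positivity
    linarith

variable {ι : Type*} [Fintype ι]

lemma prod_bound (c : ι → ℝ) {ε M : ℝ} (hε : 0 < ε) (w : ι → ℝ) (h1 : ∀ i, ε ≤ w i)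
    (h2 : ∀ i, w i ≤ M) :
    ‖∏ i, (w i) ^ (c i)‖ ≤ ∏ i, (ε ^ c i + M ^ c i) := by
  have hw : ∀ i, 0 < w i := fun i => lt_of_lt_of_le hε (h1 i)
  rw [Real.norm_eq_abs, abs_of_nonneg (Finset.prod_nonneg fun i _ => (Real.rpow_pos_of_pos (hw i) _).le)]
  exact Finset.prod_le_prod (fun i _ => (Real.rpow_pos_of_pos (hw i) _).le)
    fun i _ => rpow_two_bound hε (h1 i) (h2 i)

lemma one_step (c : ι → ℝ) (V : ι → Submodule ℝ E)
    (hV : ∀ b : ι → E, (∀ i, b i ∈ V i) → ∑ i, c i * ‖b i‖ ^ 2 ≤ ‖∑ i, c i • b i‖ ^ 2)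
    {ε M L : ℝ} (hε : 0 < ε) (hM : 0 < M) (hL : 0 ≤ L) :
    ∃ C : ℝ, 0 ≤ C ∧ ∀ (u : ι → E → ℝ) (a : ι → E → E),
      (∀ i, Nice (V i) ε M L (u i) (a i)) → ∀ σ : ℝ, 0 ≤ σ → σ ≤ 1 → ∀ x : E,
      ∏ i, (∫ y, u i (x + σ • y) ∂(stdGaussian E)) ^ (c i) - C * σ ^ 3
        ≤ ∫ y, ∏ i, (u i (x + σ • y)) ^ (c i) ∂(stdGaussian E) := by
  set γ := stdGaussian E with hγ
  set m1 := ∫ y : E, (1 + ‖y‖ ^ 2) ∂γ with hm1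
  have irho : Integrable (fun y : E => (1 + ‖y‖ ^ 2)) γ := by
    simpa using integrable_rho (E := E) 1
  have hm1' : 0 ≤ m1 := integral_nonneg fun y => by positivity
  set K := ε⁻¹ * L * (1 + m1) with hK
  have hK0 : 0 ≤ K := by positivity
  obtain ⟨C, hC, hstep⟩ := step_pointwise c (δ := ε / M) (K := K) (by positivity) hK0
  set G := ∏ i, (ε ^ c i + M ^ c i) with hG
  have hG0 : 0 ≤ G := Finset.prod_nonneg fun i _ => by positivity
  set m3 := ∫ y : E, (1 + ‖y‖ ^ 2) ^ 3 ∂γ with hm3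
  have hm3' : 0 ≤ m3 := integral_nonneg fun y => by positivity
  refine ⟨G * (C * m3), by positivity, ?_⟩
  intro u a hu σ hσ hσ1 x
  have hnice := fun i => (hu i).heat hε σ
  set w : ι → ℝ := fun i => ∫ y, u i (x + σ • y) ∂γ with hw
  have wlo : ∀ i, ε ≤ w i := fun i => (hnice i).lo x
  have whi : ∀ i, w i ≤ M := fun i => (hnice i).hi x
  have wpos : ∀ i, 0 < w i := fun i => lt_of_lt_of_le hε (wlo i)
  have winv : ∀ i, (w i)⁻¹ ≤ ε⁻¹ := fun i => inv_anti₀ hε (wlo i)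
  have iu := fun i => (hu i).shift_integrable hε σ x
  have tay : ∀ i y, |u i (x + σ • y) - u i x - σ * ⟪a i x, y⟫| ≤ L * (σ ^ 2 * (1 + ‖y‖ ^ 2)) := by
    intro i y
    have := (hu i).tay x (σ • y)
    rw [inner_smul_right, norm_smul, Real.norm_eq_abs, mul_pow, sq_abs] at this
    refine this.trans ?_
    gcongr
    linarith
  have wx : ∀ i, |w i - u i x| ≤ L * (σ ^ 2 * m1) := by
    intro i
    have i3 := (integrable_inner_gauss (a i x)).const_mul σ
    have e : w i - u i x = ∫ y, (u i (x + σ • y) - u i x - σ * ⟪a i x, y⟫) ∂γ := by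
      have e1 := integral_sub' ((iu i).sub (integrable_const (u i x))) i3
      rw [integral_sub' (iu i) (integrable_const _), integral_const_mul, integral_inner_gauss] at e1
      simp only [integral_const, probReal_univ, one_smul, mul_zero, sub_zero] at e1
      exact e1.symm
    rw [e]
    have := norm_integral_le_of_norm_le (μ := γ)
      (f := fun y => (u i (x + σ • y) - u i x - σ * ⟪a i x, y⟫))
      ((irho.const_mul (σ ^ 2)).const_mul L) (ae_of_all _ (tay i))
    rw [integral_const_mul, integral_const_mul] at this
    exact this
  set b : ι → E := fun i => (w i)⁻¹ • a i x with hb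
  have hbV : ∀ i, b i ∈ V i := fun i => (V i).smul_mem _ ((hu i).mem x)
  set r : E → ι → ℝ := fun y i => (u i (x + σ • y) - w i) * (w i)⁻¹ with hr
  have r1 : ∀ y i, 1 + r y i = u i (x + σ • y) * (w i)⁻¹ := by
    intro y i
    have := (wpos i).ne'
    simp only [hr]
    field_simp
    ring
  have hrho : ∀ y : E, ‖y‖ ≤ 1 + ‖y‖ ^ 2 := fun y => by nlinarith [sq_nonneg (‖y‖ - 1), norm_nonneg y]
  have hrho1 : ∀ y : E, (1 : ℝ) ≤ 1 + ‖y‖ ^ 2 := fun y => by nlinarith [norm_nonneg y]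
  have hσ2 : σ ^ 2 ≤ σ := by nlinarith
  have pt : ∀ y : E, 1 + ∑ i, c i * r y i
      + σ ^ 2 * ((∑ i, c i * ⟪b i, y⟫) ^ 2 - ∑ i, c i * ⟪b i, y⟫ ^ 2) / 2
      - C * (σ ^ 3 * (1 + ‖y‖ ^ 2) ^ 3) ≤ ∏ i, (1 + r y i) ^ (c i) := by
    intro y
    refine hstep (r y) (fun i => ⟪b i, y⟫) σ (1 + ‖y‖ ^ 2) hσ (hrho1 y) ?_ ?_ ?_ ?_
    · intro i
      rw [r1, div_eq_mul_inv]
      have := (hu i).lo (x + σ • y)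
      have h2 : M⁻¹ ≤ (w i)⁻¹ := inv_anti₀ (wpos i) (whi i)
      exact mul_le_mul this h2 (by positivity) (hε.le.trans this)
    · intro i
      simp only [hr]
      rw [abs_mul, abs_of_pos (inv_pos.2 (wpos i))]
      have h1 : |u i (x + σ • y) - w i| ≤ L * (1 + m1) * (σ * (1 + ‖y‖ ^ 2)) := by
        have l1 := (hu i).lip x (σ • y)
        rw [norm_smul, Real.norm_eq_abs, abs_of_nonneg hσ] at l1
        have l2 := wx i
        have l3 : |u i (x + σ • y) - w i| ≤ L * (σ * ‖y‖) + L * (σ ^ 2 * m1) := by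
          have : u i (x + σ • y) - w i = (u i (x + σ • y) - u i x) - (w i - u i x) := by ring
          rw [this]
          exact (abs_sub _ _).trans (add_le_add l1 l2)
        have l4 : L * (σ * ‖y‖) ≤ L * (σ * (1 + ‖y‖ ^ 2)) := by gcongr; exact hrho y
        have l5 : L * (σ ^ 2 * m1) ≤ L * (σ * m1) := by gcongr
        have l6 : L * (σ * m1) * 1 ≤ L * (σ * m1) * (1 + ‖y‖ ^ 2) := by gcongr; exact hrho1 y
        linarith
      calc _ ≤ (L * (1 + m1) * (σ * (1 + ‖y‖ ^ 2))) * ε⁻¹ :=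
            mul_le_mul h1 (winv i) (inv_pos.2 (wpos i)).le (by positivity)
        _ = _ := by rw [hK]; ring
    · intro i
      simp only [hb, real_inner_smul_left]
      rw [abs_mul, abs_of_pos (inv_pos.2 (wpos i))]
      have h1 : |⟪a i x, y⟫| ≤ L * (1 + ‖y‖ ^ 2) :=
        (abs_real_inner_le_norm _ _).trans (mul_le_mul ((hu i).abd x) (hrho y) (norm_nonneg _) hL)
      calc _ ≤ ε⁻¹ * (L * (1 + ‖y‖ ^ 2)) :=
            mul_le_mul (winv i) h1 (abs_nonneg _) (by positivity)
        _ = ε⁻¹ * L * 1 * (1 + ‖y‖ ^ 2) := by ring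
        _ ≤ _ := by rw [hK]; gcongr; linarith
    · intro i
      simp only [hr, hb, real_inner_smul_left]
      have : (u i (x + σ • y) - w i) * (w i)⁻¹ - σ * ((w i)⁻¹ * ⟪a i x, y⟫)
        = ((u i (x + σ • y) - u i x - σ * ⟪a i x, y⟫) - (w i - u i x)) * (w i)⁻¹ := by ring
      rw [this, abs_mul, abs_of_pos (inv_pos.2 (wpos i))]
      have l6 : L * (σ ^ 2 * m1) * 1 ≤ L * (σ ^ 2 * m1) * (1 + ‖y‖ ^ 2) := by gcongr; exact hrho1 y
      calc _ ≤ (L * (σ ^ 2 * (1 + ‖y‖ ^ 2)) + L * (σ ^ 2 * m1)) * ε⁻¹ :=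
            mul_le_mul ((abs_sub _ _).trans (add_le_add (tay i y) (wx i))) (winv i)
              (inv_pos.2 (wpos i)).le (by positivity)
        _ ≤ (L * (1 + m1) * (σ ^ 2 * (1 + ‖y‖ ^ 2))) * ε⁻¹ := by gcongr; linarith
        _ = _ := by rw [hK]; ring
  set W := ∏ i, (w i) ^ (c i) with hW
  have hW0 : 0 ≤ W := Finset.prod_nonneg fun i _ => (Real.rpow_pos_of_pos (wpos i) _).le
  have hWG : W ≤ G := (le_abs_self _).trans (prod_bound c hε w wlo whi)
  have prodeq : ∀ y, ∏ i, (u i (x + σ • y)) ^ (c i) = W * ∏ i, (1 + r y i) ^ (c i) := by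
    intro y
    rw [hW, ← Finset.prod_mul_distrib]
    refine Finset.prod_congr rfl fun i _ => ?_
    have hup : 0 ≤ u i (x + σ • y) := hε.le.trans ((hu i).lo _)
    rw [r1, ← Real.mul_rpow (wpos i).le (mul_nonneg hup (inv_pos.2 (wpos i)).le)]
    congr 1
    have := (wpos i).ne'
    field_simp
  -- integrate
  have ir : ∀ i, Integrable (fun y => r y i) γ := fun i =>
    ((iu i).sub (integrable_const _)).mul_const _
  have ir0 : ∀ i, ∫ y, r y i ∂γ = 0 := by
    intro i
    simp only [hr]
    rw [integral_mul_const]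
    have e1 := integral_sub' (iu i) (integrable_const (w i))
    simp only [integral_const, probReal_univ, one_smul] at e1
    have e2 : ∫ y, (u i (x + σ • y) - w i) ∂γ = 0 := e1.trans (sub_self _)
    rw [e2, zero_mul]
  have hsumin : ∀ y, ∑ i, c i * ⟪b i, y⟫ = ⟪∑ i, c i • b i, y⟫ := by
    intro y
    rw [sum_inner]
    simp [real_inner_smul_left]
  have iA : Integrable (fun y => 1 + ∑ i, c i * r y i) γ :=
    (integrable_const _).add (integrable_finsetSum _ fun i _ => (ir i).const_mul _)
  have iQ1 : Integrable (fun y => (∑ i, c i * ⟪b i, y⟫) ^ 2) γ := by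
    simp_rw [hsumin]; exact integrable_inner_sq_gauss _
  have iQ2 : Integrable (fun y => ∑ i, c i * ⟪b i, y⟫ ^ 2) γ :=
    integrable_finsetSum _ fun i _ => (integrable_inner_sq_gauss _).const_mul _
  have iQ : Integrable (fun y => σ ^ 2 * ((∑ i, c i * ⟪b i, y⟫) ^ 2
      - ∑ i, c i * ⟪b i, y⟫ ^ 2) / 2) γ := ((iQ1.sub iQ2).const_mul _).div_const _
  have iR : Integrable (fun y : E => C * (σ ^ 3 * (1 + ‖y‖ ^ 2) ^ 3)) γ :=
    ((integrable_rho 3).const_mul _).const_mul _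
  have vA : ∫ y, (1 + ∑ i, c i * r y i) ∂γ = 1 := by
    rw [integral_add (integrable_const _)
      (integrable_finsetSum _ fun i _ => (ir i).const_mul _),
      integral_finsetSum _ fun i _ => (ir i).const_mul _]
    simp [integral_const_mul, ir0]
  have vQ : 0 ≤ ∫ y, σ ^ 2 * ((∑ i, c i * ⟪b i, y⟫) ^ 2
      - ∑ i, c i * ⟪b i, y⟫ ^ 2) / 2 ∂γ := by
    rw [integral_div, integral_const_mul, integral_sub iQ1 iQ2,
      integral_finsetSum _ fun i _ => (integrable_inner_sq_gauss _).const_mul _]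
    simp_rw [hsumin, integral_const_mul, hγ, integral_inner_sq_gauss]
    have := hV b hbV
    have : 0 ≤ ‖∑ i, c i • b i‖ ^ 2 - ∑ i, c i * ‖b i‖ ^ 2 := by linarith
    positivity
  have iP : Integrable (fun y => ∏ i, (u i (x + σ • y)) ^ (c i)) γ := by
    refine bdd_integrable (K := G) (Measurable.aestronglyMeasurable ?_) fun y =>
      prod_bound c hε _ (fun i => (hu i).lo _) (fun i => (hu i).hi _)
    refine Finset.measurable_prod _ fun i _ => ?_
    exact ((hu i).meas.comp (by fun_prop)).pow_const _
  have final := integral_mono (((iA.add iQ).sub iR).const_mul W) iP (fun y => by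
    rw [prodeq y]
    exact mul_le_mul_of_nonneg_left (pt y) hW0)
  have vtot : ∫ y, W * ((((fun y => 1 + ∑ i, c i * r y i) + (fun y => σ ^ 2 * ((∑ i, c i * ⟪b i, y⟫) ^ 2
      - ∑ i, c i * ⟪b i, y⟫ ^ 2) / 2)) - (fun y : E => C * (σ ^ 3 * (1 + ‖y‖ ^ 2) ^ 3)) : E → ℝ) y) ∂γ
      = W * (1 + (∫ y, σ ^ 2 * ((∑ i, c i * ⟪b i, y⟫) ^ 2
      - ∑ i, c i * ⟪b i, y⟫ ^ 2) / 2 ∂γ) - C * (σ ^ 3 * m3)) := by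
    rw [integral_const_mul, integral_sub' (iA.add iQ) iR, integral_add' iA iQ, vA,
      integral_const_mul, integral_const_mul]
  rw [vtot] at final
  refine le_trans ?_ final
  have z1 : 0 ≤ W * (∫ y, σ ^ 2 * ((∑ i, c i * ⟪b i, y⟫) ^ 2
      - ∑ i, c i * ⟪b i, y⟫ ^ 2) / 2 ∂γ) := mul_nonneg hW0 vQ
  have z2 : W * (C * (σ ^ 3 * m3)) ≤ G * (C * (σ ^ 3 * m3)) := by gcongr
  nlinarith

lemma iterate_step (c : ι → ℝ) (V : ι → Submodule ℝ E)
    {ε M L C : ℝ} (hε : 0 < ε)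
    {σ : ℝ} (hσ : 0 ≤ σ)
    (hC : ∀ (u : ι → E → ℝ) (a : ι → E → E),
      (∀ i, Nice (V i) ε M L (u i) (a i)) → ∀ x : E,
      ∏ i, (∫ y, u i (x + σ • y) ∂(stdGaussian E)) ^ (c i) - C * σ ^ 3
        ≤ ∫ y, ∏ i, (u i (x + σ • y)) ^ (c i) ∂(stdGaussian E)) (j : ℕ) :
    ∀ (u : ι → E → ℝ) (a : ι → E → E), (∀ i, Nice (V i) ε M L (u i) (a i)) → ∀ x : E,
      ∏ i, (∫ y, u i (x + (√j * σ) • y) ∂(stdGaussian E)) ^ (c i) - j * (C * σ ^ 3)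
        ≤ ∫ y, ∏ i, (u i (x + (√j * σ) • y)) ^ (c i) ∂(stdGaussian E) := by
  induction j with
  | zero => intro u a hu x; simp
  | succ j ih =>
    intro u a hu x
    have hs : √((√j * σ) ^ 2 + σ ^ 2) = √(j + 1 : ℕ) * σ := by
      rw [mul_pow, Real.sq_sqrt (by positivity)]
      have : (j : ℝ) * σ ^ 2 + σ ^ 2 = ((j + 1 : ℕ) : ℝ) * σ ^ 2 := by push_cast; ring
      rw [this, Real.sqrt_mul (by positivity), Real.sqrt_sq hσ]
    have hb : ∀ i x, ‖u i x‖ ≤ M := fun i x => by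
      rw [Real.norm_eq_abs, abs_of_nonneg (hε.le.trans ((hu i).lo _))]; exact (hu i).hi _
    have sg : ∀ i, ∫ y, u i (x + (√(j + 1 : ℕ) * σ) • y) ∂(stdGaussian E)
        = ∫ y, ∫ z, u i (x + (√j * σ) • y + σ • z) ∂(stdGaussian E) ∂(stdGaussian E) := by
      intro i
      rw [semigroup (hu i).meas (hb i), hs]
    have Pm : Measurable (fun x => ∏ i, (u i x) ^ (c i)) :=
      Finset.measurable_prod _ fun i _ => (hu i).meas.pow_const _
    have Pb : ∀ x, ‖∏ i, (u i x) ^ (c i)‖ ≤ ∏ i, (ε ^ c i + M ^ c i) := fun x =>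
      prod_bound c hε _ (fun i => (hu i).lo _) (fun i => (hu i).hi _)
    have sgP := semigroup Pm Pb (√j * σ) σ x
    rw [hs] at sgP
    rw [← sgP]
    simp_rw [sg]
    have hn := fun i => (hu i).heat hε σ
    have h1 := ih _ _ hn x
    have i1 : Integrable (fun y => ∏ i, (∫ z, u i (x + (√j * σ) • y + σ • z) ∂(stdGaussian E)) ^ (c i))
        (stdGaussian E) := by
      refine bdd_integrable (Measurable.aestronglyMeasurable ?_) fun y =>
        prod_bound c hε _ (fun i => (hn i).lo _) (fun i => (hn i).hi _)
      refine Finset.measurable_prod _ fun i _ => ?_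
      exact ((hn i).meas.comp (g := fun x => ∫ z, u i (x + σ • z) ∂(stdGaussian E))
        (by fun_prop : Measurable fun y : E => x + (√j * σ) • y)).pow_const _
    have i2 : Integrable (fun y => ∫ z, ∏ i, (u i (x + (√j * σ) • y + σ • z)) ^ (c i)
        ∂(stdGaussian E)) (stdGaussian E) := by
      have : Integrable (fun z : E × E => ∏ i, (u i (x + (√j * σ) • z.1 + σ • z.2)) ^ (c i))
          ((stdGaussian E).prod (stdGaussian E)) :=
        bdd_integrable (Pm.comp (by fun_prop : Measurable fun z : E × E =>
          x + (√j * σ) • z.1 + σ • z.2)).aestronglyMeasurable fun z => Pb _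
      exact this.integral_prod_left
    have h2 := integral_mono (i1.sub (integrable_const (C * σ ^ 3))) i2
      (fun y => hC u a hu (x + (√j * σ) • y))
    rw [integral_sub' i1 (integrable_const _)] at h2
    simp only [integral_const, probReal_univ, one_smul] at h2
    push_cast
    linarith

lemma gauss_nice (c : ι → ℝ) (V : ι → Submodule ℝ E)
    (hV : ∀ b : ι → E, (∀ i, b i ∈ V i) → ∑ i, c i * ‖b i‖ ^ 2 ≤ ‖∑ i, c i • b i‖ ^ 2)
    {ε M L : ℝ} (hε : 0 < ε) (hM : 0 < M) (hL : 0 ≤ L)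
    (u : ι → E → ℝ) (a : ι → E → E) (hu : ∀ i, Nice (V i) ε M L (u i) (a i)) :
    ∏ i, (∫ y, u i y ∂(stdGaussian E)) ^ (c i)
        ≤ ∫ y, ∏ i, (u i y) ^ (c i) ∂(stdGaussian E) := by
  obtain ⟨C, hC, h⟩ := one_step c V hV hε hM hL
  have key : ∀ k : ℕ, ∏ i, (∫ y, u i y ∂(stdGaussian E)) ^ (c i) - C * (√((k : ℝ) + 1))⁻¹
        ≤ ∫ y, ∏ i, (u i y) ^ (c i) ∂(stdGaussian E) := by
    intro k
    set s := √((k : ℝ) + 1) with hs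
    have hs1 : 1 ≤ s := by rw [hs, Real.one_le_sqrt]; linarith [Nat.cast_nonneg (α := ℝ) k]
    have hs0 : 0 < s := by linarith
    have := iterate_step c V hε (σ := s⁻¹) (by positivity)
      (fun u a hu x => h u a hu s⁻¹ (by positivity) (inv_le_one_of_one_le₀ hs1) x) (k + 1) u a hu 0
    have e1 : √((k + 1 : ℕ) : ℝ) * s⁻¹ = 1 := by
      push_cast; rw [← hs]; field_simp
    rw [e1] at this
    simp only [zero_add, one_smul] at this
    have e2 : ((k + 1 : ℕ) : ℝ) * (C * s⁻¹ ^ 3) = C * s⁻¹ := by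
      have : ((k + 1 : ℕ) : ℝ) = s ^ 2 := by rw [hs, Real.sq_sqrt (by positivity)]; push_cast; ring
      rw [this]; field_simp
    rw [e2] at this
    exact this
  have lim : Tendsto (fun k : ℕ => ∏ i, (∫ y, u i y ∂(stdGaussian E)) ^ (c i)
      - C * (√((k : ℝ) + 1))⁻¹) atTop
      (𝓝 (∏ i, (∫ y, u i y ∂(stdGaussian E)) ^ (c i) - C * 0)) := by
    refine tendsto_const_nhds.sub (Tendsto.const_mul _ ?_)
    refine tendsto_inv_atTop_zero.comp (Real.tendsto_sqrt_atTop.comp ?_)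
    exact tendsto_atTop_add_const_right _ _ tendsto_natCast_atTop_atTop
  have := le_of_tendsto' lim key
  simpa using this

end gauss
end RevYoung

namespace RevYoung
open Filter Topology ProbabilityTheory
open scoped RealInnerProductSpace Convolution ContDiff

section moll

variable {E : Type*} [NormedAddCommGroup E] [InnerProductSpace ℝ E] [FiniteDimensional ℝ E]
  [MeasurableSpace E] [BorelSpace E]

/-- Gaussian density. -/
noncomputable def gdens (E : Type*) [NormedAddCommGroup E] [InnerProductSpace ℝ E] (x : E) : ℝ :=
  (2 * Real.pi) ^ (-(Module.finrank ℝ E / 2 : ℝ)) * Real.exp (-(‖x‖ ^ 2 / 2))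

lemma gdens_integral (t : E) :
    ∫ x : E, (gdens E x : ℂ) * Complex.exp (⟪x, t⟫ * Complex.I) = Complex.exp (-‖t‖ ^ 2 / 2) := by
  have h := GaussianFourier.integral_cexp_neg_mul_sq_norm_add (V := E) (b := (1 / 2 : ℂ))
    (by norm_num) Complex.I t
  have e : ∀ x : E, (gdens E x : ℂ) * Complex.exp (⟪x, t⟫ * Complex.I)
      = ((2 * Real.pi : ℝ) ^ (-(Module.finrank ℝ E / 2 : ℝ)) : ℝ)
        * Complex.exp (-(1 / 2 : ℂ) * ‖x‖ ^ 2 + Complex.I * ⟪t, x⟫) := by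
    intro x
    rw [gdens]
    push_cast
    rw [mul_assoc, ← Complex.exp_add, real_inner_comm]
    congr 2
    ring
  simp_rw [e]
  rw [integral_const_mul, h, ← mul_assoc]
  have hpi : (0 : ℝ) < 2 * Real.pi := by positivity
  have e2 : (Real.pi / (1 / 2) : ℂ) = ((2 * Real.pi : ℝ) : ℂ) := by push_cast; field_simp
  have e3 : (((2 * Real.pi : ℝ) ^ (-(Module.finrank ℝ E / 2 : ℝ)) : ℝ) : ℂ)
      * (Real.pi / (1 / 2) : ℂ) ^ (Module.finrank ℝ E / 2 : ℂ) = 1 := by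
    rw [e2]
    have : (Module.finrank ℝ E / 2 : ℂ) = ((Module.finrank ℝ E / 2 : ℝ) : ℂ) := by push_cast; rfl
    rw [this, ← Complex.ofReal_cpow hpi.le, ← Complex.ofReal_mul, ← Real.rpow_add hpi]
    simp
  rw [e3, one_mul]
  congr 1
  rw [Complex.I_sq]
  ring

lemma gdens_nonneg (x : E) : 0 ≤ gdens E x := by
  unfold gdens; positivity

lemma gdens_cont : Continuous (gdens E) := by
  unfold gdens; fun_prop

lemma gdens_integrable : Integrable (gdens E) := by
  have h := GaussianFourier.integrable_cexp_neg_mul_sq_norm_add (V := E) (b := (1 / 2 : ℂ))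
    (by norm_num) 0 0
  have h2 := h.norm.const_mul ((2 * Real.pi) ^ (-(Module.finrank ℝ E / 2 : ℝ)))
  refine h2.congr (ae_of_all _ fun x => ?_)
  simp only [gdens, Complex.norm_exp]
  congr 2
  norm_cast
  simp
  norm_cast
  ring

lemma gauss_eq_withDensity :
    stdGaussian E = (volume : Measure E).withDensity (fun x => ENNReal.ofReal (gdens E x)) := by
  have : IsFiniteMeasure ((volume : Measure E).withDensity (fun x => ENNReal.ofReal (gdens E x))) :=
    isFiniteMeasure_withDensity_ofReal gdens_integrable.2
  apply Measure.ext_of_charFun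
  ext t
  rw [charFun_stdGaussian, charFun_apply, integral_withDensity_eq_integral_toReal_smul
    (by exact (ENNReal.measurable_ofReal.comp gdens_cont.measurable))
    (ae_of_all _ fun x => ENNReal.ofReal_lt_top), ← gdens_integral t]
  refine integral_congr_ae (ae_of_all _ fun x => ?_)
  simp [ENNReal.toReal_ofReal (gdens_nonneg x)]

lemma gauss_ac : stdGaussian E ≪ (volume : Measure E) := by
  rw [gauss_eq_withDensity]; exact withDensity_absolutelyContinuous _ _

lemma Nice.mono {V : Submodule ℝ E} {ε M L L' : ℝ} {u : E → ℝ} {a : E → E}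
    (h : Nice V ε M L u a) (hL : L ≤ L') : Nice V ε M L' u a where
  meas := h.meas
  ameas := h.ameas
  lo := h.lo
  hi := h.hi
  abd x := (h.abd x).trans hL
  lip x y := (h.lip x y).trans (by gcongr)
  tay x y := (h.tay x y).trans (by gcongr)
  mem := h.mem

lemma conv_deriv {F G : Type*} [NormedAddCommGroup F] [NormedSpace ℝ F]
    [NormedAddCommGroup G] [NormedSpace ℝ G] (B : F →L[ℝ] ℝ →L[ℝ] G)
    {φ : E → F} (hφ : HasCompactSupport φ) (hφ1 : ContDiff ℝ 1 φ) {u : E → ℝ} (hu : Measurable u)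
    {M : ℝ} (hM : ∀ x, |u x| ≤ M) :
    ∃ K : ℝ, 0 ≤ K ∧ ∀ x, HasFDerivAt (φ ⋆[B, volume] u)
      ((fderiv ℝ φ ⋆[B.precompL E, volume] u) x) x
      ∧ ‖(fderiv ℝ φ ⋆[B.precompL E, volume] u) x‖ ≤ K := by
  have hM0 : 0 ≤ M := (abs_nonneg _).trans (hM 0)
  have hloc : LocallyIntegrable u (volume : Measure E) := by
    refine (locallyIntegrable_const (μ := (volume : Measure E)) M).mono
      hu.aestronglyMeasurable (ae_of_all _ fun x => ?_)
    simpa [abs_of_nonneg hM0] using hM x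
  refine ⟨∫ t, ‖B‖ * ‖fderiv ℝ φ t‖ * M, integral_nonneg fun t => by positivity, ?_⟩
  intro x
  refine ⟨hφ.hasFDerivAt_convolution_left B hφ1 hloc x, ?_⟩
  rw [convolution_def]
  have hint : Integrable (fun t => ‖fderiv ℝ φ t‖) (volume : Measure E) := by
    refine Continuous.integrable_of_hasCompactSupport ?_ ?_
    · exact (hφ1.continuous_fderiv (by norm_num)).norm
    · exact (hφ.fderiv ℝ).norm
  refine norm_integral_le_of_norm_le ((hint.const_mul _).mul_const _) (ae_of_all _ fun t => ?_)
  refine ContinuousLinearMap.opNorm_le_bound _ (by positivity) fun w => ?_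
  rw [ContinuousLinearMap.precompL_apply]
  refine (B.le_opNorm₂ _ _).trans ?_
  have h1 := (fderiv ℝ φ t).le_opNorm w
  have h2 : ‖u (x - t)‖ ≤ M := hM _
  calc ‖B‖ * ‖fderiv ℝ φ t w‖ * ‖u (x - t)‖
      ≤ ‖B‖ * (‖fderiv ℝ φ t‖ * ‖w‖) * M :=
        mul_le_mul (mul_le_mul_of_nonneg_left h1 (by positivity)) h2 (norm_nonneg _) (by positivity)
    _ = ‖B‖ * ‖fderiv ℝ φ t‖ * M * ‖w‖ := by ring

lemma moll_nice (V : Submodule ℝ E) {ε M : ℝ} (hε : 0 < ε) {u : E → ℝ} (hu : Measurable u)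
    (lo : ∀ x, ε ≤ u x) (hi : ∀ x, u x ≤ M) (inv : ∀ x, ∀ k ∈ Vᗮ, u (x + k) = u x)
    (φ : ContDiffBump (0 : E)) :
    ∃ (L : ℝ) (a : E → E),
      Nice V ε M L (φ.normed volume ⋆[ContinuousLinearMap.lsmul ℝ ℝ, volume] u) a := by
  have hb : ∀ x, |u x| ≤ M := fun x => by
    rw [abs_of_nonneg (hε.le.trans (lo x))]; exact hi x
  have hc : HasCompactSupport (φ.normed (volume : Measure E)) := φ.hasCompactSupport_normed
  have hsm : ContDiff ℝ 2 (φ.normed (volume : Measure E)) := φ.contDiff_normed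
  obtain ⟨K1, hK1, d1⟩ := conv_deriv (ContinuousLinearMap.lsmul ℝ ℝ) hc (hsm.of_le (by norm_num)) hu hb
  obtain ⟨K2, hK2, d2⟩ := conv_deriv ((ContinuousLinearMap.lsmul ℝ ℝ).precompL E) (hc.fderiv ℝ)
    (hsm.fderiv_right (m := 1) (by norm_num)) hu hb
  set v := φ.normed volume ⋆[ContinuousLinearMap.lsmul ℝ ℝ, volume] u with hv
  set D := (fderiv ℝ (φ.normed (volume : Measure E)) ⋆[(ContinuousLinearMap.lsmul ℝ ℝ).precompL E, volume] u)
    with hD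
  have hint : ∀ x, Integrable (fun t => φ.normed volume t * u (x - t)) (volume : Measure E) := by
    intro x
    refine Integrable.mul_bdd (c := M) ?_ ?_ ?_
    · exact φ.continuous_normed.integrable_of_hasCompactSupport hc
    · exact (hu.comp (by fun_prop)).aestronglyMeasurable
    · exact ae_of_all _ fun t => hb _
  have hint1 : Integrable (φ.normed (volume : Measure E)) :=
    φ.continuous_normed.integrable_of_hasCompactSupport hc
  have vdef : ∀ x, v x = ∫ t, φ.normed volume t * u (x - t) := fun x => by
    rw [hv, convolution_def]; rfl
  have Dcont : Continuous D := by
    rw [continuous_iff_continuousAt]; exact fun x => (d2 x).1.continuousAt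
  have vcont : Continuous v := by
    rw [continuous_iff_continuousAt]; exact fun x => (d1 x).1.continuousAt
  have ain : ∀ x y, ⟪(InnerProductSpace.toDual ℝ E).symm (D x), y⟫ = D x y := fun x y =>
    InnerProductSpace.toDual_symm_apply
  refine ⟨K1 + K2, fun x => (InnerProductSpace.toDual ℝ E).symm (D x), ?_, ?_, ?_, ?_, ?_, ?_, ?_, ?_⟩
  · exact vcont.measurable
  · exact ((LinearIsometryEquiv.continuous _).comp Dcont).measurable
  · intro x
    rw [vdef]
    have h1 : ∫ t, φ.normed volume t * ε = ε := by
      rw [integral_mul_const, φ.integral_normed, one_mul]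
    rw [← h1]
    refine integral_mono (hint1.mul_const _) (hint x) fun t => ?_
    exact mul_le_mul_of_nonneg_left (lo _) (φ.nonneg_normed _)
  · intro x
    rw [vdef]
    have h1 : ∫ t, φ.normed volume t * M = M := by
      rw [integral_mul_const, φ.integral_normed, one_mul]
    rw [← h1]
    refine integral_mono (hint x) (hint1.mul_const _) fun t => ?_
    exact mul_le_mul_of_nonneg_left (hi _) (φ.nonneg_normed _)
  · intro x
    rw [LinearIsometryEquiv.norm_map]
    linarith [(d1 x).2]
  · intro x y
    have := convex_univ.norm_image_sub_le_of_norm_hasFDerivWithin_le (f := v) (f' := D) (C := K1)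
      (fun z _ => (d1 z).1.hasFDerivWithinAt) (fun z _ => (d1 z).2) (Set.mem_univ x)
      (Set.mem_univ (x + y))
    rw [Real.norm_eq_abs, add_sub_cancel_left] at this
    nlinarith [norm_nonneg y]
  · intro x y
    rw [ain]
    have hx : x ∈ Metric.closedBall x ‖y‖ := Metric.mem_closedBall_self (norm_nonneg y)
    have hy : x + y ∈ Metric.closedBall x ‖y‖ := by simp
    have Dlip : ∀ z ∈ Metric.closedBall x ‖y‖, ‖D z - D x‖ ≤ K2 * ‖y‖ := by
      intro z hz
      have := convex_univ.norm_image_sub_le_of_norm_hasFDerivWithin_le (f := D) (C := K2)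
        (fun z _ => (d2 z).1.hasFDerivWithinAt) (fun z _ => (d2 z).2) (Set.mem_univ x)
        (Set.mem_univ z)
      refine this.trans ?_
      gcongr
      simpa [dist_eq_norm] using hz
    have := (convex_closedBall x ‖y‖).norm_image_sub_le_of_norm_hasFDerivWithin_le' (f := v) (f' := D)
      (fun z _ => (d1 z).1.hasFDerivWithinAt) Dlip hx hy
    rw [Real.norm_eq_abs, add_sub_cancel_left] at this
    nlinarith [norm_nonneg y, sq_nonneg ‖y‖]
  · intro x
    have : (InnerProductSpace.toDual ℝ E).symm (D x) ∈ Vᗮᗮ := by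
      rw [Submodule.mem_orthogonal']
      intro k hk
      rw [ain]
      have hl := (d1 x).1.hasLineDerivAt k
      have hconst : ∀ t : ℝ, v (x + t • k) = v x := by
        intro t
        rw [vdef, vdef]
        refine integral_congr_ae (ae_of_all _ fun s => ?_)
        have : x + t • k - s = (x - s) + t • k := by abel
        simp only [this, inv _ _ (Vᗮ.smul_mem t hk)]
      unfold HasLineDerivAt at hl
      simp_rw [hconst] at hl
      exact hl.unique (hasDerivAt_const _ _)
    rwa [Submodule.orthogonal_orthogonal] at this

variable {ι : Type*} [Fintype ι]

lemma gauss_bdd (c : ι → ℝ) (V : ι → Submodule ℝ E)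
    (hV : ∀ b : ι → E, (∀ i, b i ∈ V i) → ∑ i, c i * ‖b i‖ ^ 2 ≤ ‖∑ i, c i • b i‖ ^ 2)
    {ε M : ℝ} (hε : 0 < ε) (hM : 0 < M)
    (u : ι → E → ℝ) (hu : ∀ i, Measurable (u i)) (lo : ∀ i x, ε ≤ u i x) (hi : ∀ i x, u i x ≤ M)
    (inv : ∀ i x, ∀ k ∈ (V i)ᗮ, u i (x + k) = u i x) :
    ∏ i, (∫ y, u i y ∂(stdGaussian E)) ^ (c i)
        ≤ ∫ y, ∏ i, (u i y) ^ (c i) ∂(stdGaussian E) := by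
  let φ : ℕ → ContDiffBump (0 : E) := fun k =>
    ⟨1 / ((k : ℝ) + 1), 2 / ((k : ℝ) + 1), by positivity, by gcongr; norm_num⟩
  set v : ℕ → ι → E → ℝ := fun k i =>
    ((φ k).normed volume ⋆[ContinuousLinearMap.lsmul ℝ ℝ, volume] (u i)) with hv
  have hn : ∀ k i, ∃ (L : ℝ) (a : E → E), Nice (V i) ε M L (v k i) a := fun k i =>
    moll_nice (V i) hε (hu i) (lo i) (hi i) (inv i) (φ k)
  choose L a hn using hn
  have hbd : ∀ i x, ‖u i x‖ ≤ M := fun i x => by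
    rw [Real.norm_eq_abs, abs_of_nonneg (hε.le.trans (lo i x))]; exact hi i x
  have hvbd : ∀ k i x, ‖v k i x‖ ≤ M := fun k i x => by
    rw [Real.norm_eq_abs, abs_of_nonneg (hε.le.trans ((hn k i).lo x))]; exact (hn k i).hi x
  have key : ∀ k, ∏ i, (∫ y, v k i y ∂(stdGaussian E)) ^ (c i)
        ≤ ∫ y, ∏ i, (v k i y) ^ (c i) ∂(stdGaussian E) := by
    intro k
    refine gauss_nice c V hV hε hM (L := ∑ i, |L k i|) (Finset.sum_nonneg fun i _ => abs_nonneg _)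
      (v k) (a k) fun i => (hn k i).mono ?_
    exact (le_abs_self _).trans
      (Finset.single_le_sum (f := fun i => |L k i|) (fun i _ => abs_nonneg _) (Finset.mem_univ i))
  have hconv : ∀ i, ∀ᵐ x ∂(stdGaussian E), Tendsto (fun k => v k i x) atTop (𝓝 (u i x)) := by
    intro i
    apply gauss_ac.ae_le
    refine ContDiffBump.ae_convolution_tendsto_right_of_locallyIntegrable (K := 2) ?_ ?_ ?_
    · exact tendsto_const_div_atTop_nhds_zero_nat (𝕜 := ℝ) 2 |>.comp (tendsto_add_atTop_nat 1) |>.congr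
        (fun k => by simp [φ])
    · refine Eventually.of_forall fun k => ?_
      simp only [φ]
      apply le_of_eq; ring
    · refine (locallyIntegrable_const (μ := (volume : Measure E)) M).mono
        (hu i).aestronglyMeasurable (ae_of_all _ fun x => ?_)
      simpa [abs_of_pos hM] using hbd i x
  have hall : ∀ᵐ x ∂(stdGaussian E), ∀ i, Tendsto (fun k => v k i x) atTop (𝓝 (u i x)) :=
    ae_all_iff.2 hconv
  have l1 : ∀ i, Tendsto (fun k => ∫ y, v k i y ∂(stdGaussian E)) atTop
      (𝓝 (∫ y, u i y ∂(stdGaussian E))) := by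
    intro i
    refine tendsto_integral_of_dominated_convergence (fun _ => M)
      (fun k => (hn k i).meas.aestronglyMeasurable) (integrable_const _)
      (fun k => ae_of_all _ (hvbd k i)) (hconv i)
  have l2 : Tendsto (fun k => ∏ i, (∫ y, v k i y ∂(stdGaussian E)) ^ (c i)) atTop
      (𝓝 (∏ i, (∫ y, u i y ∂(stdGaussian E)) ^ (c i))) := by
    refine tendsto_finsetProd _ fun i _ => ?_
    refine (l1 i).rpow_const (Or.inl ?_)
    have : ε ≤ ∫ y, u i y ∂(stdGaussian E) := by
      have := integral_mono (integrable_const (μ := stdGaussian E) ε)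
        (bdd_integrable (hu i).aestronglyMeasurable (hbd i)) (fun y => lo i y)
      simpa using this
    linarith
  have l3 : Tendsto (fun k => ∫ y, ∏ i, (v k i y) ^ (c i) ∂(stdGaussian E)) atTop
      (𝓝 (∫ y, ∏ i, (u i y) ^ (c i) ∂(stdGaussian E))) := by
    refine tendsto_integral_of_dominated_convergence (fun _ => ∏ i, (ε ^ c i + M ^ c i))
      (fun k => ?_) (integrable_const _) (fun k => ae_of_all _ fun y => ?_) ?_
    · exact (Finset.measurable_prod _ fun i _ => ((hn k i).meas.pow_const _)).aestronglyMeasurable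
    · exact prod_bound c hε _ (fun i => (hn k i).lo y) (fun i => (hn k i).hi y)
    · filter_upwards [hall] with x hx
      refine tendsto_finsetProd _ fun i _ => (hx i).rpow_const (Or.inl ?_)
      linarith [lo i x]
  exact le_of_tendsto_of_tendsto' l2 l3 key

end moll
end RevYoung

namespace RevYoung
open Filter Topology ProbabilityTheory

section ennreal

variable {E : Type*} [NormedAddCommGroup E] [InnerProductSpace ℝ E] [FiniteDimensional ℝ E]
  [MeasurableSpace E] [BorelSpace E] {ι : Type*} [Fintype ι]

lemma rpow_anti {a b : ℝ≥0∞} {p : ℝ} (hp : p ≤ 0) (h : a ≤ b) : b ^ p ≤ a ^ p := by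
  have h1 : a ^ (-p) ≤ b ^ (-p) := ENNReal.rpow_le_rpow h (by linarith)
  rw [ENNReal.rpow_neg, ENNReal.rpow_neg] at h1
  exact ENNReal.inv_le_inv.1 h1

lemma max_rpow_le {a e : ℝ≥0∞} {p : ℝ} (he : e ≤ 1) : (max a e) ^ p ≤ a ^ p + 1 := by
  rcases le_total 0 p with hp | hp
  · rcases le_total a e with h | h
    · rw [max_eq_right h]
      exact (ENNReal.rpow_le_one he hp).trans le_add_self
    · rw [max_eq_left h]; exact le_self_add
  · exact (rpow_anti hp (le_max_left _ _)).trans le_self_add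

lemma min_rpow_le {a e : ℝ≥0∞} {p : ℝ} (he : 1 ≤ e) : (min a e) ^ p ≤ a ^ p + 1 := by
  rcases le_total 0 p with hp | hp
  · exact (ENNReal.rpow_le_rpow (min_le_left _ _) hp).trans le_self_add
  · rcases le_total a e with h | h
    · rw [min_eq_left h]; exact le_self_add
    · rw [min_eq_right h]
      refine (rpow_anti hp he).trans ?_
      rw [ENNReal.one_rpow]
      exact le_add_self

lemma lhs_tendsto (p : ι → ℝ) (hp : ∀ i, p i ≠ 0) (μ : Measure E) [IsProbabilityMeasure μ]
    (g : ι → E → ℝ) (hg : ∀ i, Measurable (g i))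
    (hfin : ∀ i, ∫⁻ x, ENNReal.ofReal (g i x) ^ (p i) ∂μ ≠ ⊤)
    (G : ℕ → ι → E → ℝ) (hG : ∀ k i, Measurable (G k i))
    (hlim : ∀ i x, Tendsto (fun k => G k i x) atTop (𝓝 (g i x)))
    (hdom : ∀ k i x, ENNReal.ofReal (G k i x) ^ (p i) ≤ ENNReal.ofReal (g i x) ^ (p i) + 1) :
    Tendsto (fun k => ∏ i, (∫⁻ x, ENNReal.ofReal (G k i x) ^ (p i) ∂μ) ^ (1 / p i)) atTop
      (𝓝 (∏ i, (∫⁻ x, ENNReal.ofReal (g i x) ^ (p i) ∂μ) ^ (1 / p i))) := by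
  refine ENNReal.tendsto_finsetProd_of_ne_top _ (fun i _ => ?_) (fun i _ => ?_)
  · refine (ENNReal.continuous_rpow_const.tendsto _).comp ?_
    refine tendsto_lintegral_of_dominated_convergence
      (fun x => ENNReal.ofReal (g i x) ^ (p i) + 1) (fun k => ?_) (fun k => ae_of_all _ (hdom k i)) ?_ ?_
    · exact ((hG k i).ennreal_ofReal).pow_const _
    · rw [lintegral_add_right _ measurable_const]
      simp [hfin i]
    · refine ae_of_all _ fun x => ?_
      exact (ENNReal.continuous_rpow_const.tendsto _).comp (ENNReal.tendsto_ofReal (hlim i x))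
  · rcases lt_or_gt_of_ne (hp i) with h | h
    · have hpos : ∫⁻ x, ENNReal.ofReal (g i x) ^ (p i) ∂μ ≠ 0 := by
        intro h0
        rw [lintegral_eq_zero_iff (((hg i).ennreal_ofReal).pow_const _)] at h0
        have : ∀ᵐ x ∂μ, False := by
          filter_upwards [h0] with x hx
          simp only [Pi.zero_apply, ENNReal.rpow_eq_zero_iff, ENNReal.ofReal_ne_top, false_and,
            or_false] at hx
          linarith [hx.2]
        simp at this
        exact NeZero.ne μ this
      intro htop
      rw [ENNReal.rpow_eq_top_iff] at htop
      rcases htop with h' | h'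
      · exact hpos h'.1
      · exact hfin i h'.1
    · exact ENNReal.rpow_ne_top_of_nonneg (by positivity) (hfin i)

lemma gauss_a (p : ι → ℝ) (hp : ∀ i, p i ≠ 0) (V : ι → Submodule ℝ E)
    (hV : ∀ b : ι → E, (∀ i, b i ∈ V i) →
      ∑ i, (1 / p i) * ‖b i‖ ^ 2 ≤ ‖∑ i, (1 / p i) • b i‖ ^ 2)
    {ε M : ℝ} (hε : 0 < ε) (hM : 0 < M)
    (g : ι → E → ℝ) (hg : ∀ i, Measurable (g i)) (lo : ∀ i x, ε ≤ g i x) (hi : ∀ i x, g i x ≤ M)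
    (inv : ∀ i x, ∀ k ∈ (V i)ᗮ, g i (x + k) = g i x) :
    ∏ i, (∫⁻ x, ENNReal.ofReal (g i x) ^ (p i) ∂(stdGaussian E)) ^ (1 / p i)
      ≤ ∫⁻ x, ∏ i, ENNReal.ofReal (g i x) ∂(stdGaussian E) := by
  have gpos : ∀ i x, 0 < g i x := fun i x => hε.trans_le (lo i x)
  set δ : ℝ := (1 + ∑ i, (ε ^ (-p i) + M ^ (-p i)))⁻¹ with hδ
  have hδ0 : 0 < δ := by
    have : 0 ≤ ∑ i, (ε ^ (-p i) + M ^ (-p i)) := Finset.sum_nonneg fun i _ => by positivity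
    positivity
  set K : ℝ := 1 + ∑ i, (ε ^ p i + M ^ p i) with hK
  have hK0 : 0 < K := by
    have : 0 ≤ ∑ i, (ε ^ p i + M ^ p i) := Finset.sum_nonneg fun i _ => by positivity
    linarith
  have hlo : ∀ i x, δ ≤ (g i x) ^ p i := by
    intro i x
    have h1 := rpow_two_bound (c := -p i) hε (lo i x) (hi i x)
    have h2 := Finset.single_le_sum (f := fun i => ε ^ (-p i) + M ^ (-p i))
      (fun i _ => by positivity) (Finset.mem_univ i)
    rw [Real.rpow_neg (gpos i x).le] at h1
    have h3 := gpos i x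
    rw [hδ]
    refine inv_le_of_inv_le₀ (by positivity) ?_
    linarith
  have hhi : ∀ i x, (g i x) ^ p i ≤ K := by
    intro i x
    have h1 := rpow_two_bound (c := p i) hε (lo i x) (hi i x)
    have h2 := Finset.single_le_sum (f := fun i => ε ^ p i + M ^ p i)
      (fun i _ => by positivity) (Finset.mem_univ i)
    linarith
  have key := gauss_bdd (fun i => 1 / p i) V hV hδ0 hK0 (fun i x => (g i x) ^ p i)
    (fun i => (hg i).pow_const _) hlo hhi (fun i x k hk => by simp only [inv i x k hk])
  have e1 : ∀ i x, ((g i x) ^ p i) ^ (1 / p i) = g i x := by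
    intro i x
    rw [← Real.rpow_mul (gpos i x).le, mul_one_div_cancel (hp i), Real.rpow_one]
  simp only [e1] at key
  have int1 : ∀ i, Integrable (fun x => (g i x) ^ p i) (stdGaussian E) := fun i =>
    bdd_integrable ((hg i).pow_const _).aestronglyMeasurable (K := K) fun x => by
      rw [Real.norm_eq_abs, abs_of_nonneg (Real.rpow_nonneg (gpos i x).le _)]; exact hhi i x
  have e2 : ∀ i, ∫⁻ x, ENNReal.ofReal (g i x) ^ (p i) ∂(stdGaussian E)
      = ENNReal.ofReal (∫ x, (g i x) ^ p i ∂(stdGaussian E)) := by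
    intro i
    rw [ofReal_integral_eq_lintegral_ofReal (int1 i)
      (ae_of_all _ fun x => Real.rpow_nonneg (gpos i x).le _)]
    refine lintegral_congr fun x => ?_
    rw [ENNReal.ofReal_rpow_of_pos (gpos i x)]
  have ipos : ∀ i, 0 < ∫ x, (g i x) ^ p i ∂(stdGaussian E) := by
    intro i
    have := integral_mono (integrable_const (μ := stdGaussian E) δ) (int1 i) (hlo i)
    simp at this
    linarith
  have e3 : ∀ i, (∫⁻ x, ENNReal.ofReal (g i x) ^ (p i) ∂(stdGaussian E)) ^ (1 / p i)
      = ENNReal.ofReal ((∫ x, (g i x) ^ p i ∂(stdGaussian E)) ^ (1 / p i)) := by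
    intro i
    rw [e2, ENNReal.ofReal_rpow_of_pos (ipos i)]
  simp_rw [e3]
  rw [← ENNReal.ofReal_prod_of_nonneg (fun i _ => Real.rpow_nonneg (ipos i).le _)]
  refine (ENNReal.ofReal_le_ofReal key).trans ?_
  have e4 : ∀ x, ∏ i, ENNReal.ofReal (g i x) = ENNReal.ofReal (∏ i, g i x) := fun x =>
    (ENNReal.ofReal_prod_of_nonneg (fun i _ => (gpos i x).le)).symm
  simp_rw [e4]
  rw [ofReal_integral_eq_lintegral_ofReal]
  · refine bdd_integrable (K := ∏ i : ι, M) (Finset.measurable_prod _ fun i _ => hg i).aestronglyMeasurable fun x => ?_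
    rw [Real.norm_eq_abs, abs_of_nonneg (Finset.prod_nonneg fun i _ => (gpos i x).le)]
    exact Finset.prod_le_prod (fun i _ => (gpos i x).le) fun i _ => hi i x
  · exact ae_of_all _ fun x => Finset.prod_nonneg fun i _ => (gpos i x).le

lemma gauss_b (p : ι → ℝ) (hp : ∀ i, p i ≠ 0) (V : ι → Submodule ℝ E)
    (hV : ∀ b : ι → E, (∀ i, b i ∈ V i) →
      ∑ i, (1 / p i) * ‖b i‖ ^ 2 ≤ ‖∑ i, (1 / p i) • b i‖ ^ 2)
    {M : ℝ} (hM : 1 ≤ M)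
    (g : ι → E → ℝ) (hg : ∀ i, Measurable (g i)) (lo : ∀ i x, 0 ≤ g i x) (hi : ∀ i x, g i x ≤ M)
    (hfin : ∀ i, ∫⁻ x, ENNReal.ofReal (g i x) ^ (p i) ∂(stdGaussian E) ≠ ⊤)
    (inv : ∀ i x, ∀ k ∈ (V i)ᗮ, g i (x + k) = g i x) :
    ∏ i, (∫⁻ x, ENNReal.ofReal (g i x) ^ (p i) ∂(stdGaussian E)) ^ (1 / p i)
      ≤ ∫⁻ x, ∏ i, ENNReal.ofReal (g i x) ∂(stdGaussian E) := by
  set G : ℕ → ι → E → ℝ := fun k i x => max (g i x) (1 / ((k : ℝ) + 1)) with hG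
  have hGm : ∀ k i, Measurable (G k i) := fun k i => (hg i).max measurable_const
  have hlim : ∀ i x, Tendsto (fun k => G k i x) atTop (𝓝 (g i x)) := by
    intro i x
    have h := (tendsto_const_nhds (x := g i x)).max (tendsto_one_div_add_atTop_nhds_zero_nat (𝕜 := ℝ))
    rwa [max_eq_left (lo i x)] at h
  have hk1 : ∀ k : ℕ, 1 / ((k : ℝ) + 1) ≤ 1 := fun k => by
    rw [div_le_one (by positivity)]; simp
  have hGM : ∀ k i x, G k i x ≤ M := fun k i x => max_le (hi i x) ((hk1 k).trans hM)
  have l1 := lhs_tendsto p hp (stdGaussian E) g hg hfin G hGm hlim (fun k i x => by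
    simp only [hG]
    rw [ENNReal.ofReal_max]
    exact max_rpow_le (by rw [ENNReal.ofReal_le_one]; exact hk1 k))
  have key : ∀ k, ∏ i, (∫⁻ x, ENNReal.ofReal (G k i x) ^ (p i) ∂(stdGaussian E)) ^ (1 / p i)
      ≤ ∫⁻ x, ∏ i, ENNReal.ofReal (G k i x) ∂(stdGaussian E) := fun k =>
    gauss_a p hp V hV (ε := 1 / ((k : ℝ) + 1)) (by positivity) (by linarith) (G k) (hGm k)
      (fun i x => le_max_right _ _) (hGM k) (fun i x y hy => by simp only [hG, inv i x y hy])
  refine le_of_tendsto_of_tendsto' l1 ?_ key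
  refine tendsto_lintegral_of_dominated_convergence (fun x => ∏ i : ι, ENNReal.ofReal M)
    (fun k => Finset.measurable_prod _ fun i _ => (hGm k i).ennreal_ofReal)
    (fun k => ae_of_all _ fun x => Finset.prod_le_prod' fun i _ => ENNReal.ofReal_le_ofReal (hGM k i x))
    ?_ (ae_of_all _ fun x => ?_)
  · simp
  · exact ENNReal.tendsto_finsetProd_of_ne_top _ (fun i _ => ENNReal.tendsto_ofReal (hlim i x))
      (fun i _ => ENNReal.ofReal_ne_top)

lemma gauss_c (p : ι → ℝ) (hp : ∀ i, p i ≠ 0) (V : ι → Submodule ℝ E)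
    (hV : ∀ b : ι → E, (∀ i, b i ∈ V i) →
      ∑ i, (1 / p i) * ‖b i‖ ^ 2 ≤ ‖∑ i, (1 / p i) • b i‖ ^ 2)
    (g : ι → E → ℝ) (hg : ∀ i, Measurable (g i)) (lo : ∀ i x, 0 ≤ g i x)
    (hfin : ∀ i, ∫⁻ x, ENNReal.ofReal (g i x) ^ (p i) ∂(stdGaussian E) ≠ ⊤)
    (inv : ∀ i x, ∀ k ∈ (V i)ᗮ, g i (x + k) = g i x) :
    ∏ i, (∫⁻ x, ENNReal.ofReal (g i x) ^ (p i) ∂(stdGaussian E)) ^ (1 / p i)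
      ≤ ∫⁻ x, ∏ i, ENNReal.ofReal (g i x) ∂(stdGaussian E) := by
  set G : ℕ → ι → E → ℝ := fun k i x => min (g i x) ((k : ℝ) + 1) with hG
  have hGm : ∀ k i, Measurable (G k i) := fun k i => (hg i).min measurable_const
  have hk1 : ∀ k : ℕ, 1 ≤ ((k : ℝ) + 1) := fun k => by simp
  have hlim : ∀ i x, Tendsto (fun k => G k i x) atTop (𝓝 (g i x)) := by
    intro i x
    refine tendsto_const_nhds.congr' ?_
    filter_upwards [eventually_ge_atTop (Nat.ceil (g i x))] with k hk
    have : g i x ≤ k := Nat.ceil_le.1 hk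
    simp only [hG]
    rw [min_eq_left (by linarith)]
  have hdom : ∀ k i x, ENNReal.ofReal (G k i x) ^ (p i) ≤ ENNReal.ofReal (g i x) ^ (p i) + 1 := by
    intro k i x
    simp only [hG]
    rw [ENNReal.ofReal_min]
    exact min_rpow_le (by rw [ENNReal.one_le_ofReal]; exact hk1 k)
  have l1 := lhs_tendsto p hp (stdGaussian E) g hg hfin G hGm hlim hdom
  refine le_of_tendsto' l1 fun k => ?_
  refine (gauss_b p hp V hV (hk1 k) (G k) (hGm k) (fun i x => le_min (lo i x) (by positivity))
    (fun i x => min_le_right _ _) (fun i => ?_) (fun i x y hy => by simp only [hG, inv i x y hy])).trans ?_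
  · refine ne_top_of_le_ne_top ?_ (lintegral_mono (hdom k i))
    rw [lintegral_add_right _ measurable_const]
    simp [hfin i]
  · exact lintegral_mono fun x => Finset.prod_le_prod' fun i _ =>
      ENNReal.ofReal_le_ofReal (min_le_left _ _)

end ennreal
end RevYoung

namespace RevYoung
open Filter Topology ProbabilityTheory
open scoped RealInnerProductSpace

section leb

variable {E : Type*} [NormedAddCommGroup E] [InnerProductSpace ℝ E] [FiniteDimensional ℝ E]
  [MeasurableSpace E] [BorelSpace E]
  {F : Type*} [NormedAddCommGroup F] [InnerProductSpace ℝ F] [FiniteDimensional ℝ F]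
  [MeasurableSpace F] [BorelSpace F]

lemma linmap_meas (T : E →ₗ[ℝ] F) : Measurable T := T.continuous_of_finiteDimensional.measurable

lemma lint_comp (L : F →ₗ[ℝ] F) (hL : LinearMap.det L ≠ 0) {k : F → ℝ≥0∞} (hk : Measurable k) :
    ∫⁻ y, k (L y) = ENNReal.ofReal |LinearMap.det L|⁻¹ * ∫⁻ w, k w := by
  rw [← lintegral_map hk (linmap_meas L), Measure.map_linearMap_addHaar_eq_smul_addHaar _ hL,
    lintegral_smul_measure, abs_inv, smul_eq_mul]

lemma charFun_lin (T : E →ₗ[ℝ] F) (T' : F →ₗ[ℝ] E) (hT : ∀ x t, ⟪T x, t⟫ = ⟪x, T' t⟫) (t : F) :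
    charFun ((stdGaussian E).map T) t = Complex.exp (-‖T' t‖ ^ 2 / 2) := by
  rw [← charFun_stdGaussian, charFun_apply, charFun_apply, integral_map (linmap_meas T).aemeasurable
    (by fun_prop)]
  simp only [hT]

lemma map_gauss (T : E →ₗ[ℝ] F) (T' : F →ₗ[ℝ] E) (hT : ∀ x t, ⟪T x, t⟫ = ⟪x, T' t⟫)
    (R R' : F →ₗ[ℝ] F) (hR : ∀ x t, ⟪R x, t⟫ = ⟪x, R' t⟫) (hTR : ∀ t, ‖T' t‖ ^ 2 = ‖R' t‖ ^ 2) :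
    (stdGaussian E).map T = (stdGaussian F).map R := by
  have : IsProbabilityMeasure ((stdGaussian E).map T) :=
    Measure.isProbabilityMeasure_map (linmap_meas T).aemeasurable
  have : IsProbabilityMeasure ((stdGaussian F).map R) :=
    Measure.isProbabilityMeasure_map (linmap_meas R).aemeasurable
  apply Measure.ext_of_charFun
  ext t
  rw [charFun_lin T T' hT, charFun_lin R R' hR]
  have : (‖T' t‖ : ℂ) ^ 2 = (‖R' t‖ : ℂ) ^ 2 := by exact_mod_cast hTR t
  rw [this]

lemma lint_gauss {k : E → ℝ≥0∞} (hk : Measurable k) :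
    ∫⁻ x, k x ∂(stdGaussian E) = ∫⁻ x, ENNReal.ofReal (gdens E x) * k x := by
  rw [gauss_eq_withDensity,
    lintegral_withDensity_eq_lintegral_mul _ gdens_cont.measurable.ennreal_ofReal hk]
  rfl

/-- Scaled weight. -/
noncomputable def wt (R : F →ₗ[ℝ] F) (hR : LinearMap.det R ≠ 0) (σ : ℝ) (w : F) : ℝ :=
  Real.exp (-(‖(R.equivOfDetNeZero hR).symm w‖ ^ 2 / (2 * σ ^ 2)))

lemma wt_meas (R : F →ₗ[ℝ] F) (hR : LinearMap.det R ≠ 0) (σ : ℝ) : Measurable (wt R hR σ) := by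
  unfold wt
  have := (linmap_meas ((R.equivOfDetNeZero hR).symm : F →ₗ[ℝ] F))
  have h2 : Measurable fun w => (R.equivOfDetNeZero hR).symm w := this
  fun_prop

lemma tau_split {σ : ℝ} (hσ : 0 < σ) (d : ℕ) :
    (2 * Real.pi * σ ^ 2) ^ (-(d / 2 : ℝ)) = (2 * Real.pi) ^ (-(d / 2 : ℝ)) * (σ ^ d)⁻¹ := by
  rw [Real.mul_rpow (by positivity) (by positivity)]
  congr 1
  rw [← Real.rpow_natCast σ 2, ← Real.rpow_mul hσ.le, ← Real.rpow_natCast σ d, ← Real.rpow_neg hσ.le]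
  congr 1
  push_cast
  ring

lemma gauss_scaled (T : E →ₗ[ℝ] F) (T' : F →ₗ[ℝ] E) (hT : ∀ x t, ⟪T x, t⟫ = ⟪x, T' t⟫)
    (R R' : F →ₗ[ℝ] F) (hR : ∀ x t, ⟪R x, t⟫ = ⟪x, R' t⟫) (hTR : ∀ t, ‖T' t‖ ^ 2 = ‖R' t‖ ^ 2)
    (hdet : LinearMap.det R ≠ 0) {σ : ℝ} (hσ : 0 < σ) {H : F → ℝ≥0∞} (hH : Measurable H) :
    ∫⁻ x, H (σ • T x) ∂(stdGaussian E) =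
      ENNReal.ofReal (|LinearMap.det R|⁻¹ * (2 * Real.pi * σ ^ 2) ^ (-(Module.finrank ℝ F / 2 : ℝ)))
        * ∫⁻ w, H w * ENNReal.ofReal (wt R hdet σ w) := by
  have h1 : Measurable fun w : F => H (σ • w) := hH.comp (measurable_const_smul σ)
  rw [← lintegral_map (f := fun w => H (σ • w)) h1 (linmap_meas T), map_gauss T T' hT R R' hR hTR,
    lintegral_map h1 (linmap_meas R), lint_gauss (k := fun a => H (σ • R a)) (h1.comp (linmap_meas R))]
  set L : F →ₗ[ℝ] F := σ • R with hL
  have hLd : LinearMap.det L = σ ^ Module.finrank ℝ F * LinearMap.det R := by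
    rw [hL, LinearMap.det_smul]
  have hLd0 : LinearMap.det L ≠ 0 := by rw [hLd]; positivity
  have h2 := lint_comp L hLd0 (hH.mul (wt_meas R hdet σ).ennreal_ofReal)
  have h3 : ∀ y, ENNReal.ofReal (gdens F y) * H (σ • R y)
      = ENNReal.ofReal ((2 * Real.pi) ^ (-(Module.finrank ℝ F / 2 : ℝ))) *
        (H * fun x => ENNReal.ofReal (wt R hdet σ x)) (L y) := by
    intro y
    have : (R.equivOfDetNeZero hdet).symm (L y) = σ • y := by
      rw [LinearEquiv.symm_apply_eq, map_smul]; rfl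
    have e : wt R hdet σ (L y) = Real.exp (-(‖y‖ ^ 2 / 2)) := by
      rw [wt, this, norm_smul, Real.norm_eq_abs, mul_pow, sq_abs]
      congr 2
      field_simp
    simp only [Pi.mul_apply, Function.comp, e, gdens]
    rw [ENNReal.ofReal_mul (by positivity)]
    simp only [hL, LinearMap.smul_apply]
    ring
  simp_rw [h3]
  rw [lintegral_const_mul' _ _ ENNReal.ofReal_ne_top]
  have h4 : ∀ y, (H * fun x => ENNReal.ofReal (wt R hdet σ x)) y = H y * ENNReal.ofReal (wt R hdet σ y) :=
    fun y => rfl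
  simp_rw [h4] at h2 ⊢
  rw [h2, ← mul_assoc, ← ENNReal.ofReal_mul (by positivity), hLd, tau_split hσ, abs_mul, mul_inv,
    abs_of_pos (pow_pos hσ _)]
  congr 2
  ring

lemma gauss_upper {σ : ℝ} (hσ : 0 < σ) {Q : E → ℝ≥0∞} (hQ : Measurable Q) :
    ∫⁻ x, Q (σ • x) ∂(stdGaussian E) ≤
      ENNReal.ofReal ((2 * Real.pi * σ ^ 2) ^ (-(Module.finrank ℝ E / 2 : ℝ))) * ∫⁻ x, Q x := by
  have hdet : LinearMap.det (σ • (LinearMap.id : E →ₗ[ℝ] E)) = σ ^ Module.finrank ℝ E := by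
    rw [LinearMap.det_smul, LinearMap.det_id, mul_one]
  have h2 := lint_comp (σ • (LinearMap.id : E →ₗ[ℝ] E)) (by rw [hdet]; positivity) hQ
  simp only [LinearMap.smul_apply, LinearMap.id_apply] at h2
  rw [lint_gauss (k := fun x => Q (σ • x)) (hQ.comp (measurable_const_smul σ))]
  calc _ ≤ ∫⁻ x, ENNReal.ofReal ((2 * Real.pi) ^ (-(Module.finrank ℝ E / 2 : ℝ))) * Q (σ • x) := by
        refine lintegral_mono fun x => ?_
        refine mul_le_mul_left (ENNReal.ofReal_le_ofReal ?_) _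
        unfold gdens
        refine mul_le_of_le_one_right (by positivity) ?_
        rw [Real.exp_le_one_iff]
        have := sq_nonneg ‖x‖
        linarith
    _ = _ := by
        rw [lintegral_const_mul' _ _ ENNReal.ofReal_ne_top, h2, hdet, ← mul_assoc,
          ← ENNReal.ofReal_mul (by positivity), tau_split hσ, abs_of_pos (pow_pos hσ _)]

lemma factor_ne_top {Ω : Type*} [MeasurableSpace Ω] {μ : Measure Ω} [NeZero μ] {p : ℝ} (hp : p ≠ 0)
    {g : Ω → ℝ} (hg : Measurable g) (hfin : ∫⁻ x, ENNReal.ofReal (g x) ^ p ∂μ ≠ ⊤) :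
    (∫⁻ x, ENNReal.ofReal (g x) ^ p ∂μ) ^ (1 / p) ≠ ⊤ := by
  rcases lt_or_gt_of_ne hp with h | h
  · have hpos : ∫⁻ x, ENNReal.ofReal (g x) ^ p ∂μ ≠ 0 := by
      intro h0
      rw [lintegral_eq_zero_iff ((hg.ennreal_ofReal).pow_const _)] at h0
      have : ∀ᵐ x ∂μ, False := by
        filter_upwards [h0] with x hx
        simp only [Pi.zero_apply, ENNReal.rpow_eq_zero_iff, ENNReal.ofReal_ne_top, false_and,
          or_false] at hx
        linarith [hx.2]
      simp at this
      exact NeZero.ne μ this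
    intro htop
    rw [ENNReal.rpow_eq_top_iff] at htop
    rcases htop with h' | h'
    · exact hpos h'.1
    · exact hfin h'.1
  · exact ENNReal.rpow_ne_top_of_nonneg (by positivity) hfin

lemma wt_le_one (R : F →ₗ[ℝ] F) (hR : LinearMap.det R ≠ 0) (σ : ℝ) (w : F) : wt R hR σ w ≤ 1 := by
  unfold wt
  rw [Real.exp_le_one_iff, neg_nonpos]
  positivity

lemma wt_tendsto (R : F →ₗ[ℝ] F) (hR : LinearMap.det R ≠ 0) (w : F) :
    Tendsto (fun k : ℕ => wt R hR ((k : ℝ) + 1) w) atTop (𝓝 1) := by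
  unfold wt
  rw [← Real.exp_zero]
  refine (Real.continuous_exp.tendsto _).comp ?_
  rw [← neg_zero]
  refine Tendsto.neg ?_
  refine Tendsto.const_div_atTop ?_ _
  refine Tendsto.const_mul_atTop (by norm_num) ?_
  refine (tendsto_pow_atTop (by norm_num)).comp ?_
  exact tendsto_atTop_add_const_right _ _ tendsto_natCast_atTop_atTop

lemma leb_main {ι : Type*} [Fintype ι] (p : ι → ℝ) (hp : ∀ i, p i ≠ 0)
    (F : ι → Type*) [∀ i, NormedAddCommGroup (F i)] [∀ i, InnerProductSpace ℝ (F i)]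
    [∀ i, FiniteDimensional ℝ (F i)] [∀ i, MeasurableSpace (F i)] [∀ i, BorelSpace (F i)]
    (hsum : ∑ i, (Module.finrank ℝ (F i) : ℝ) / p i = Module.finrank ℝ E)
    (T : ∀ i, E →ₗ[ℝ] F i) (T' : ∀ i, F i →ₗ[ℝ] E) (hT : ∀ i x t, ⟪T i x, t⟫ = ⟪x, T' i t⟫)
    (R R' : ∀ i, F i →ₗ[ℝ] F i) (hR : ∀ i x t, ⟪R i x, t⟫ = ⟪x, R' i t⟫)
    (hTR : ∀ i t, ‖T' i t‖ ^ 2 = ‖R' i t‖ ^ 2) (hdet : ∀ i, LinearMap.det (R i) ≠ 0)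
    (hcond : ∀ v : ∀ i, F i, ∑ i, p i * ‖T' i (v i)‖ ^ 2 ≤ ‖∑ i, T' i (v i)‖ ^ 2)
    (f : ∀ i, F i → ℝ) (hmeas : ∀ i, Measurable (f i)) (hpos : ∀ i x, 0 ≤ f i x)
    (hLp : ∀ i, ∫⁻ z, ENNReal.ofReal (f i z) ^ p i ≠ ⊤) :
    ENNReal.ofReal (∏ i, (|LinearMap.det (R i)|⁻¹) ^ (1 / p i))
      * ∏ i, (∫⁻ z, ENNReal.ofReal (f i z) ^ p i) ^ (1 / p i)
    ≤ ∫⁻ x, ∏ i, ENNReal.ofReal (f i (T i x)) := by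
  have hHm : ∀ i, Measurable fun z => ENNReal.ofReal (f i z) ^ p i :=
    fun i => (hmeas i).ennreal_ofReal.pow_const _
  set Φ : ℝ → ι → ℝ≥0∞ := fun σ i =>
    ∫⁻ w, ENNReal.ofReal (f i w) ^ p i * ENNReal.ofReal (wt (R i) (hdet i) σ w) with hΦ
  have hdom : ∀ σ i w, ENNReal.ofReal (f i w) ^ p i * ENNReal.ofReal (wt (R i) (hdet i) σ w)
      ≤ ENNReal.ofReal (f i w) ^ p i := fun σ i w =>
    mul_le_of_le_one_right' (by rw [ENNReal.ofReal_le_one]; exact wt_le_one _ _ _ _)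
  have hΦle : ∀ σ i, Φ σ i ≠ ⊤ := fun σ i =>
    ne_top_of_le_ne_top (hLp i) (lintegral_mono (hdom σ i))
  have hVc : ∀ b : ι → E, (∀ i, b i ∈ LinearMap.range (T' i)) →
      ∑ i, (1 / p i) * ‖b i‖ ^ 2 ≤ ‖∑ i, (1 / p i) • b i‖ ^ 2 := by
    intro b hb
    choose v hv using hb
    have := hcond fun i => (1 / p i) • v i
    simp only [map_smul, hv, norm_smul] at this
    refine le_trans (le_of_eq ?_) this
    refine Finset.sum_congr rfl fun i _ => ?_
    rw [mul_pow, Real.norm_eq_abs, sq_abs]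
    field_simp [hp i]
  have main : ∀ σ : ℝ, 0 < σ → ENNReal.ofReal (∏ i, (|LinearMap.det (R i)|⁻¹) ^ (1 / p i))
      * ∏ i, (Φ σ i) ^ (1 / p i) ≤ ∫⁻ x, ∏ i, ENNReal.ofReal (f i (T i x)) := by
    intro σ hσ
    set τ : ℝ := 2 * Real.pi * σ ^ 2 with hτ
    have hτ0 : 0 < τ := by positivity
    have hr : ∀ i, 0 < |LinearMap.det (R i)|⁻¹ := fun i => by
      have := hdet i
      positivity
    have sc : ∀ i, ∫⁻ x, ENNReal.ofReal (f i (σ • T i x)) ^ (p i) ∂(stdGaussian E) =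
        ENNReal.ofReal (|LinearMap.det (R i)|⁻¹ * τ ^ (-(Module.finrank ℝ (F i) / 2 : ℝ))) * Φ σ i :=
      fun i => gauss_scaled (T i) (T' i) (hT i) (R i) (R' i) (hR i) (hTR i) (hdet i) hσ (hHm i)
    have g := gauss_c p hp (fun i => LinearMap.range (T' i)) hVc (fun i x => f i (σ • T i x))
      (fun i => (hmeas i).comp ((linmap_meas (T i)).const_smul σ)) (fun i x => hpos i _)
      (fun i => by rw [sc]; exact ENNReal.mul_ne_top ENNReal.ofReal_ne_top (hΦle σ i))
      (fun i x k hk => by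
        have : T i k = 0 := by
          have h := (Submodule.mem_orthogonal' _ _).1 hk (T' i (T i k)) ⟨_, rfl⟩
          rw [← hT] at h
          exact inner_self_eq_zero.1 h
        simp only [map_add, this, add_zero])
    have up := gauss_upper (E := E) hσ (Q := fun x => ∏ i, ENNReal.ofReal (f i (T i x)))
      (Finset.measurable_prod _ fun i _ => ((hmeas i).comp (linmap_meas (T i))).ennreal_ofReal)
    simp only [map_smul] at up
    have g2 := g.trans up
    simp only [sc] at g2
    have e : ∀ i, (ENNReal.ofReal (|LinearMap.det (R i)|⁻¹ * τ ^ (-(Module.finrank ℝ (F i) / 2 : ℝ)))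
        * Φ σ i) ^ (1 / p i) = ENNReal.ofReal ((|LinearMap.det (R i)|⁻¹) ^ (1 / p i)
          * τ ^ (-(Module.finrank ℝ (F i) / p i / 2 : ℝ))) * (Φ σ i) ^ (1 / p i) := by
      intro i
      have := hr i
      rw [ENNReal.mul_rpow_of_ne_top ENNReal.ofReal_ne_top (hΦle σ i),
        ENNReal.ofReal_rpow_of_pos (by positivity), Real.mul_rpow (by positivity) (by positivity),
        ← Real.rpow_mul hτ0.le]
      congr 4
      ring
    simp only [e] at g2
    rw [Finset.prod_mul_distrib, ← ENNReal.ofReal_prod_of_nonneg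
      (fun i _ => by have := hr i; positivity), Finset.prod_mul_distrib,
      ← Real.rpow_sum_of_pos hτ0, Finset.sum_neg_distrib, ← Finset.sum_div, hsum,
      ENNReal.ofReal_mul (Finset.prod_nonneg fun i _ => by have := hr i; positivity),
      mul_comm (ENNReal.ofReal _) (ENNReal.ofReal (τ ^ _)), mul_assoc] at g2
    exact (ENNReal.mul_le_mul_iff_right (by simp; positivity) ENNReal.ofReal_ne_top).1 g2
  refine le_of_tendsto' (f := fun k : ℕ => ENNReal.ofReal (∏ i, (|LinearMap.det (R i)|⁻¹) ^ (1 / p i))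
      * ∏ i, (Φ ((k : ℝ) + 1) i) ^ (1 / p i)) (x := atTop) ?_ fun k => main _ (by positivity)
  refine ENNReal.Tendsto.const_mul ?_ (Or.inr ENNReal.ofReal_ne_top)
  refine ENNReal.tendsto_finsetProd_of_ne_top _ (fun i _ => ?_)
    (fun i _ => factor_ne_top (hp i) (hmeas i) (hLp i))
  refine (ENNReal.continuous_rpow_const.tendsto _).comp ?_
  refine tendsto_lintegral_of_dominated_convergence (fun w => ENNReal.ofReal (f i w) ^ p i)
    (fun k => (hHm i).mul (wt_meas _ _ _).ennreal_ofReal) (fun k => ae_of_all _ (hdom _ i)) (hLp i)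
    (ae_of_all _ fun w => ?_)
  have := ENNReal.Tendsto.const_mul (a := ENNReal.ofReal (f i w) ^ p i)
    (ENNReal.tendsto_ofReal (wt_tendsto (R i) (hdet i) w)) (Or.inl (by simp))
  simpa using this

end leb
end RevYoung

namespace RevYoung
open Filter Topology ProbabilityTheory
open scoped RealInnerProductSpace

section mat

open scoped MatrixOrder in
lemma exists_root {n : ℕ} {A : Matrix (Fin n) (Fin n) ℝ} (hA : A.PosDef) :
    ∃ R : Matrix (Fin n) (Fin n) ℝ, A = R * Rᵀ ∧ R.det ≠ 0 ∧ |R.det| = Real.sqrt A.det := by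
  obtain ⟨y, rfl⟩ := CStarAlgebra.nonneg_iff_eq_star_mul_self.mp hA.posSemidef.nonneg
  have hd := hA.det_pos
  have e : (star y * y).det = y.det ^ 2 := by
    rw [Matrix.det_mul, star_eq_conjTranspose, Matrix.det_conjTranspose]; simp [sq]
  refine ⟨yᵀ, ?_, ?_, ?_⟩
  · rw [transpose_transpose, star_eq_conjTranspose, conjTranspose_eq_transpose_of_trivial]
  · rw [det_transpose]
    intro h
    rw [e, h] at hd
    simp at hd
  · rw [e, Real.sqrt_sq_eq_abs, det_transpose]

lemma vecMul_inj {k n : ℕ} {U : Matrix (Fin k) (Fin n) ℝ} (h : U.rank = k) :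
    Function.Injective U.vecMul := by
  rw [Matrix.vecMul_injective_iff, linearIndependent_iff_card_eq_finrank_span, Fintype.card_fin]
  rw [Matrix.rank_eq_finrank_span_row] at h
  exact h.symm

lemma inner_mat {k n : ℕ} (M : Matrix (Fin k) (Fin n) ℝ) (x : EuclideanSpace ℝ (Fin n))
    (t : EuclideanSpace ℝ (Fin k)) :
    ⟪toEuclideanLin M x, t⟫ = ⟪x, toEuclideanLin Mᵀ t⟫ := by
  simp only [EuclideanSpace.inner_eq_star_dotProduct, ofLp_toEuclideanLin_apply, star_trivial]
  rw [dotProduct_mulVec, mulVec_transpose]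

lemma norm_mat {k n : ℕ} (M : Matrix (Fin k) (Fin n) ℝ) (t : EuclideanSpace ℝ (Fin k)) :
    ‖toEuclideanLin Mᵀ t‖ ^ 2 = t.ofLp ⬝ᵥ ((M * Mᵀ) *ᵥ t.ofLp) := by
  rw [← real_inner_self_eq_norm_sq, ← inner_mat]
  simp only [EuclideanSpace.inner_eq_star_dotProduct, ofLp_toEuclideanLin_apply, star_trivial,
    mulVec_mulVec]

lemma p_ne_zero {k : ℕ} (hk : 0 < k) {p : ℝ} {f : (Fin k → ℝ) → ℝ}
    (h : ∫⁻ z, ENNReal.ofReal (f z) ^ p ≠ ⊤) : p ≠ 0 := by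
  rintro rfl
  apply h
  have : Nonempty (Fin k) := ⟨⟨0, hk⟩⟩
  have : NoncompactSpace (Fin k → ℝ) := NormedSpace.noncompactSpace ℝ _
  simp only [ENNReal.rpow_zero, lintegral_const, one_mul]
  exact measure_univ_of_isAddLeftInvariant _

lemma cond_mat {n m : ℕ} (nn : Fin m → ℕ) (p : Fin m → ℝ)
    (U : ∀ i, Matrix (Fin (nn i)) (Fin n) ℝ)
    (bigU : Matrix (Σ i : Fin m, Fin (nn i)) (Fin n) ℝ)
    (hbigU : ∀ a k, bigU a k = U a.1 a.2 k)
    (S : Matrix (Fin n) (Fin n) ℝ)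
    (PD : Matrix (Σ i : Fin m, Fin (nn i)) (Σ i : Fin m, Fin (nn i)) ℝ)
    (hPD : ∀ a b, PD a b = if a.1 = b.1 then p a.1 * (bigU * (S * Sᵀ) * bigUᵀ) a b else 0)
    (hcond : (bigU * (S * Sᵀ) * bigUᵀ - PD).PosSemidef)
    (v : ∀ i, EuclideanSpace ℝ (Fin (nn i))) :
    ∑ i, p i * ‖toEuclideanLin (U i * S)ᵀ (v i)‖ ^ 2
      ≤ ‖∑ i, toEuclideanLin (U i * S)ᵀ (v i)‖ ^ 2 := by
  set q : Fin m → Fin n → ℝ := fun i k => ∑ a, (U i * S) a k * v i a with hq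
  have hqk : ∀ i k, (toEuclideanLin (U i * S)ᵀ (v i)) k = q i k := by
    intro i k
    rw [ofLp_toEuclideanLin_apply]
    rfl
  have hM : ∀ a b, (bigU * (S * Sᵀ) * bigUᵀ) a b
      = ∑ k, (U a.1 * S) a.2 k * (U b.1 * S) b.2 k := by
    intro a b
    have e : bigU * (S * Sᵀ) * bigUᵀ = (bigU * S) * (bigU * S)ᵀ := by
      rw [transpose_mul]; simp only [Matrix.mul_assoc]
    have e2 : ∀ a k, (bigU * S) a k = (U a.1 * S) a.2 k := by
      intro a k
      simp only [Matrix.mul_apply, hbigU]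
    rw [e, Matrix.mul_apply]
    simp only [transpose_apply, e2]
  have blk : ∀ i j, ∑ a, ∑ b, v i a * (∑ k, (U i * S) a k * (U j * S) b k) * v j b
      = ∑ k, q i k * q j k := by
    intro i j
    simp only [hq, Finset.sum_mul_sum, Finset.mul_sum, Finset.sum_mul]
    have : ∀ a, ∑ b, ∑ k, v i a * ((U i * S) a k * (U j * S) b k) * v j b
        = ∑ k, ∑ b, v i a * ((U i * S) a k * (U j * S) b k) * v j b := fun a => Finset.sum_comm
    simp only [this]
    rw [Finset.sum_comm]
    refine Finset.sum_congr rfl fun k _ => ?_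
    rw [Finset.sum_comm]
    refine Finset.sum_congr rfl fun b _ => Finset.sum_congr rfl fun a _ => ?_
    ring
  have h := hcond.dotProduct_mulVec_nonneg (fun a => v a.1 a.2)
  rw [star_trivial, sub_mulVec, dotProduct_sub, sub_nonneg] at h
  have l : (fun a : (Σ i : Fin m, Fin (nn i)) => v a.1 a.2) ⬝ᵥ
      (bigU * (S * Sᵀ) * bigUᵀ) *ᵥ (fun a => v a.1 a.2) = ∑ i, ∑ j, ∑ k, q i k * q j k := by
    simp only [dotProduct, mulVec, hM, Finset.mul_sum, Fintype.sum_sigma]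
    refine Finset.sum_congr rfl fun i _ => ?_
    rw [Finset.sum_comm]
    refine Finset.sum_congr rfl fun j _ => ?_
    rw [← blk]
    refine Finset.sum_congr rfl fun a _ => Finset.sum_congr rfl fun b _ => ?_
    ring
  have r : (fun a : (Σ i : Fin m, Fin (nn i)) => v a.1 a.2) ⬝ᵥ
      PD *ᵥ (fun a => v a.1 a.2) = ∑ i, p i * ∑ k, q i k * q i k := by
    simp only [dotProduct, mulVec, hPD, hM, Finset.mul_sum, Fintype.sum_sigma]
    refine Finset.sum_congr rfl fun i _ => ?_
    rw [← Finset.mul_sum, ← blk, Finset.mul_sum]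
    refine Finset.sum_congr rfl fun a _ => ?_
    rw [Finset.sum_eq_single i]
    · simp only [if_true, Finset.mul_sum]
      refine Finset.sum_congr rfl fun b _ => ?_
      rw [Finset.sum_mul, Finset.mul_sum, Finset.sum_mul, Finset.mul_sum]
      refine Finset.sum_congr rfl fun k _ => ?_
      ring
    · intro j _ hj
      simp [Ne.symm hj]
    · simp
  rw [l, r] at h
  have n1 : ∀ i, ‖toEuclideanLin (U i * S)ᵀ (v i)‖ ^ 2 = ∑ k, q i k * q i k := by
    intro i
    rw [EuclideanSpace.real_norm_sq_eq]
    simp only [hqk, sq]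
  have n2 : ‖∑ i, toEuclideanLin (U i * S)ᵀ (v i)‖ ^ 2 = ∑ i, ∑ j, ∑ k, q i k * q j k := by
    rw [EuclideanSpace.real_norm_sq_eq]
    simp only [WithLp.ofLp_sum, Finset.sum_apply, hqk, sq, Finset.sum_mul_sum]
    rw [Finset.sum_comm]
    exact Finset.sum_congr rfl fun i _ => Finset.sum_comm
  simp only [n1, n2]
  exact h

end mat
end RevYoung

theorem stmt11
    (n m : ℕ) (hn : 0 < n) (hm : 0 < m)
    (nn : Fin m → ℕ) (hnn : ∀ i, 0 < nn i) (hnnle : ∀ i, nn i ≤ n)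
    (p : Fin m → ℝ) (hsum : ∑ i, (nn i : ℝ) / p i = n)
    (U : ∀ i, Matrix (Fin (nn i)) (Fin n) ℝ) (hUrank : ∀ i, (U i).rank = nn i)
    (bigU : Matrix (Σ i : Fin m, Fin (nn i)) (Fin n) ℝ)
    (hbigU : ∀ a k, bigU a k = U a.1 a.2 k)
    (B : Matrix (Fin n) (Fin n) ℝ) (hB : B.PosDef)
    (PD : Matrix (Σ i : Fin m, Fin (nn i)) (Σ i : Fin m, Fin (nn i)) ℝ)
    (hPD : ∀ a b, PD a b = if a.1 = b.1 then p a.1 * (bigU * B * bigUᵀ) a b else 0)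
    (hcond : (bigU * B * bigUᵀ - PD).PosSemidef)
    (f : ∀ i, (Fin (nn i) → ℝ) → ℝ) (hmeas : ∀ i, Measurable (f i))
    (hpos : ∀ i x, 0 ≤ f i x)
    (hLp : ∀ i, ∫⁻ z, ENNReal.ofReal (f i z) ^ p i ≠ ⊤) :
    ENNReal.ofReal
        (Real.sqrt (B.det / ∏ i, (U i * B * (U i)ᵀ).det ^ (1 / p i)))
      * ∏ i, (∫⁻ z, ENNReal.ofReal (f i z) ^ p i) ^ (1 / p i)
    ≤ ∫⁻ x, ∏ i, ENNReal.ofReal (f i ((U i).mulVec x)) := by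
  have hp : ∀ i, p i ≠ 0 := fun i => RevYoung.p_ne_zero (hnn i) (hLp i)
  have hA : ∀ i, (U i * B * (U i)ᵀ).PosDef := fun i => by
    have := hB.mul_mul_conjTranspose_same (RevYoung.vecMul_inj (hUrank i))
    rwa [conjTranspose_eq_transpose_of_trivial] at this
  obtain ⟨S, hS, hSd, hSabs⟩ := RevYoung.exists_root hB
  choose R hR hRd hRabs using fun i => RevYoung.exists_root (hA i)
  have hch : ∀ (k : ℕ) (h : (Fin k → ℝ) → ℝ≥0∞), Measurable h →
      ∫⁻ z : EuclideanSpace ℝ (Fin k), h z.ofLp = ∫⁻ z, h z := fun k h hh =>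
    (PiLp.volume_preserving_ofLp (Fin k)).lintegral_comp hh
  have hHm : ∀ i, Measurable fun z => ENNReal.ofReal (f i z) ^ p i :=
    fun i => (hmeas i).ennreal_ofReal.pow_const _
  have hQm : Measurable fun x => ∏ i, ENNReal.ofReal (f i ((U i).mulVec x)) :=
    Finset.measurable_prod _ fun i _ => ((hmeas i).comp
      (Continuous.measurable (by fun_prop))).ennreal_ofReal
  have key := RevYoung.leb_main (E := EuclideanSpace ℝ (Fin n)) p hp
    (fun i => EuclideanSpace ℝ (Fin (nn i))) (by simpa using hsum)
    (fun i => toEuclideanLin (U i * S)) (fun i => toEuclideanLin (U i * S)ᵀ)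
    (fun i => RevYoung.inner_mat _) (fun i => toEuclideanLin (R i)) (fun i => toEuclideanLin (R i)ᵀ)
    (fun i => RevYoung.inner_mat _)
    (fun i t => by
      rw [RevYoung.norm_mat, RevYoung.norm_mat, ← hR i, hS, transpose_mul]
      simp only [Matrix.mul_assoc])
    (fun i => by rw [LinearMap.det_toLpLin]; exact hRd i)
    (RevYoung.cond_mat nn p U bigU hbigU S PD (by rw [← hS]; exact hPD) (by rw [← hS]; exact hcond))
    (fun i z => f i z.ofLp) (fun i => (hmeas i).comp (PiLp.volume_preserving_ofLp _).measurable)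
    (fun i x => hpos i _)
    (fun i => by rw [hch _ (fun z => ENNReal.ofReal (f i z) ^ p i) (hHm i)]; exact hLp i)
  simp only [LinearMap.det_toLpLin] at key
  simp only [fun i => hch _ (fun z => ENNReal.ofReal (f i z) ^ p i) (hHm i)] at key
  have cv : ∫⁻ x : EuclideanSpace ℝ (Fin n), ∏ i, ENNReal.ofReal (f i (toEuclideanLin (U i * S) x).ofLp)
      = ENNReal.ofReal |S.det|⁻¹ * ∫⁻ x, ∏ i, ENNReal.ofReal (f i ((U i).mulVec x)) := by
    have := RevYoung.lint_comp (toEuclideanLin S) (by rw [LinearMap.det_toLpLin]; exact hSd)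
      (k := fun x => ∏ i, ENNReal.ofReal (f i ((U i).mulVec x.ofLp)))
      (hQm.comp (PiLp.volume_preserving_ofLp _).measurable)
    rw [hch n (fun x => ∏ i, ENNReal.ofReal (f i ((U i).mulVec x))) hQm, LinearMap.det_toLpLin] at this
    rw [← this]
    simp only [ofLp_toEuclideanLin_apply, mulVec_mulVec]
  rw [cv] at key
  have hSp : 0 < |S.det| := abs_pos.2 hSd
  have k2 := mul_le_mul_right key (ENNReal.ofReal |S.det|)
  rw [← mul_assoc, ← mul_assoc, ← ENNReal.ofReal_mul hSp.le, ← ENNReal.ofReal_mul hSp.le,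
    mul_inv_cancel₀ hSp.ne', ENNReal.ofReal_one, one_mul] at k2
  refine le_trans (le_of_eq ?_) k2
  congr 2
  have e : ∀ i, (|(R i).det|⁻¹) ^ (1 / p i) = (Real.sqrt ((U i * B * (U i)ᵀ).det ^ (1 / p i)))⁻¹ := by
    intro i
    have := (hA i).det_pos
    rw [hRabs, Real.inv_rpow (Real.sqrt_nonneg _), Real.sqrt_eq_rpow, Real.sqrt_eq_rpow,
      ← Real.rpow_mul this.le, ← Real.rpow_mul this.le, mul_comm]
  simp only [e]
  rw [Finset.prod_inv_distrib, hSabs, Real.sqrt_div hB.det_pos.le, div_eq_mul_inv,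
    Real.sqrt_prod _ (fun i _ => Real.rpow_nonneg (hA i).det_pos.le _)]
end

section
/- (Brascamp–Lieb inequality, Gaussian-extremizable form.) Assume (A1) and (A2). Then for all nonnegative measurable functions fᵢ on ℝ^{nᵢ}, 1 ≤ i ≤ m, ∫_{ℝⁿ} ∏_{i=1}^m fᵢ(Uᵢx) dx ≤ ( det(A) / ∏_{i=1}^m det(Aᵢ)^{cᵢ} )^{1/2} · ∏_{i=1}^m ‖fᵢ‖_{1/cᵢ}. Moreover, equality holds when fᵢ(xᵢ) = exp(−cᵢ⟨Aᵢ⁻¹xᵢ, xᵢ⟩) for each i. -/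
open MeasureTheory Matrix
open scoped ENNReal

namespace BL
open ProbabilityTheory
open scoped RealInnerProductSpace

section Gauss
variable {E F : Type*} [NormedAddCommGroup E] [InnerProductSpace ℝ E] [FiniteDimensional ℝ E]
  [MeasurableSpace E] [BorelSpace E]
  [NormedAddCommGroup F] [InnerProductSpace ℝ F] [FiniteDimensional ℝ F]
  [MeasurableSpace F] [BorelSpace F]

lemma map_coisom (W : E →L[ℝ] F) (V : F →L[ℝ] E) (hadj : ∀ x y, ⟪W x, y⟫ = ⟪x, V y⟫)
    (hV : ∀ y, ‖V y‖ = ‖y‖) : (stdGaussian E).map W = stdGaussian F := by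
  have : IsProbabilityMeasure ((stdGaussian E).map W) :=
    Measure.isProbabilityMeasure_map (by fun_prop)
  apply Measure.ext_of_charFun
  ext t
  rw [charFun_stdGaussian, charFun_apply, integral_map (by fun_prop)
    (Measurable.aestronglyMeasurable (by fun_prop))]
  simp_rw [hadj]
  rw [← charFun_apply, charFun_stdGaussian, hV]

lemma map_semigroup (a b : ℝ) (ha : 0 ≤ a) (hb : 0 ≤ b) :
    ((stdGaussian E).prod (stdGaussian E)).map (fun p : E × E => √a • p.1 + √b • p.2)
      = (stdGaussian E).map (fun x => √(a + b) • x) := by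
  have hm : Measurable (fun p : E × E => √a • p.1 + √b • p.2) := by fun_prop
  have hm2 : Measurable (fun x : E => √(a + b) • x) := by fun_prop
  have : IsProbabilityMeasure (((stdGaussian E).prod (stdGaussian E)).map
      (fun p : E × E => √a • p.1 + √b • p.2)) :=
    Measure.isProbabilityMeasure_map hm.aemeasurable
  have : IsProbabilityMeasure ((stdGaussian E).map (fun x => √(a + b) • x)) :=
    Measure.isProbabilityMeasure_map hm2.aemeasurable
  apply Measure.ext_of_charFun
  ext t
  rw [charFun_map_smul, charFun_stdGaussian, charFun_apply, integral_map hm.aemeasurable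
    (Measurable.aestronglyMeasurable (by fun_prop))]
  have : ∀ p : E × E, Complex.exp ((⟪√a • p.1 + √b • p.2, t⟫ : ℝ) * Complex.I)
      = Complex.exp ((⟪p.1, √a • t⟫ : ℝ) * Complex.I)
        * Complex.exp ((⟪p.2, √b • t⟫ : ℝ) * Complex.I) := by
    intro p
    rw [← Complex.exp_add, inner_add_left, real_inner_smul_left, real_inner_smul_left,
      real_inner_smul_right, real_inner_smul_right]
    push_cast
    ring_nf
  simp_rw [this]
  rw [integral_prod_mul (fun x : E => Complex.exp ((⟪x, √a • t⟫ : ℝ) * Complex.I))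
    (fun x : E => Complex.exp ((⟪x, √b • t⟫ : ℝ) * Complex.I)), ← charFun_apply, ← charFun_apply,
    charFun_stdGaussian, charFun_stdGaussian, ← Complex.exp_add]
  congr 1
  simp only [norm_smul, Real.norm_eq_abs, abs_of_nonneg (Real.sqrt_nonneg _)]
  norm_cast
  rw [mul_pow, mul_pow, mul_pow, Real.sq_sqrt ha, Real.sq_sqrt hb, Real.sq_sqrt (by positivity)]
  push_cast
  ring

lemma integral_inner_sq (a : E) : ∫ x, ⟪a, x⟫ ^ 2 ∂(stdGaussian E) = ‖a‖ ^ 2 := by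
  have h := variance_dual_stdGaussian (E := E) (innerSL ℝ a)
  rw [variance_eq_integral (by fun_prop), integral_strongDual_stdGaussian] at h
  simpa using h

lemma memLp_norm (p : ℝ≥0∞) (hp : p ≠ ∞) : MemLp (fun x : E => 1 + ‖x‖) p (stdGaussian E) :=
  (memLp_const (1:ℝ)).add (IsGaussian.memLp_id (stdGaussian E) p hp).norm

lemma integrable_pow (k : ℕ) : Integrable (fun x : E => (1 + ‖x‖) ^ k) (stdGaussian E) := by
  have h := (memLp_norm (E := E) k (by simp)).integrable_norm_pow'
  refine h.congr (Filter.Eventually.of_forall fun x => ?_)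
  simp only [Real.norm_eq_abs]
  rw [abs_of_nonneg (by positivity)]

lemma integrable_inner_sq (a : E) : Integrable (fun x : E => ⟪a, x⟫ ^ 2) (stdGaussian E) := by
  have := IsGaussian.memLp_dual (stdGaussian E) (innerSL ℝ a) 2 (by simp)
  simpa using this.integrable_sq

lemma stdGaussian_eq_withDensity :
    stdGaussian E = (volume : Measure E).withDensity
      (fun x => ENNReal.ofReal ((2 * Real.pi) ^ (-(Module.finrank ℝ E / 2 : ℝ))
        * Real.exp (-(1/2) * ‖x‖ ^ 2))) := by
  set K : ℝ := (2 * Real.pi) ^ (-(Module.finrank ℝ E / 2 : ℝ)) with hK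
  have hKpos : 0 < K := by positivity
  have hInt : Integrable (fun x : E => Real.exp (-(1/2) * ‖x‖ ^ 2)) := by
    have h := (GaussianFourier.integrable_cexp_neg_mul_sq_norm_add (V := E) (b := ((1/2 : ℝ) : ℂ))
      (by simp) 0 0).norm
    refine h.congr (Filter.Eventually.of_forall fun x => ?_)
    simp only [Complex.norm_exp]
    congr 1
    norm_cast
    simp [← Complex.ofReal_pow]
  have htot : ∫ x : E, K * Real.exp (-(1/2) * ‖x‖ ^ 2) = 1 := by
    rw [integral_const_mul, GaussianFourier.integral_rexp_neg_mul_sq_norm (by norm_num), hK,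
      show Real.pi / (1/2) = 2 * Real.pi by ring, ← Real.rpow_add (by positivity)]
    simp
  have hdm : Measurable (fun x : E => ENNReal.ofReal (K * Real.exp (-(1/2) * ‖x‖ ^ 2))) := by
    fun_prop
  have : IsFiniteMeasure ((volume : Measure E).withDensity
      (fun x => ENNReal.ofReal (K * Real.exp (-(1/2) * ‖x‖ ^ 2)))) :=
    isFiniteMeasure_withDensity_ofReal (hInt.const_mul K).2
  apply Measure.ext_of_charFun
  ext t
  rw [charFun_stdGaussian, charFun_apply,
    integral_withDensity_eq_integral_toReal_smul hdm (by simp)]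
  have : ∀ x : E, (ENNReal.ofReal (K * Real.exp (-(1/2) * ‖x‖ ^ 2))).toReal
      • Complex.exp ((⟪x, t⟫ : ℝ) * Complex.I)
      = (K : ℂ) * Complex.exp (-((1/2 : ℝ) : ℂ) * ‖x‖ ^ 2 + Complex.I * (⟪t, x⟫ : ℝ)) := by
    intro x
    rw [ENNReal.toReal_ofReal (by positivity), Complex.real_smul, Complex.exp_add,
      real_inner_comm t x]
    push_cast
    ring_nf
  simp_rw [this]
  rw [integral_const_mul, GaussianFourier.integral_cexp_neg_mul_sq_norm_add (by simp), ← mul_assoc]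
  have h1 : (K : ℂ) * ((Real.pi : ℂ) / ((1/2 : ℝ) : ℂ)) ^ (Module.finrank ℝ E / 2 : ℂ) = 1 := by
    have h2 : K * (2 * Real.pi) ^ ((Module.finrank ℝ E / 2 : ℝ)) = 1 := by
      rw [hK, ← Real.rpow_add (by positivity)]; simp
    clear_value K
    have h3 := congrArg Complex.ofReal h2
    rw [Complex.ofReal_mul, Complex.ofReal_cpow (by positivity), Complex.ofReal_one] at h3
    refine Eq.trans ?_ h3
    have e1 : (Real.pi : ℂ) / ((1/2 : ℝ) : ℂ) = ((2 * Real.pi : ℝ) : ℂ) := by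
      push_cast; ring
    rw [e1]
    push_cast
    ring
  rw [h1, one_mul]
  congr 1
  rw [Complex.I_sq]
  push_cast
  ring

end Gauss
end BL

namespace BL

lemma log_one_add_le (s : ℝ) (hs : -1 < s) :
    Real.log (1 + s) ≤ s - s ^ 2 / 2 + |s| ^ 3 := by
  set h : ℝ → ℝ := fun s => s - s ^ 2 / 2 + s ^ 3 / 3 - Real.log (1 + s) with hh
  have hd : ∀ x, -1 < x → HasDerivAt h (x ^ 3 / (1 + x)) x := by
    intro x hx
    have h1 : (1 + x) ≠ 0 := by linarith
    have hl : HasDerivAt (fun x : ℝ => Real.log (1 + x)) (1 / (1 + x)) x :=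
      ((hasDerivAt_id x).const_add 1).log h1
    have := (((hasDerivAt_id x).sub ((hasDerivAt_pow 2 x).div_const 2)).add
      ((hasDerivAt_pow 3 x).div_const 3)).sub hl
    refine HasDerivAt.congr_deriv this ?_
    field_simp
    norm_num
    ring
  have h0 : h 0 = 0 := by simp [hh]
  have key : 0 ≤ h s := by
    rw [← h0]
    rcases le_total 0 s with hs0 | hs0
    · refine monotoneOn_of_deriv_nonneg (convex_Icc 0 s) ?_ ?_ ?_ (by simp [hs0]) (by simp [hs0]) hs0
      · exact fun x hx => (hd x (by linarith [hx.1])).continuousAt.continuousWithinAt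
      · intro x hx
        rw [interior_Icc] at hx
        exact (hd x (by linarith [hx.1])).differentiableAt.differentiableWithinAt
      · intro x hx
        rw [interior_Icc] at hx
        rw [(hd x (by linarith [hx.1])).deriv]
        have := hx.1
        positivity
    · refine antitoneOn_of_deriv_nonpos (convex_Icc s 0) ?_ ?_ ?_ (by simp [hs0]) (by simp [hs0]) hs0
      · exact fun x hx => (hd x (by linarith [hx.1])).continuousAt.continuousWithinAt
      · intro x hx
        rw [interior_Icc] at hx
        exact (hd x (by linarith [hx.1])).differentiableAt.differentiableWithinAt
      · intro x hx
        rw [interior_Icc] at hx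
        rw [(hd x (by linarith [hx.1])).deriv]
        apply div_nonpos_of_nonpos_of_nonneg
        · have := hx.2
          have : 0 ≤ (-x) ^ 3 := by
            apply pow_nonneg; linarith
          nlinarith
        · linarith [hx.1]
  have h3 : s ^ 3 / 3 ≤ |s| ^ 3 := by
    have h1 : s ^ 3 ≤ |s| ^ 3 := by rw [← abs_pow]; exact le_abs_self _
    have h2 : 0 ≤ |s| ^ 3 := by positivity
    linarith
  simp only [hh] at key
  linarith

lemma exp_le_taylor (u : ℝ) : Real.exp u ≤ 1 + u + u ^ 2 / 2 + |u| ^ 3 * Real.exp |u| := by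
  have h := Complex.norm_exp_sub_sum_le_norm_mul_exp (u : ℂ) 3
  have h2 : (Complex.exp u - ∑ m ∈ Finset.range 3, (u : ℂ) ^ m / m.factorial)
    = ((Real.exp u - (1 + u + u ^ 2 / 2) : ℝ) : ℂ) := by
    simp [Finset.sum_range_succ]
  rw [h2, Complex.norm_real, Complex.norm_real] at h
  have := le_abs_self (Real.exp u - (1 + u + u ^ 2 / 2))
  simp only [Real.norm_eq_abs] at h
  linarith

set_option maxHeartbeats 800000 in
lemma prod_rpow_le {ι : Type*} [Fintype ι] (c : ι → ℝ) (hc : ∀ i, 0 ≤ c i) (R : ℝ) (hR : 0 ≤ R) :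
    ∃ C : ℝ, 0 ≤ C ∧ ∀ (s : ι → ℝ) (σ : ℝ), 0 ≤ σ → (∀ i, -1 < s i) → (∀ i, |s i| ≤ R) →
      (∀ i, |s i| ≤ σ) →
      ∏ i, (1 + s i) ^ (c i) ≤
        1 + ∑ i, c i * s i + ((∑ i, c i * s i) ^ 2 - ∑ i, c i * s i ^ 2) / 2 + C * σ ^ 3 := by
  set S := ∑ i, c i with hS
  have hS0 : 0 ≤ S := Finset.sum_nonneg fun i _ => hc i
  set L := S * (1 + R + R ^ 2) with hL
  have hL0 : 0 ≤ L := by positivity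
  set C := S + S * (1 + R) * L + L ^ 3 * Real.exp (L * R) with hC
  have hC0 : 0 ≤ C := by positivity
  refine ⟨C, hC0, ?_⟩
  have main : ∀ (s : ι → ℝ) (σ : ℝ), 0 ≤ σ → σ ≤ R → (∀ i, -1 < s i) → 
      (∀ i, |s i| ≤ σ) →
      ∏ i, (1 + s i) ^ (c i) ≤
        1 + ∑ i, c i * s i + ((∑ i, c i * s i) ^ 2 - ∑ i, c i * s i ^ 2) / 2 + C * σ ^ 3 := by
    intro s σ hσ hσR hs1 hs
    set v := ∑ i, c i * s i with hv
    set w := ∑ i, c i * s i ^ 2 with hw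
    set t := ∑ i, c i * |s i| ^ 3 with ht
    have hvb : |v| ≤ S * σ := by
      rw [hv, hS, Finset.sum_mul]
      refine (Finset.abs_sum_le_sum_abs _ _).trans (Finset.sum_le_sum fun i _ => ?_)
      rw [abs_mul, abs_of_nonneg (hc i)]
      exact mul_le_mul_of_nonneg_left (hs i) (hc i)
    have hw0 : 0 ≤ w := Finset.sum_nonneg fun i _ => mul_nonneg (hc i) (sq_nonneg _)
    have hwb : w ≤ S * σ ^ 2 := by
      rw [hw, hS, Finset.sum_mul]
      refine (Finset.sum_le_sum fun i _ => ?_)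
      refine mul_le_mul_of_nonneg_left ?_ (hc i)
      rw [← sq_abs]
      exact pow_le_pow_left₀ (abs_nonneg _) (hs i) 2
    have ht0 : 0 ≤ t := Finset.sum_nonneg fun i _ => mul_nonneg (hc i) (by positivity)
    have htb : t ≤ S * σ ^ 3 := by
      rw [ht, hS, Finset.sum_mul]
      refine (Finset.sum_le_sum fun i _ => ?_)
      refine mul_le_mul_of_nonneg_left ?_ (hc i)
      exact pow_le_pow_left₀ (abs_nonneg _) (hs i) 3
    set u := v - w / 2 + t with hu
    have h1 : ∏ i, (1 + s i) ^ (c i) ≤ Real.exp u := by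
      have : u = ∑ i, c i * (s i - s i ^ 2 / 2 + |s i| ^ 3) := by
        rw [hu, hv, hw, ht, Finset.sum_div, ← Finset.sum_sub_distrib, ← Finset.sum_add_distrib]
        exact Finset.sum_congr rfl fun i _ => by ring
      rw [this, Real.exp_sum]
      refine Finset.prod_le_prod (fun i _ => ?_) (fun i _ => ?_)
      · have := hs1 i
        exact Real.rpow_nonneg (by linarith) _
      · have := hs1 i
        rw [Real.rpow_def_of_pos (by linarith), Real.exp_le_exp, mul_comm]
        exact mul_le_mul_of_nonneg_left (log_one_add_le _ this) (hc i)
    have hσ2 : σ ^ 2 ≤ R * σ := by nlinarith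
    have hσ3 : σ ^ 3 ≤ R * σ ^ 2 := by nlinarith [sq_nonneg σ]
    have hσ3' : σ ^ 3 ≤ R ^ 2 * σ := by nlinarith
    have huv : |u - v| ≤ S * (1 + R) * σ ^ 2 := by
      have a1 : S * σ ^ 3 ≤ S * (R * σ ^ 2) := mul_le_mul_of_nonneg_left hσ3 hS0
      have a2 : 0 ≤ S * R * σ ^ 2 := by positivity
      rw [abs_le]; constructor <;> nlinarith
    have hub : |u| ≤ L * σ := by
      have a1 : S * σ ^ 3 ≤ S * (R ^ 2 * σ) := mul_le_mul_of_nonneg_left hσ3' hS0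
      have a2 : S * σ ^ 2 ≤ S * (R * σ) := mul_le_mul_of_nonneg_left hσ2 hS0
      have a3 : 0 ≤ S * R * σ := by positivity
      have a4 : 0 ≤ S * R ^ 2 * σ := by positivity
      have := abs_le.1 hvb
      rw [hL, abs_le]; constructor <;> nlinarith
    have hvL : |v| ≤ L * σ := by
      have a3 : 0 ≤ S * R * σ := by positivity
      have a4 : 0 ≤ S * R ^ 2 * σ := by positivity
      rw [hL]; nlinarith
    have huv2 : u ^ 2 ≤ v ^ 2 + 2 * (S * (1 + R) * L * σ ^ 3) := by
      have : u ^ 2 - v ^ 2 ≤ |u - v| * |u + v| := by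
        rw [← abs_mul]
        refine le_trans (le_of_eq ?_) (le_abs_self _)
        ring
      have h2 : |u + v| ≤ 2 * (L * σ) := (abs_add_le _ _).trans (by linarith)
      have h3 : |u - v| * |u + v| ≤ (S * (1 + R) * σ ^ 2) * (2 * (L * σ)) :=
        mul_le_mul huv h2 (abs_nonneg _) (by positivity)
      have h4 : (S * (1 + R) * σ ^ 2) * (2 * (L * σ)) = 2 * (S * (1 + R) * L * σ ^ 3) := by ring
      linarith
    have hu3 : |u| ^ 3 * Real.exp |u| ≤ L ^ 3 * Real.exp (L * R) * σ ^ 3 := by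
      have h2 : |u| ^ 3 ≤ (L * σ) ^ 3 := pow_le_pow_left₀ (abs_nonneg _) hub 3
      have h3 : Real.exp |u| ≤ Real.exp (L * R) :=
        Real.exp_le_exp.2 (hub.trans (mul_le_mul_of_nonneg_left hσR hL0))
      have h4 := mul_le_mul h2 h3 (Real.exp_pos _).le (by positivity)
      have h5 : (L * σ) ^ 3 * Real.exp (L * R) = L ^ 3 * Real.exp (L * R) * σ ^ 3 := by ring
      linarith
    have := exp_le_taylor u
    have e : u = v - w / 2 + t := hu
    have e2 : C * σ ^ 3 = S * σ ^ 3 + S * (1 + R) * L * σ ^ 3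
        + L ^ 3 * Real.exp (L * R) * σ ^ 3 := by rw [hC]; ring
    linarith
  intro s σ hσ hs1 hsR hs
  have h := main s (min σ R) (le_min hσ hR) (min_le_right _ _) hs1
    (fun i => le_min (hs i) (hsR i))
  have h2 : (min σ R) ^ 3 ≤ σ ^ 3 := pow_le_pow_left₀ (le_min hσ hR) (min_le_left _ _) 3
  have := mul_le_mul_of_nonneg_left h2 hC0
  linarith

end BL

namespace BL
open ProbabilityTheory
open scoped RealInnerProductSpace

section Step
variable {E : Type*} [NormedAddCommGroup E] [InnerProductSpace ℝ E] [FiniteDimensional ℝ E]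
  [MeasurableSpace E] [BorelSpace E]
variable {ι : Type*} [Fintype ι]

lemma sq_diff (p q A B : ℝ) (h1 : |p - q| ≤ A) (h2 : |p| ≤ B) (h3 : |q| ≤ B) :
    |p ^ 2 - q ^ 2| ≤ A * (2 * B) := by
  have : p ^ 2 - q ^ 2 = (p - q) * (p + q) := by ring
  rw [this, abs_mul]
  have h4 : |p + q| ≤ 2 * B := (abs_add_le _ _).trans (by linarith)
  exact mul_le_mul h1 h4 (abs_nonneg _) ((abs_nonneg _).trans h1)

variable (E) in
lemma step_abs (c : ι → ℝ) (hc : ∀ i, 0 ≤ c i) (R D B : ℝ) (hR : 0 ≤ R) (hD : 0 ≤ D)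
    (hB : 0 ≤ B) :
    ∃ C : ℝ, 0 ≤ C ∧ ∀ (s : ι → E → ℝ) (β : ι → E) (h : ℝ), 0 ≤ h → h ≤ 1 →
      (∀ i, Continuous (s i)) → (∀ i, ∫ ξ, s i ξ ∂(stdGaussian E) = 0) →
      (∀ i ξ, -1 < s i ξ) → (∀ i ξ, |s i ξ| ≤ R) →
      (∀ i ξ, |s i ξ - h * ⟪β i, ξ⟫| ≤ D * h ^ 2 * (1 + ‖ξ‖) ^ 2) →
      (∀ i, ‖β i‖ ≤ B) → ‖∑ i, c i • β i‖ ^ 2 ≤ ∑ i, c i * ‖β i‖ ^ 2 →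
      ∫ ξ, ∏ i, (1 + s i ξ) ^ (c i) ∂(stdGaussian E) ≤ 1 + C * h ^ 3 := by
  obtain ⟨C0, hC0, hprod⟩ := prod_rpow_le c hc R hR
  set S := ∑ i, c i with hS
  have hS0 : 0 ≤ S := Finset.sum_nonneg fun i _ => hc i
  set D' := B + D with hD'
  have hD'0 : 0 ≤ D' := by positivity
  set m6 := ∫ ξ : E, (1 + ‖ξ‖) ^ 6 ∂(stdGaussian E) with hm6
  have hm60 : 0 ≤ m6 := integral_nonneg fun ξ => by positivity
  set T := (S * D) * (2 * (S * D')) / 2 + S * (D * (2 * D')) / 2 + C0 * D' ^ 3 with hT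
  have hT0 : 0 ≤ T := by positivity
  refine ⟨T * m6, by positivity, ?_⟩
  intro s β h h0 h1 hcont hmean hlow hR' htay hβ hquad
  set b := ∑ i, c i • β i with hb
  have hpt : ∀ ξ : E, ∏ i, (1 + s i ξ) ^ (c i) ≤
      1 + ∑ i, c i * s i ξ + h ^ 2 / 2 * (⟪b, ξ⟫ ^ 2 - ∑ i, c i * ⟪β i, ξ⟫ ^ 2)
        + T * h ^ 3 * (1 + ‖ξ‖) ^ 6 := by
    intro ξ
    set ρ := 1 + ‖ξ‖ with hρ
    have hρ1 : 1 ≤ ρ := by rw [hρ]; linarith [norm_nonneg ξ]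
    have hρ12 : ρ ≤ ρ ^ 2 := by nlinarith
    have hρ46 : ρ ^ 4 ≤ ρ ^ 6 := pow_le_pow_right₀ hρ1 (by norm_num)
    have hh2 : h ^ 2 ≤ h := by nlinarith
    have hlin : ∀ i, |h * ⟪β i, ξ⟫| ≤ D' * h * ρ ^ 2 := by
      intro i
      rw [abs_mul, abs_of_nonneg h0]
      have h2 : |⟪β i, ξ⟫| ≤ B * ρ ^ 2 := by
        refine (abs_real_inner_le_norm _ _).trans ?_
        refine mul_le_mul (hβ i) ?_ (norm_nonneg _) hB
        rw [hρ] at hρ12 ⊢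
        linarith
      have h3 : h * |⟪β i, ξ⟫| ≤ h * (B * ρ ^ 2) := mul_le_mul_of_nonneg_left h2 h0
      have h4 : 0 ≤ D * h * ρ ^ 2 := by positivity
      rw [hD']; linarith
    have hs : ∀ i, |s i ξ| ≤ D' * h * ρ ^ 2 := by
      intro i
      have h2 : |h * ⟪β i, ξ⟫| ≤ h * (B * ρ ^ 2) := by
        rw [abs_mul, abs_of_nonneg h0]
        refine mul_le_mul_of_nonneg_left ?_ h0
        refine (abs_real_inner_le_norm _ _).trans ?_
        refine mul_le_mul (hβ i) ?_ (norm_nonneg _) hB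
        rw [hρ] at hρ12 ⊢
        linarith
      have h3 : |s i ξ| ≤ |s i ξ - h * ⟪β i, ξ⟫| + |h * ⟪β i, ξ⟫| := by
        have := abs_add_le (s i ξ - h * ⟪β i, ξ⟫) (h * ⟪β i, ξ⟫)
        simpa using this
      have h4 : D * h ^ 2 * ρ ^ 2 ≤ D * h * ρ ^ 2 := by gcongr
      have := htay i ξ
      rw [hD']; linarith
    have hp := hprod (fun i => s i ξ) (D' * h * ρ ^ 2) (by positivity) (fun i => hlow i ξ)
      (fun i => hR' i ξ) hs
    have hbξ : ⟪b, ξ⟫ = ∑ i, c i * ⟪β i, ξ⟫ := by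
      rw [hb, sum_inner]; simp [real_inner_smul_left]
    have hv : |(∑ i, c i * s i ξ) ^ 2 - (h * ⟪b, ξ⟫) ^ 2| ≤
        (S * D * h ^ 2 * ρ ^ 2) * (2 * (S * D' * h * ρ ^ 2)) := by
      apply sq_diff
      · rw [hbξ, Finset.mul_sum, ← Finset.sum_sub_distrib]
        refine (Finset.abs_sum_le_sum_abs _ _).trans ?_
        rw [hS, Finset.sum_mul, Finset.sum_mul, Finset.sum_mul]
        refine Finset.sum_le_sum fun i _ => ?_
        rw [show c i * s i ξ - h * (c i * ⟪β i, ξ⟫) = c i * (s i ξ - h * ⟪β i, ξ⟫) by ring,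
          abs_mul, abs_of_nonneg (hc i), mul_assoc, mul_assoc]
        refine mul_le_mul_of_nonneg_left ?_ (hc i)
        rw [← mul_assoc]
        exact htay i ξ
      · refine (Finset.abs_sum_le_sum_abs _ _).trans ?_
        rw [hS, Finset.sum_mul, Finset.sum_mul, Finset.sum_mul]
        refine Finset.sum_le_sum fun i _ => ?_
        rw [abs_mul, abs_of_nonneg (hc i), mul_assoc, mul_assoc]
        refine mul_le_mul_of_nonneg_left ?_ (hc i)
        rw [← mul_assoc]
        exact hs i
      · rw [hbξ, Finset.mul_sum]
        refine (Finset.abs_sum_le_sum_abs _ _).trans ?_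
        rw [hS, Finset.sum_mul, Finset.sum_mul, Finset.sum_mul]
        refine Finset.sum_le_sum fun i _ => ?_
        rw [show h * (c i * ⟪β i, ξ⟫) = c i * (h * ⟪β i, ξ⟫) by ring,
          abs_mul, abs_of_nonneg (hc i), mul_assoc, mul_assoc]
        refine mul_le_mul_of_nonneg_left ?_ (hc i)
        rw [← mul_assoc]
        exact hlin i
    have hw : h ^ 2 * ∑ i, c i * ⟪β i, ξ⟫ ^ 2 - ∑ i, c i * s i ξ ^ 2 ≤
        S * ((D * h ^ 2 * ρ ^ 2) * (2 * (D' * h * ρ ^ 2))) := by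
      rw [hS, Finset.sum_mul, Finset.mul_sum, ← Finset.sum_sub_distrib]
      refine Finset.sum_le_sum fun i _ => ?_
      have h2 := sq_diff _ _ _ _ (htay i ξ) (hs i) (hlin i)
      have h3 := neg_abs_le (s i ξ ^ 2 - (h * ⟪β i, ξ⟫) ^ 2)
      have h4 : h ^ 2 * (c i * ⟪β i, ξ⟫ ^ 2) - c i * s i ξ ^ 2
        = c i * ((h * ⟪β i, ξ⟫) ^ 2 - s i ξ ^ 2) := by ring
      rw [h4]
      exact mul_le_mul_of_nonneg_left (by linarith) (hc i)
    have hv' := (abs_le.1 hv).2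
    have e1 : (S * D * h ^ 2 * ρ ^ 2) * (2 * (S * D' * h * ρ ^ 2)) ≤
        (S * D) * (2 * (S * D')) * h ^ 3 * ρ ^ 6 := by
      calc (S * D * h ^ 2 * ρ ^ 2) * (2 * (S * D' * h * ρ ^ 2))
          = (S * D) * (2 * (S * D')) * h ^ 3 * ρ ^ 4 := by ring
        _ ≤ _ := by gcongr
    have e2 : S * ((D * h ^ 2 * ρ ^ 2) * (2 * (D' * h * ρ ^ 2))) ≤
        S * (D * (2 * D')) * h ^ 3 * ρ ^ 6 := by
      calc S * ((D * h ^ 2 * ρ ^ 2) * (2 * (D' * h * ρ ^ 2)))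
          = S * (D * (2 * D')) * h ^ 3 * ρ ^ 4 := by ring
        _ ≤ _ := by gcongr
    have e3 : C0 * (D' * h * ρ ^ 2) ^ 3 = C0 * D' ^ 3 * h ^ 3 * ρ ^ 6 := by ring
    have e4 : T * h ^ 3 * ρ ^ 6 = (S * D) * (2 * (S * D')) * h ^ 3 * ρ ^ 6 / 2
      + S * (D * (2 * D')) * h ^ 3 * ρ ^ 6 / 2 + C0 * D' ^ 3 * h ^ 3 * ρ ^ 6 := by rw [hT]; ring
    have e5 : (h * ⟪b, ξ⟫) ^ 2 = h ^ 2 * ⟪b, ξ⟫ ^ 2 := by ring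
    rw [e3] at hp
    rw [e4]
    rw [e5] at hv'
    linarith
  have hsint : ∀ i, Integrable (s i) (stdGaussian E) := fun i =>
    Integrable.of_bound (hcont i).aestronglyMeasurable R
      (Filter.Eventually.of_forall fun ξ => by simpa using hR' i ξ)
  have hi1 : Integrable (fun ξ => ∑ i, c i * s i ξ) (stdGaussian E) :=
    integrable_finsetSum _ fun i _ => (hsint i).const_mul _
  have hi2 : Integrable (fun ξ => ∑ i, c i * ⟪β i, ξ⟫ ^ 2) (stdGaussian E) :=
    integrable_finsetSum _ fun i _ => (integrable_inner_sq _).const_mul _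
  have hi3 : Integrable (fun ξ => h ^ 2 / 2 * (⟪b, ξ⟫ ^ 2 - ∑ i, c i * ⟪β i, ξ⟫ ^ 2))
      (stdGaussian E) := ((integrable_inner_sq b).sub hi2).const_mul _
  have hi4 : Integrable (fun ξ : E => T * h ^ 3 * (1 + ‖ξ‖) ^ 6) (stdGaussian E) :=
    (integrable_pow 6).const_mul _
  have hi5 : Integrable (fun ξ => 1 + ∑ i, c i * s i ξ) (stdGaussian E) :=
    (integrable_const 1).add hi1
  have hmono := integral_mono_of_nonneg (μ := stdGaussian E)
    (Filter.Eventually.of_forall fun ξ => Finset.prod_nonneg fun i _ =>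
      Real.rpow_nonneg (by linarith [hlow i ξ]) _) ((hi5.add hi3).add hi4)
    (Filter.Eventually.of_forall hpt)
  refine hmono.trans ?_
  simp only [Pi.add_apply]
  rw [integral_add (f := fun ξ => 1 + ∑ i, c i * s i ξ
      + h ^ 2 / 2 * (⟪b, ξ⟫ ^ 2 - ∑ i, c i * ⟪β i, ξ⟫ ^ 2)) (hi5.add hi3) hi4,
    integral_add hi5 hi3, integral_add (integrable_const 1) hi1,
    integral_const_mul, integral_const_mul, integral_sub (integrable_inner_sq b) hi2,
    integral_finsetSum _ fun i _ => (hsint i).const_mul _,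
    integral_finsetSum _ fun i _ => (integrable_inner_sq _).const_mul _, integral_inner_sq]
  simp only [integral_const_mul, hmean, integral_inner_sq]
  simp only [integral_const, probReal_univ, smul_eq_mul, mul_one, mul_zero, Finset.sum_const_zero,
    add_zero]
  rw [← hm6]
  have : h ^ 2 / 2 * (‖b‖ ^ 2 - ∑ i, c i * ‖β i‖ ^ 2) ≤ 0 :=
    mul_nonpos_of_nonneg_of_nonpos (by positivity) (by linarith)
  linarith

end Step
end BL

namespace BL
open ProbabilityTheory
open scoped RealInnerProductSpace

section Good
variable {E : Type*} [NormedAddCommGroup E] [InnerProductSpace ℝ E] [FiniteDimensional ℝ E]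
  [MeasurableSpace E] [BorelSpace E]

/-- Uniformly `C^{1,1}` functions with values in `[δ, M]`. -/
structure Good (δ M K : ℝ) (g : E → ℝ) (a : E → E) : Prop where
  cont : Continuous g
  conta : Continuous a
  lb : ∀ x, δ ≤ g x
  ub : ∀ x, g x ≤ M
  ab : ∀ x, ‖a x‖ ≤ K
  tay : ∀ x z, |g (x + z) - g x - ⟪a x, z⟫| ≤ K * ‖z‖ ^ 2

/-- Gaussian averaging with step `h`. -/
noncomputable def avg (h : ℝ) (g : E → ℝ) (x : E) : ℝ := ∫ y, g (x + h • y) ∂(stdGaussian E)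

lemma Good.integrable {δ M K : ℝ} {g : E → ℝ} {a : E → E} (hg : Good δ M K g a) (hδ : 0 < δ)
    {X : Type*} [MeasurableSpace X] (μ : Measure X) [IsFiniteMeasure μ]
    (φ : X → E) (hφ : Measurable φ) : Integrable (fun y => g (φ y)) μ :=
  Integrable.of_bound (hg.cont.measurable.comp hφ).aestronglyMeasurable M
    (Filter.Eventually.of_forall fun y => by
      rw [Real.norm_eq_abs, abs_of_nonneg (hδ.le.trans (hg.lb _))]; exact hg.ub _)

lemma Good.avg {δ M K : ℝ} {g : E → ℝ} {a : E → E} (hg : Good δ M K g a) (hδ : 0 < δ) (h : ℝ) :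
    Good δ M K (avg h g) (fun x => ∫ y, a (x + h • y) ∂(stdGaussian E)) := by
  have hInt : ∀ x, Integrable (fun y => g (x + h • y)) (stdGaussian E) := fun x =>
    hg.integrable hδ _ _ (by fun_prop)
  have hca := hg.conta
  have hcg := hg.cont
  have hinta : ∀ x, Integrable (fun y => a (x + h • y)) (stdGaussian E) := fun x =>
    Integrable.of_bound (Continuous.aestronglyMeasurable (by fun_prop)) K
      (Filter.Eventually.of_forall fun y => hg.ab _)
  constructor
  · refine continuous_of_dominated (bound := fun _ => M)
      (fun x => (hInt x).aestronglyMeasurable) (fun x => Filter.Eventually.of_forall fun y => ?_)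
      (integrable_const _) (Filter.Eventually.of_forall fun y => by fun_prop)
    rw [Real.norm_eq_abs, abs_of_nonneg (hδ.le.trans (hg.lb _))]; exact hg.ub _
  · refine continuous_of_dominated (bound := fun _ => K)
      (fun x => (hinta x).aestronglyMeasurable) (fun x => Filter.Eventually.of_forall fun y => ?_)
      (integrable_const _) (Filter.Eventually.of_forall fun y => by fun_prop)
    exact hg.ab _
  · intro x
    have := integral_mono (integrable_const δ) (hInt x) (fun y => hg.lb _)
    simpa [BL.avg] using this
  · intro x
    have := integral_mono (hInt x) (integrable_const M) (fun y => hg.ub _)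
    simpa [BL.avg] using this
  · intro x
    have := norm_integral_le_of_norm_le_const (μ := stdGaussian E) (f := fun y => a (x + h • y))
      (Filter.Eventually.of_forall fun y => hg.ab _)
    simpa using this
  · intro x z
    have h1 : ⟪∫ y, a (x + h • y) ∂(stdGaussian E), z⟫
        = ∫ y, ⟪a (x + h • y), z⟫ ∂(stdGaussian E) := by
      rw [real_inner_comm, ← integral_inner (hinta x)]
      simp_rw [real_inner_comm z]
    have hi : Integrable (fun y => ⟪a (x + h • y), z⟫) (stdGaussian E) := (hinta x).inner_const z
    rw [h1, BL.avg, BL.avg, ← integral_sub (hInt _) (hInt _),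
      ← integral_sub (f := fun y => g (x + z + h • y) - g (x + h • y)) ((hInt _).sub (hInt _)) hi, ← Real.norm_eq_abs]
    have := norm_integral_le_of_norm_le_const (μ := stdGaussian E)
      (f := fun y => g (x + z + h • y) - g (x + h • y) - ⟪a (x + h • y), z⟫) (C := K * ‖z‖ ^ 2)
      (Filter.Eventually.of_forall fun y => by
        have := hg.tay (x + h • y) z
        rw [Real.norm_eq_abs]
        rwa [show x + z + h • y = x + h • y + z by abel])
    simpa using this

lemma integral_semigroup (F : E → ℝ) (hF : Continuous F) (M : ℝ) (hM : ∀ x, |F x| ≤ M)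
    (a b : ℝ) (ha : 0 ≤ a) (hb : 0 ≤ b) (x : E) :
    ∫ y, ∫ z, F (x + √a • y + √b • z) ∂(stdGaussian E) ∂(stdGaussian E)
      = ∫ y, F (x + √(a + b) • y) ∂(stdGaussian E) := by
  have h1 := integral_map (μ := (stdGaussian E).prod (stdGaussian E))
    (φ := fun p : E × E => √a • p.1 + √b • p.2) (f := fun y => F (x + y))
    (by fun_prop) (Continuous.aestronglyMeasurable (by fun_prop))
  have h2 := integral_map (μ := stdGaussian E)
    (φ := fun y : E => √(a + b) • y) (f := fun y => F (x + y))
    (by fun_prop) (Continuous.aestronglyMeasurable (by fun_prop))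
  rw [map_semigroup a b ha hb, h2] at h1
  rw [h1, integral_prod]
  · simp only [add_assoc]
  · refine Integrable.of_bound (Continuous.aestronglyMeasurable (by fun_prop)) M
      (Filter.Eventually.of_forall fun y => by simpa using hM _)

end Good

section Step
variable {E : Type*} [NormedAddCommGroup E] [InnerProductSpace ℝ E] [FiniteDimensional ℝ E]
  [MeasurableSpace E] [BorelSpace E]
variable {ι : Type*} [Fintype ι] {F : ι → Type*} [∀ i, NormedAddCommGroup (F i)]
  [∀ i, InnerProductSpace ℝ (F i)] [∀ i, FiniteDimensional ℝ (F i)]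
  [∀ i, MeasurableSpace (F i)] [∀ i, BorelSpace (F i)]

/-- Geometric Brascamp-Lieb datum. -/
structure Datum (c : ι → ℝ) (W : ∀ i, E →L[ℝ] F i) (V : ∀ i, F i →L[ℝ] E) : Prop where
  pos : ∀ i, 0 < c i
  adj : ∀ i x y, ⟪W i x, y⟫ = ⟪x, V i y⟫
  iso : ∀ i y, ‖V i y‖ = ‖y‖
  sum : ∀ x, ∑ i, c i • V i (W i x) = x

variable {c : ι → ℝ} {W : ∀ i, E →L[ℝ] F i} {V : ∀ i, F i →L[ℝ] E}

lemma Datum.norm_le (d : Datum c W V) (i : ι) (x : E) : ‖W i x‖ ≤ ‖x‖ := by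
  have h := real_inner_self_eq_norm_sq (W i x)
  rw [d.adj] at h
  have h2 := real_inner_le_norm x (V i (W i x))
  rw [d.iso, h] at h2
  by_contra hlt
  push Not at hlt
  nlinarith [norm_nonneg x, norm_nonneg (W i x)]

lemma Datum.quad (d : Datum c W V) (a : ∀ i, F i) :
    ‖∑ i, c i • V i (a i)‖ ^ 2 ≤ ∑ i, c i * ‖a i‖ ^ 2 := by
  set w := ∑ i, c i • V i (a i) with hw
  have h1 : ‖w‖ ^ 2 = ∑ i, c i * ⟪W i w, a i⟫ := by
    rw [← real_inner_self_eq_norm_sq]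
    conv_lhs => rw [hw, inner_sum]
    refine Finset.sum_congr rfl fun i _ => ?_
    rw [real_inner_smul_right, ← d.adj]
  have h2 : ‖w‖ ^ 2 = ∑ i, c i * ‖W i w‖ ^ 2 := by
    rw [← real_inner_self_eq_norm_sq]
    conv_lhs => rw [← d.sum w, sum_inner]
    refine Finset.sum_congr rfl fun i _ => ?_
    rw [real_inner_smul_left, d.sum, real_inner_comm, ← d.adj, real_inner_self_eq_norm_sq]
  have h3 : ∑ i, c i * ⟪W i w, a i⟫ ≤ ∑ i, (c i * ‖W i w‖ ^ 2 / 2 + c i * ‖a i‖ ^ 2 / 2) := by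
    refine Finset.sum_le_sum fun i _ => ?_
    have h4 : ⟪W i w, a i⟫ ≤ ‖W i w‖ ^ 2 / 2 + ‖a i‖ ^ 2 / 2 := by
      nlinarith [real_inner_le_norm (W i w) (a i), sq_nonneg (‖W i w‖ - ‖a i‖)]
    have := mul_le_mul_of_nonneg_left h4 (d.pos i).le
    linarith
  rw [Finset.sum_add_distrib, ← Finset.sum_div, ← Finset.sum_div] at h3
  linarith

lemma Datum.avg_eq (d : Datum c W V) (i : ι) (g : F i → ℝ) (hg : Continuous g) (h : ℝ) (x : E) :
    avg h g (W i x) = ∫ ξ, g (W i (x + h • ξ)) ∂(stdGaussian E) := by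
  rw [avg, ← map_coisom (W i) (V i) (d.adj i) (d.iso i), integral_map (by fun_prop)
    (Continuous.aestronglyMeasurable (by fun_prop))]
  simp

lemma Datum.step (d : Datum c W V) (δ M K : ℝ) (hδ : 0 < δ) (hM : 0 ≤ M) (hK : 0 ≤ K) :
    ∃ C : ℝ, 0 ≤ C ∧ ∀ (h : ℝ), 0 ≤ h → h ≤ 1 → ∀ (g : ∀ i, F i → ℝ) (a : ∀ i, F i → F i),
      (∀ i, Good δ M K (g i) (a i)) → ∀ x : E,
      ∫ ξ, ∏ i, (g i (W i (x + h • ξ))) ^ (c i) ∂(stdGaussian E)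
        ≤ (1 + C * h ^ 3) * ∏ i, (avg h (g i) (W i x)) ^ (c i) := by
  set m := ∫ ξ : E, (1 + ‖ξ‖) ^ 2 ∂(stdGaussian E) with hm
  have hm0 : 0 ≤ m := integral_nonneg fun ξ => by positivity
  obtain ⟨C, hC, hstep⟩ := step_abs E c (fun i => (d.pos i).le) (M / δ + 1) (K * (1 + m) / δ)
    (K / δ) (by positivity) (by positivity) (by positivity)
  refine ⟨C, hC, ?_⟩
  intro h h0 h1 g a hg x
  set q : ι → ℝ := fun i => avg h (g i) (W i x) with hq
  have hqδ : ∀ i, δ ≤ q i := fun i => ((hg i).avg hδ h).lb _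
  have hq0 : ∀ i, 0 < q i := fun i => hδ.trans_le (hqδ i)
  have hcg : ∀ i, Continuous (g i) := fun i => (hg i).cont
  have hgint : ∀ i, Integrable (fun ξ => g i (W i (x + h • ξ))) (stdGaussian E) := fun i =>
    (hg i).integrable hδ _ _ (by fun_prop)
  have hlinint : ∀ i, Integrable (fun ξ => h * ⟪V i (a i (W i x)), ξ⟫) (stdGaussian E) := fun i =>
    (IsGaussian.integrable_dual (stdGaussian E) (innerSL ℝ (V i (a i (W i x))))).const_mul h
  have hlin0 : ∀ i, ∫ ξ, h * ⟪V i (a i (W i x)), ξ⟫ ∂(stdGaussian E) = 0 := fun i => by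
    rw [integral_const_mul]
    have := integral_strongDual_stdGaussian (E := E) (innerSL ℝ (V i (a i (W i x))))
    simp only [innerSL_apply_apply] at this
    rw [this, mul_zero]
  have htay : ∀ i ξ, |g i (W i (x + h • ξ)) - g i (W i x) - h * ⟪V i (a i (W i x)), ξ⟫|
      ≤ K * h ^ 2 * (1 + ‖ξ‖) ^ 2 := by
    intro i ξ
    have h2 := (hg i).tay (W i x) (h • W i ξ)
    rw [real_inner_smul_right, real_inner_comm, d.adj, real_inner_comm, norm_smul,
      Real.norm_eq_abs, abs_of_nonneg h0] at h2
    rw [map_add, map_smul]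
    refine h2.trans ?_
    rw [mul_pow, mul_assoc]
    have := d.norm_le i ξ
    gcongr
    linarith
  have hqg : ∀ i, |g i (W i x) - q i| ≤ K * h ^ 2 * m := by
    intro i
    have h2 : q i - g i (W i x) = ∫ ξ, (g i (W i (x + h • ξ)) - g i (W i x)
        - h * ⟪V i (a i (W i x)), ξ⟫) ∂(stdGaussian E) := by
      rw [integral_sub (f := fun ξ => g i (W i (x + h • ξ)) - g i (W i x))
        ((hgint i).sub (integrable_const _)) (hlinint i), hlin0,
        integral_sub (hgint i) (integrable_const _), hq]
      simp [d.avg_eq i (g i) (hcg i)]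
    rw [abs_sub_comm, h2, hm, ← integral_const_mul, ← Real.norm_eq_abs]
    exact norm_integral_le_of_norm_le ((integrable_pow 2).const_mul _)
      (Filter.Eventually.of_forall fun ξ => htay i ξ)
  have key := hstep (fun i ξ => g i (W i (x + h • ξ)) / q i - 1)
    (fun i => V i ((q i)⁻¹ • a i (W i x))) h h0 h1
    (fun i => by fun_prop)
    (fun i => by
      rw [integral_sub ((hgint i).div_const _) (integrable_const _), integral_div,
        ← d.avg_eq i (g i) (hcg i)]
      have := (hq0 i).ne'
      simp only [hq] at this
      simp [hq, div_self this])
    (fun i ξ => by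
      have : 0 < g i (W i (x + h • ξ)) / q i := div_pos (hδ.trans_le ((hg i).lb _)) (hq0 i)
      linarith)
    (fun i ξ => by
      have h2 : 0 < g i (W i (x + h • ξ)) / q i := div_pos (hδ.trans_le ((hg i).lb _)) (hq0 i)
      have h3 : g i (W i (x + h • ξ)) / q i ≤ M / δ :=
        div_le_div₀ hM ((hg i).ub _) hδ (hqδ i)
      rw [abs_le]; constructor <;> linarith)
    (fun i ξ => by
      have h2 : g i (W i (x + h • ξ)) / q i - 1 - h * ⟪V i ((q i)⁻¹ • a i (W i x)), ξ⟫
        = ((g i (W i (x + h • ξ)) - g i (W i x) - h * ⟪V i (a i (W i x)), ξ⟫)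
          + (g i (W i x) - q i)) / q i := by
        rw [map_smul, real_inner_smul_left]
        have := (hq0 i).ne'
        field_simp
        ring
      rw [h2, abs_div, abs_of_pos (hq0 i)]
      have h3 : |(g i (W i (x + h • ξ)) - g i (W i x) - h * ⟪V i (a i (W i x)), ξ⟫)
          + (g i (W i x) - q i)| ≤ K * (1 + m) * h ^ 2 * (1 + ‖ξ‖) ^ 2 := by
        refine (abs_add_le _ _).trans ((add_le_add (htay i ξ) (hqg i)).trans ?_)
        have h4 : 1 ≤ (1 + ‖ξ‖) ^ 2 := one_le_pow₀ (by linarith [norm_nonneg ξ])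
        have h5 : K * h ^ 2 * m * 1 ≤ K * h ^ 2 * m * (1 + ‖ξ‖) ^ 2 := by gcongr
        linarith
      refine (div_le_div₀ (by positivity) h3 hδ (hqδ i)).trans (le_of_eq ?_)
      ring)
    (fun i => by
      rw [d.iso, norm_smul, norm_inv, Real.norm_eq_abs, abs_of_pos (hq0 i), inv_mul_eq_div]
      exact div_le_div₀ hK ((hg i).ab _) hδ (hqδ i))
    (by
      have := d.quad (fun i => (q i)⁻¹ • a i (W i x))
      simpa only [d.iso] using this)
  have hfac : ∀ ξ, ∏ i, (g i (W i (x + h • ξ))) ^ (c i)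
      = (∏ i, (q i) ^ (c i)) * ∏ i, (1 + (g i (W i (x + h • ξ)) / q i - 1)) ^ (c i) := by
    intro ξ
    rw [← Finset.prod_mul_distrib]
    refine Finset.prod_congr rfl fun i _ => ?_
    have h2 : 0 < g i (W i (x + h • ξ)) / q i := div_pos (hδ.trans_le ((hg i).lb _)) (hq0 i)
    rw [← Real.mul_rpow (hq0 i).le (by linarith)]
    congr 1
    have := (hq0 i).ne'
    field_simp
    ring
  simp_rw [hfac]
  rw [integral_const_mul, mul_comm]
  exact mul_le_mul_of_nonneg_right key
    (Finset.prod_nonneg fun i _ => Real.rpow_nonneg (hq0 i).le _)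

end Step
end BL

namespace BL
open ProbabilityTheory
open scoped RealInnerProductSpace

section Iter
variable {E : Type*} [NormedAddCommGroup E] [InnerProductSpace ℝ E] [FiniteDimensional ℝ E]
  [MeasurableSpace E] [BorelSpace E]
variable {ι : Type*} [Fintype ι] {F : ι → Type*} [∀ i, NormedAddCommGroup (F i)]
  [∀ i, InnerProductSpace ℝ (F i)] [∀ i, FiniteDimensional ℝ (F i)]
  [∀ i, MeasurableSpace (F i)] [∀ i, BorelSpace (F i)]
variable {c : ι → ℝ} {W : ∀ i, E →L[ℝ] F i} {V : ∀ i, F i →L[ℝ] E}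

lemma Good.avg_avg {δ M K : ℝ} {g : E → ℝ} {a : E → E} (hg : Good δ M K g a) (hδ : 0 < δ)
    (t ε : ℝ) (ht : 0 ≤ t) (hε : 0 ≤ ε) (x : E) :
    BL.avg √ε (BL.avg √t g) x = BL.avg √(t + ε) g x := by
  have := integral_semigroup g hg.cont M (fun x => by
    rw [abs_of_nonneg (hδ.le.trans (hg.lb _))]; exact hg.ub _) ε t hε ht x
  rw [add_comm t ε]
  exact this

lemma Datum.prod_cont (d : Datum c W V) {δ M K : ℝ} (hδ : 0 < δ) {g : ∀ i, F i → ℝ}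
    {a : ∀ i, F i → F i} (hg : ∀ i, Good δ M K (g i) (a i)) :
    Continuous fun x => ∏ i, (g i (W i x)) ^ (c i) := by
  refine continuous_finset_prod _ fun i _ => ?_
  have hcg := (hg i).cont
  refine Continuous.rpow_const (by fun_prop) fun x => Or.inr (d.pos i).le

lemma Datum.prod_bound (d : Datum c W V) {δ M K : ℝ} (hδ : 0 < δ) {g : ∀ i, F i → ℝ}
    {a : ∀ i, F i → F i} (hg : ∀ i, Good δ M K (g i) (a i)) (x : E) :
    |∏ i, (g i (W i x)) ^ (c i)| ≤ ∏ i, M ^ (c i) := by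
  have h0 : ∀ i, 0 ≤ g i (W i x) := fun i => hδ.le.trans ((hg i).lb _)
  rw [abs_of_nonneg (Finset.prod_nonneg fun i _ => Real.rpow_nonneg (h0 i) _)]
  refine Finset.prod_le_prod (fun i _ => Real.rpow_nonneg (h0 i) _) fun i _ => ?_
  exact Real.rpow_le_rpow (h0 i) ((hg i).ub _) (d.pos i).le

theorem Datum.good_ineq (d : Datum c W V) {δ M K : ℝ} (hδ : 0 < δ) (hM : 0 ≤ M) (hK : 0 ≤ K)
    {g : ∀ i, F i → ℝ} {a : ∀ i, F i → F i} (hg : ∀ i, Good δ M K (g i) (a i)) :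
    ∫ ξ, ∏ i, (g i (W i ξ)) ^ (c i) ∂(stdGaussian E)
      ≤ ∏ i, (∫ y, g i y ∂(stdGaussian (F i))) ^ (c i) := by
  obtain ⟨C, hC, hstep⟩ := d.step δ M K hδ hM hK
  set Φ : ℝ → ℝ := fun t => ∫ ξ, ∏ i, (avg √t (g i) (W i (√(1 - t) • ξ))) ^ (c i) ∂(stdGaussian E)
    with hΦ
  have hga : ∀ t, ∀ i, Good δ M K (avg √t (g i))
    (fun x => ∫ y, a i (x + √t • y) ∂(stdGaussian (F i))) := fun t i => (hg i).avg hδ √t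
  have hΦstep : ∀ t ε, 0 ≤ t → 0 ≤ ε → ε ≤ 1 → t + ε ≤ 1 →
      Φ t ≤ (1 + C * √ε ^ 3) * Φ (t + ε) := by
    intro t ε ht hε hε1 htε
    have h1 := integral_semigroup (fun x => ∏ i, (avg √t (g i) (W i x)) ^ (c i))
      (d.prod_cont hδ (hga t)) _ (d.prod_bound hδ (hga t)) (1 - (t + ε)) ε (by linarith) hε 0
    simp only [zero_add] at h1
    rw [show 1 - (t + ε) + ε = 1 - t by ring] at h1
    have h2 : Φ t = _ := h1.symm
    rw [h2]
    have hc2 : Continuous fun y => ∏ i, (avg √(t + ε) (g i) (W i (√(1 - (t + ε)) • y))) ^ (c i) :=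
      (d.prod_cont hδ (hga (t + ε))).comp (by fun_prop : Continuous fun y : E => √(1 - (t + ε)) • y)
    have hInt : Integrable (fun y => (1 + C * √ε ^ 3) *
        ∏ i, (avg √(t + ε) (g i) (W i (√(1 - (t + ε)) • y))) ^ (c i)) (stdGaussian E) := by
      refine Integrable.const_mul ?_ _
      exact Integrable.of_bound hc2.aestronglyMeasurable (∏ i, M ^ (c i))
        (Filter.Eventually.of_forall fun y => d.prod_bound hδ (hga (t + ε)) _)
    rw [hΦ, ← integral_const_mul]
    refine integral_mono_of_nonneg (Filter.Eventually.of_forall fun y => ?_) hInt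
      (Filter.Eventually.of_forall fun y => ?_)
    · refine integral_nonneg fun z => Finset.prod_nonneg fun i _ => Real.rpow_nonneg ?_ _
      exact hδ.le.trans ((hga t i).lb _)
    · have h3 := hstep √ε (Real.sqrt_nonneg _) (Real.sqrt_le_one.2 hε1) _ _ (hga t)
        (√(1 - (t + ε)) • y)
      refine h3.trans (le_of_eq ?_)
      congr 1
      refine Finset.prod_congr rfl fun i _ => ?_
      rw [(hg i).avg_avg hδ t ε ht hε]
  have hΦ0 : Φ 0 = ∫ ξ, ∏ i, (g i (W i ξ)) ^ (c i) ∂(stdGaussian E) := by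
    simp [hΦ, avg]
  have hΦ1 : Φ 1 = ∏ i, (∫ y, g i y ∂(stdGaussian (F i))) ^ (c i) := by
    simp [hΦ, avg]
  have hΦpos : 0 ≤ Φ 1 := by
    rw [hΦ1]
    exact Finset.prod_nonneg fun i _ => Real.rpow_nonneg
      (integral_nonneg fun y => hδ.le.trans ((hg i).lb _)) _
  rw [← hΦ0, ← hΦ1]
  have hN : ∀ N : ℕ, Φ 0 ≤ Real.exp (C * √(1 / ((N : ℝ) + 1))) * Φ 1 := by
    intro N
    set ε : ℝ := 1 / ((N : ℝ) + 1) with hε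
    have hN0 : (0 : ℝ) < (N : ℝ) + 1 := by positivity
    have hε0 : 0 < ε := by positivity
    have hNε : ((N + 1 : ℕ) : ℝ) * ε = 1 := by rw [hε]; push_cast; field_simp
    have hε1 : ε ≤ 1 := by
      rw [hε, div_le_one hN0]; linarith [(Nat.cast_nonneg N : (0 : ℝ) ≤ N)]
    have hpos : 0 ≤ 1 + C * √ε ^ 3 := by positivity
    have hk : ∀ k : ℕ, k ≤ N + 1 → Φ 0 ≤ (1 + C * √ε ^ 3) ^ k * Φ (k * ε) := by
      intro k
      induction k with
      | zero => intro _; simp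
      | succ k ih =>
        intro hkN
        have h1 := ih (by omega)
        have hle : ((k + 1 : ℕ) : ℝ) * ε ≤ 1 := by
          rw [← hNε]
          have : ((k + 1 : ℕ) : ℝ) ≤ ((N + 1 : ℕ) : ℝ) := by exact_mod_cast hkN
          gcongr
        have h2 := hΦstep (k * ε) ε (by positivity) hε0.le hε1 (by push_cast at hle; linarith)
        have h3 := mul_le_mul_of_nonneg_left h2 (pow_nonneg hpos k)
        refine h1.trans (h3.trans (le_of_eq ?_))
        rw [show (k : ℝ) * ε + ε = ((k + 1 : ℕ) : ℝ) * ε by push_cast; ring]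
        ring
    have h1 := hk (N + 1) le_rfl
    rw [hNε] at h1
    refine h1.trans (mul_le_mul_of_nonneg_right ?_ hΦpos)
    have h2 : 1 + C * √ε ^ 3 ≤ Real.exp (C * √ε ^ 3) := by
      linarith [Real.add_one_le_exp (C * √ε ^ 3)]
    refine (pow_le_pow_left₀ hpos h2 _).trans (le_of_eq ?_)
    rw [← Real.exp_nat_mul]
    congr 1
    have : √ε ^ 3 = ε * √ε := by rw [pow_succ, Real.sq_sqrt hε0.le]
    rw [this, show ((N + 1 : ℕ) : ℝ) * (C * (ε * √ε)) = (((N + 1 : ℕ) : ℝ) * ε) * (C * √ε) by ring,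
      hNε, one_mul]
  have hlim : Filter.Tendsto (fun N : ℕ => Real.exp (C * √(1 / ((N : ℝ) + 1))) * Φ 1)
      Filter.atTop (nhds (Real.exp (C * √0) * Φ 1)) := by
    have h0 := tendsto_one_div_add_atTop_nhds_zero_nat (𝕜 := ℝ)
    have hcont : Continuous fun x : ℝ => Real.exp (C * √x) * Φ 1 := by fun_prop
    exact (hcont.tendsto 0).comp h0
  have := ge_of_tendsto' hlim hN
  simpa using this

end Iter
end BL

namespace BL
open ProbabilityTheory
open scoped RealInnerProductSpace

section Approx
variable {E : Type*} [NormedAddCommGroup E] [InnerProductSpace ℝ E] [FiniteDimensional ℝ E]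
  [MeasurableSpace E] [BorelSpace E]

lemma Good.mono {δ M K M' K' : ℝ} {g : E → ℝ} {a : E → E} (hg : Good δ M K g a) (hM : M ≤ M')
    (hK : K ≤ K') : Good δ M' K' g a where
  cont := hg.cont
  conta := hg.conta
  lb := hg.lb
  ub := fun x => (hg.ub x).trans hM
  ab := fun x => (hg.ab x).trans hK
  tay := fun x z => (hg.tay x z).trans (by gcongr)

lemma good_of_smooth {u : E → ℝ} (hu : ContDiff ℝ (⊤ : ℕ∞) u) (hs : HasCompactSupport u)
    (h0 : ∀ x, 0 ≤ u x) (δ : ℝ) (hδ : 0 < δ) :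
    ∃ M K a, 0 ≤ M ∧ 0 ≤ K ∧ Good δ M K (fun x => u x + δ) a := by
  obtain ⟨M, hM⟩ := hs.exists_bound_of_continuous hu.continuous
  have hcf : ContDiff ℝ 1 (fderiv ℝ u) := hu.fderiv_right (by norm_cast)
  have hsf : HasCompactSupport (fderiv ℝ u) := hs.fderiv ℝ
  obtain ⟨K, hK⟩ := hsf.exists_bound_of_continuous hcf.continuous
  obtain ⟨L, hL⟩ := hcf.lipschitzWith_of_hasCompactSupport hsf (by simp)
  have hM0 : 0 ≤ M := (norm_nonneg _).trans (hM 0)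
  have hK0 : 0 ≤ K := (norm_nonneg _).trans (hK 0)
  have hd : Differentiable ℝ u := hu.differentiable (by simp)
  refine ⟨M + δ, K + L, gradient u, by positivity, by positivity, ?_⟩
  refine ⟨by have := hu.continuous; fun_prop, ?_, fun x => by linarith [h0 x], fun x => ?_,
    fun x => ?_, fun x z => ?_⟩
  · exact (InnerProductSpace.toDual ℝ E).symm.continuous.comp hcf.continuous
  · have := hM x
    rw [Real.norm_eq_abs] at this
    linarith [le_abs_self (u x)]
  · have : ‖gradient u x‖ = ‖fderiv ℝ u x‖ := by
      simp [gradient]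
    rw [this]
    have := hK x
    have : (0 : ℝ) ≤ L := L.2
    linarith [hK x]
  · have key := Convex.norm_image_sub_le_of_norm_fderiv_le' (𝕜 := ℝ) (f := u)
      (s := Metric.closedBall x ‖z‖) (φ := fderiv ℝ u x) (C := L * ‖z‖) (x := x) (y := x + z)
      (fun y _ => hd y) (fun y hy => by
        have := hL.dist_le_mul y x
        rw [dist_eq_norm] at this
        refine this.trans ?_
        have : dist y x ≤ ‖z‖ := hy
        gcongr) (convex_closedBall _ _) (by simp) (by simp)
    simp only [add_sub_cancel_left] at key
    rw [inner_gradient_left, show u (x + z) + δ - (u x + δ) - (fderiv ℝ u x) z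
      = u (x + z) - u x - (fderiv ℝ u x) z by ring]
    refine key.trans ?_
    have : 0 ≤ K * ‖z‖^2 := by positivity
    nlinarith

lemma exists_approx {g : E → ℝ} (hg : Integrable g (stdGaussian E)) (h0 : ∀ x, 0 ≤ g x)
    {ε : ℝ} (hε : 0 < ε) : ∃ M K G a, 0 ≤ M ∧ 0 ≤ K ∧ Good (ε / 2) M K G a ∧
      ∫⁻ x, ‖G x - g x‖ₑ ∂(stdGaussian E) ≤ ENNReal.ofReal ε := by
  obtain ⟨h, hs, hc, hle⟩ := MemLp.exist_eLpNorm_sub_le (p := 1) (by simp) le_rfl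
    (memLp_one_iff_integrable.2 hg) (half_pos hε)
  set δ := ε / 2 with hδd
  have hδ : 0 < δ := half_pos hε
  set u : E → ℝ := fun x => √(h x ^ 2 + δ ^ 2) - δ with hu
  have huc : ContDiff ℝ (⊤ : ℕ∞) u := by
    refine ContDiff.sub (ContDiff.sqrt (by fun_prop) fun x => by positivity) contDiff_const
  have hus : HasCompactSupport u := by
    refine hs.comp_left (g := fun t : ℝ => √(t ^ 2 + δ ^ 2) - δ) ?_
    simp [Real.sqrt_sq hδ.le]
  have hu0 : ∀ x, 0 ≤ u x := fun x => by
    have : δ ≤ √(h x ^ 2 + δ ^ 2) := Real.le_sqrt_of_sq_le (by nlinarith [sq_nonneg (h x)])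
    simp only [hu]; linarith
  obtain ⟨M, K, a, hM, hK, hG⟩ := good_of_smooth huc hus hu0 δ hδ
  refine ⟨M, K, _, a, hM, hK, hG, ?_⟩
  have hpt : ∀ x, ‖u x + δ - g x‖ₑ ≤ ENNReal.ofReal δ + ‖(g - h) x‖ₑ := fun x => by
    rw [← ofReal_norm, ← ofReal_norm, ← ENNReal.ofReal_add hδ.le (norm_nonneg _)]
    apply ENNReal.ofReal_le_ofReal
    simp only [hu, sub_add_cancel, Real.norm_eq_abs, Pi.sub_apply]
    have e1 : √(h x ^ 2 + δ ^ 2) ≤ |h x| + δ := Real.sqrt_le_iff.2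
      ⟨by positivity, by nlinarith [abs_nonneg (h x), sq_abs (h x)]⟩
    have e2 : |h x| ≤ √(h x ^ 2 + δ ^ 2) := Real.abs_le_sqrt (by nlinarith)
    have e3 : |(|h x| - g x)| ≤ |g x - h x| := by
      have := abs_abs_sub_abs_le (h x) (g x)
      rw [abs_of_nonneg (h0 x)] at this
      rwa [abs_sub_comm (g x)]
    rw [abs_le] at e3 ⊢
    constructor <;> linarith
  calc ∫⁻ x, ‖u x + δ - g x‖ₑ ∂(stdGaussian E)
      ≤ ∫⁻ x, ENNReal.ofReal δ + ‖(g - h) x‖ₑ ∂(stdGaussian E) := lintegral_mono hpt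
    _ = ENNReal.ofReal δ + eLpNorm (g - h) 1 (stdGaussian E) := by
      rw [lintegral_add_left measurable_const, eLpNorm_one_eq_lintegral_enorm]; simp
    _ ≤ ENNReal.ofReal δ + ENNReal.ofReal δ := by gcongr
    _ = _ := by rw [← ENNReal.ofReal_add hδ.le hδ.le]; congr 1; rw [hδd]; ring

end Approx
end BL

namespace BL
open ProbabilityTheory
open scoped RealInnerProductSpace

section General
variable {E : Type*} [NormedAddCommGroup E] [InnerProductSpace ℝ E] [FiniteDimensional ℝ E]
  [MeasurableSpace E] [BorelSpace E]
variable {ι : Type*} [Fintype ι] {F : ι → Type*} [∀ i, NormedAddCommGroup (F i)]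
  [∀ i, InnerProductSpace ℝ (F i)] [∀ i, FiniteDimensional ℝ (F i)]
  [∀ i, MeasurableSpace (F i)] [∀ i, BorelSpace (F i)]
variable {c : ι → ℝ} {W : ∀ i, E →L[ℝ] F i} {V : ∀ i, F i →L[ℝ] E}

lemma Datum.lintegral_comp (d : Datum c W V) (i : ι) {φ : F i → ℝ≥0∞} (hφ : Measurable φ) :
    ∫⁻ x, φ (W i x) ∂(stdGaussian E) = ∫⁻ y, φ y ∂(stdGaussian (F i)) := by
  rw [← map_coisom (W i) (V i) (d.adj i) (d.iso i), lintegral_map hφ (W i).continuous.measurable]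

theorem Datum.integrable_ineq (d : Datum c W V) {g : ∀ i, F i → ℝ} (hm : ∀ i, Measurable (g i))
    (h0 : ∀ i x, 0 ≤ g i x) (hi : ∀ i, Integrable (g i) (stdGaussian (F i))) :
    ∫⁻ x, ENNReal.ofReal (∏ i, (g i (W i x)) ^ (c i)) ∂(stdGaussian E)
      ≤ ENNReal.ofReal (∏ i, (∫ y, g i y ∂(stdGaussian (F i))) ^ (c i)) := by
  have hpos : ∀ k : ℕ, (0 : ℝ) < 1 / ((k : ℝ) + 1) := fun k => by positivity
  choose M K G a hM hK hG hL using fun (k : ℕ) (i : ι) => exists_approx (hi i) (h0 i) (hpos k)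
  have hδ : ∀ k : ℕ, (0 : ℝ) < 1 / ((k : ℝ) + 1) / 2 := fun k => half_pos (hpos k)
  have hG' : ∀ (k : ℕ) i, Good (1 / ((k : ℝ) + 1) / 2) (∑ j, M k j) (∑ j, K k j) (G k i) (a k i) :=
    fun k i => (hG k i).mono
      (Finset.single_le_sum (f := M k) (fun j _ => hM k j) (Finset.mem_univ i))
      (Finset.single_le_sum (f := K k) (fun j _ => hK k j) (Finset.mem_univ i))
  have hineq : ∀ k, ∫ ξ, ∏ i, (G k i (W i ξ)) ^ (c i) ∂(stdGaussian E)
      ≤ ∏ i, (∫ y, G k i y ∂(stdGaussian (F i))) ^ (c i) := fun k =>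
    d.good_ineq (hδ k) (Finset.sum_nonneg fun j _ => hM k j)
      (Finset.sum_nonneg fun j _ => hK k j) (hG' k)
  have hGm : ∀ k i, Measurable (G k i) := fun k i => (hG k i).cont.measurable
  have hε0 : Filter.Tendsto (fun k : ℕ => ENNReal.ofReal (1 / ((k : ℝ) + 1))) Filter.atTop
      (nhds 0) := by
    have := ENNReal.tendsto_ofReal (tendsto_one_div_add_atTop_nhds_zero_nat (𝕜 := ℝ))
    simpa using this
  have hInt : ∀ i, Filter.Tendsto (fun k => ∫ y, G k i y ∂(stdGaussian (F i))) Filter.atTop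
      (nhds (∫ y, g i y ∂(stdGaussian (F i)))) := fun i => by
    refine tendsto_integral_of_L1 _ (hm i).aestronglyMeasurable
      (Filter.Eventually.of_forall fun k => (hG k i).integrable (hδ k) _ id measurable_id) ?_
    exact tendsto_of_tendsto_of_tendsto_of_le_of_le tendsto_const_nhds hε0
      (fun _ => zero_le) (fun k => hL k i)
  have hR : Filter.Tendsto
      (fun k => ENNReal.ofReal (∏ i, (∫ y, G k i y ∂(stdGaussian (F i))) ^ (c i))) Filter.atTop
      (nhds (ENNReal.ofReal (∏ i, (∫ y, g i y ∂(stdGaussian (F i))) ^ (c i)))) := by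
    refine ENNReal.tendsto_ofReal (tendsto_finsetProd _ fun i _ => ?_)
    exact (hInt i).rpow_const (Or.inr (d.pos i).le)
  set D : ℕ → E → ℝ := fun k x => ∑ i, |G k i (W i x) - g i (W i x)| with hD
  have hDm : ∀ k, Measurable (D k) := fun k => by
    refine Finset.measurable_sum _ fun i _ => ?_
    have h1 := (hGm k i).comp (W i).continuous.measurable
    have h2 := (hm i).comp (W i).continuous.measurable
    exact (h1.sub h2).norm
  have hDle : ∀ k, eLpNorm (D k - 0) 1 (stdGaussian E)
      ≤ (Fintype.card ι : ℝ≥0∞) * ENNReal.ofReal (1 / ((k : ℝ) + 1)) := fun k => by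
    rw [sub_zero, eLpNorm_one_eq_lintegral_enorm]
    calc ∫⁻ x, ‖D k x‖ₑ ∂(stdGaussian E)
        ≤ ∫⁻ x, ∑ i, ‖G k i (W i x) - g i (W i x)‖ₑ ∂(stdGaussian E) := by
          refine lintegral_mono fun x => ?_
          refine (enorm_sum_le _ _).trans (le_of_eq ?_)
          refine Finset.sum_congr rfl fun i _ => ?_
          rw [← Real.norm_eq_abs, enorm_norm]
      _ = ∑ i, ∫⁻ x, ‖G k i (W i x) - g i (W i x)‖ₑ ∂(stdGaussian E) := by
          refine lintegral_finsetSum _ fun i _ => ?_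
          have h1 := (hGm k i).comp (W i).continuous.measurable
          have h2 := (hm i).comp (W i).continuous.measurable
          exact (h1.sub h2).enorm
      _ ≤ ∑ i : ι, ENNReal.ofReal (1 / ((k : ℝ) + 1)) := by
          refine Finset.sum_le_sum fun i _ => ?_
          rw [d.lintegral_comp i (φ := fun y => ‖G k i y - g i y‖ₑ) ((hGm k i).sub (hm i)).enorm]
          exact hL k i
      _ = _ := by simp
  have hD0 : TendstoInMeasure (stdGaussian E) D Filter.atTop 0 := by
    refine tendstoInMeasure_of_tendsto_eLpNorm (p := 1) one_ne_zero
      (fun k => (hDm k).aestronglyMeasurable) aestronglyMeasurable_zero ?_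
    refine tendsto_of_tendsto_of_tendsto_of_le_of_le tendsto_const_nhds ?_
      (fun _ => zero_le) hDle
    have := ENNReal.Tendsto.const_mul (a := (Fintype.card ι : ℝ≥0∞)) hε0
      (Or.inr (ENNReal.natCast_ne_top _))
    simpa using this
  obtain ⟨ns, hns, hae⟩ := hD0.exists_seq_tendsto_ae
  have hae2 : ∀ᵐ x ∂(stdGaussian E), Filter.Tendsto
      (fun k => ENNReal.ofReal (∏ i, (G (ns k) i (W i x)) ^ (c i))) Filter.atTop
      (nhds (ENNReal.ofReal (∏ i, (g i (W i x)) ^ (c i)))) := by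
    filter_upwards [hae] with x hx
    refine ENNReal.tendsto_ofReal (tendsto_finsetProd _ fun i _ => ?_)
    refine Filter.Tendsto.rpow_const ?_ (Or.inr (d.pos i).le)
    rw [tendsto_iff_norm_sub_tendsto_zero]
    refine tendsto_of_tendsto_of_tendsto_of_le_of_le tendsto_const_nhds hx
      (fun _ => norm_nonneg _) (fun k => ?_)
    exact Finset.single_le_sum (f := fun i => |G (ns k) i (W i x) - g i (W i x)|)
      (fun j _ => abs_nonneg _) (Finset.mem_univ i)
  calc ∫⁻ x, ENNReal.ofReal (∏ i, (g i (W i x)) ^ (c i)) ∂(stdGaussian E)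
      = ∫⁻ x, Filter.liminf (fun k => ENNReal.ofReal (∏ i, (G (ns k) i (W i x)) ^ (c i)))
          Filter.atTop ∂(stdGaussian E) := by
        refine lintegral_congr_ae ?_
        filter_upwards [hae2] with x hx using hx.liminf_eq.symm
    _ ≤ Filter.liminf (fun k => ∫⁻ x, ENNReal.ofReal (∏ i, (G (ns k) i (W i x)) ^ (c i))
          ∂(stdGaussian E)) Filter.atTop :=
        lintegral_liminf_le fun k => (d.prod_cont (hδ _) (hG' (ns k))).measurable.ennreal_ofReal
    _ ≤ Filter.liminf (fun k => ENNReal.ofReal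
          (∏ i, (∫ y, G (ns k) i y ∂(stdGaussian (F i))) ^ (c i))) Filter.atTop := by
        refine Filter.liminf_le_liminf (Filter.Eventually.of_forall fun k => ?_)
        rw [← ofReal_integral_eq_lintegral_ofReal]
        · exact ENNReal.ofReal_le_ofReal (hineq _)
        · refine Integrable.of_bound
            (d.prod_cont (hδ _) (hG' (ns k))).aestronglyMeasurable _
            (Filter.Eventually.of_forall fun x => d.prod_bound (hδ _) (hG' (ns k)) x)
        · exact Filter.Eventually.of_forall fun x => Finset.prod_nonneg fun i _ =>
            Real.rpow_nonneg ((hδ _).le.trans ((hG (ns k) i).lb _)) _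
    _ = _ := (hR.comp hns.tendsto_atTop).liminf_eq

theorem Datum.ineq (d : Datum c W V) {g : ∀ i, F i → ℝ} (hm : ∀ i, Measurable (g i))
    (h0 : ∀ i x, 0 ≤ g i x) :
    ∫⁻ x, ∏ i, ENNReal.ofReal (g i (W i x)) ^ (c i) ∂(stdGaussian E)
      ≤ ∏ i, (∫⁻ y, ENNReal.ofReal (g i y) ∂(stdGaussian (F i))) ^ (c i) := by
  by_cases hz : ∃ i, ∫⁻ y, ENNReal.ofReal (g i y) ∂(stdGaussian (F i)) = 0
  · obtain ⟨i, hi⟩ := hz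
    rw [← d.lintegral_comp i (φ := fun y => ENNReal.ofReal (g i y)) (hm i).ennreal_ofReal] at hi
    replace hi := (lintegral_eq_zero_iff
      ((hm i).ennreal_ofReal.comp (W i).continuous.measurable)).1 hi
    refine le_of_eq_of_le ?_ zero_le
    rw [← lintegral_zero (μ := stdGaussian E)]
    refine lintegral_congr_ae ?_
    filter_upwards [hi] with x hx
    refine Finset.prod_eq_zero (Finset.mem_univ i) ?_
    simp only [Pi.zero_apply, Function.comp_apply] at hx
    rw [hx, ENNReal.zero_rpow_of_pos (d.pos i)]
  push Not at hz
  by_cases ht : ∃ i, ∫⁻ y, ENNReal.ofReal (g i y) ∂(stdGaussian (F i)) = ⊤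
  · obtain ⟨i, hi⟩ := ht
    refine le_of_le_of_eq le_top (Eq.symm ?_)
    refine WithTop.prod_eq_top (Finset.mem_univ i) ?_ fun j _ => ?_
    · rw [hi]; exact ENNReal.top_rpow_of_pos (d.pos i)
    · have h1 := hz j
      intro h2
      rcases ENNReal.rpow_eq_zero_iff.1 h2 with h | h
      · exact h1 h.1
      · exact absurd h.2 (not_lt.2 (d.pos j).le)
  push Not at ht
  have hi : ∀ i, Integrable (g i) (stdGaussian (F i)) := fun i => by
    refine ⟨(hm i).aestronglyMeasurable, ?_⟩
    rw [hasFiniteIntegral_iff_ofReal (Filter.Eventually.of_forall (h0 i))]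
    exact (ht i).lt_top
  have := d.integrable_ineq hm h0 hi
  convert this using 1
  · refine lintegral_congr fun x => ?_
    rw [ENNReal.ofReal_prod_of_nonneg fun i _ => Real.rpow_nonneg (h0 _ _) _]
    exact Finset.prod_congr rfl fun i _ => ENNReal.ofReal_rpow_of_nonneg (h0 _ _) (d.pos i).le
  · rw [ENNReal.ofReal_prod_of_nonneg fun i _ => Real.rpow_nonneg (integral_nonneg (h0 i)) _]
    refine Finset.prod_congr rfl fun i _ => ?_
    rw [← ENNReal.ofReal_rpow_of_nonneg (integral_nonneg (h0 i)) (d.pos i).le,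
      ofReal_integral_eq_lintegral_ofReal (hi i) (Filter.Eventually.of_forall (h0 i))]

end General
end BL

namespace BL
open ProbabilityTheory
open scoped RealInnerProductSpace

section Geometric
variable {m n : ℕ} {nn : Fin m → ℕ}

/-- The continuous linear map between Euclidean spaces given by a matrix. -/
noncomputable def eclm {p q : ℕ} (R : Matrix (Fin p) (Fin q) ℝ) :
    EuclideanSpace ℝ (Fin q) →L[ℝ] EuclideanSpace ℝ (Fin p) :=
  LinearMap.toContinuousLinearMap (Matrix.toLpLin 2 2 R)

lemma eclm_apply {p q : ℕ} (R : Matrix (Fin p) (Fin q) ℝ) (x : EuclideanSpace ℝ (Fin q)) :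
    eclm R x = WithLp.toLp 2 (R *ᵥ x.ofLp) := by
  simp [eclm, Matrix.toLpLin_apply]

lemma eclm_adj {p q : ℕ} (R : Matrix (Fin p) (Fin q) ℝ) (x : EuclideanSpace ℝ (Fin q))
    (y : EuclideanSpace ℝ (Fin p)) : ⟪eclm R x, y⟫ = ⟪x, eclm Rᵀ y⟫ := by
  simp only [eclm_apply, EuclideanSpace.inner_eq_star_dotProduct, star_trivial]
  rw [Matrix.dotProduct_mulVec, ← Matrix.mulVec_transpose]

lemma eclm_mul {p q r : ℕ} (R : Matrix (Fin p) (Fin q) ℝ) (T : Matrix (Fin q) (Fin r) ℝ)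
    (x : EuclideanSpace ℝ (Fin r)) : eclm R (eclm T x) = eclm (R * T) x := by
  simp [eclm_apply]

lemma datum_of_matrix (c : Fin m → ℝ) (hc : ∀ i, 0 < c i)
    (R : ∀ i, Matrix (Fin (nn i)) (Fin n) ℝ) (hR : ∀ i, R i * (R i)ᵀ = 1)
    (hs : ∑ i, c i • ((R i)ᵀ * R i) = 1) :
    Datum c (fun i => eclm (R i)) (fun i => eclm (R i)ᵀ) where
  pos := hc
  adj := fun i x y => eclm_adj _ _ _
  iso := fun i y => by
    have h : ‖eclm (R i)ᵀ y‖ ^ 2 = ‖y‖ ^ 2 := by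
      rw [← real_inner_self_eq_norm_sq, eclm_adj, transpose_transpose, eclm_mul, hR,
        ← real_inner_self_eq_norm_sq, eclm_apply, one_mulVec]
    exact (pow_left_inj₀ (norm_nonneg _) (norm_nonneg _) two_ne_zero).1 h
  sum := fun x => by
    have : ∀ i, c i • eclm (R i)ᵀ (eclm (R i) x) = eclm (c i • ((R i)ᵀ * R i)) x := fun i => by
      rw [eclm_mul, eclm_apply, eclm_apply, smul_mulVec]; rfl
    simp_rw [this]
    have h2 : ∀ s : Finset (Fin m), ∑ i ∈ s, eclm (c i • ((R i)ᵀ * R i)) x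
        = eclm (∑ i ∈ s, c i • ((R i)ᵀ * R i)) x := fun s => by
      simp only [eclm, map_sum, LinearMap.coe_toContinuousLinearMap',
        ContinuousLinearMap.sum_apply]
    rw [h2, hs, eclm_apply, one_mulVec]

lemma sum_dim (c : Fin m → ℝ) 
    (R : ∀ i, Matrix (Fin (nn i)) (Fin n) ℝ) (hR : ∀ i, R i * (R i)ᵀ = 1)
    (hs : ∑ i, c i • ((R i)ᵀ * R i) = 1) : ∑ i, c i * (nn i : ℝ) = n := by
  have h := congrArg Matrix.trace hs
  rw [Matrix.trace_sum, Matrix.trace_one] at h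
  simp only [Matrix.trace_smul, Matrix.trace_mul_comm _ᵀ, hR, Matrix.trace_one] at h
  simpa using h

lemma sum_norm (c : Fin m → ℝ) (hc : ∀ i, 0 < c i)
    (R : ∀ i, Matrix (Fin (nn i)) (Fin n) ℝ) (hR : ∀ i, R i * (R i)ᵀ = 1)
    (hs : ∑ i, c i • ((R i)ᵀ * R i) = 1) (x : EuclideanSpace ℝ (Fin n)) :
    ∑ i, c i * ‖eclm (R i) x‖ ^ 2 = ‖x‖ ^ 2 := by
  have d := datum_of_matrix c hc R hR hs
  have e : ⟪x, ∑ i, c i • eclm (R i)ᵀ (eclm (R i) x)⟫ = ‖x‖ ^ 2 := by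
    rw [d.sum x, real_inner_self_eq_norm_sq]
  rw [← e, inner_sum]
  refine Finset.sum_congr rfl fun i _ => ?_
  rw [inner_smul_right, ← eclm_adj, real_inner_self_eq_norm_sq]

/-- The Gaussian weight. -/
noncomputable def wt {p : ℕ} (y : EuclideanSpace ℝ (Fin p)) : ℝ :=
  (p : ℝ) / 2 * Real.log (2 * Real.pi) + ‖y‖ ^ 2 / 2

lemma measurable_wt {p : ℕ} : Measurable (wt (p := p)) := by
  unfold wt; fun_prop

lemma lintegral_gauss {p : ℕ} {φ : EuclideanSpace ℝ (Fin p) → ℝ≥0∞} (hφ : Measurable φ) :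
    ∫⁻ x, φ x ∂(stdGaussian (EuclideanSpace ℝ (Fin p)))
      = ∫⁻ x, ENNReal.ofReal (Real.exp (-(wt x))) * φ x := by
  rw [stdGaussian_eq_withDensity, lintegral_withDensity_eq_lintegral_mul _ (by fun_prop) hφ]
  refine lintegral_congr fun x => ?_
  simp only [Pi.mul_apply]
  congr 2
  rw [Real.rpow_def_of_pos (by positivity), ← Real.exp_add]
  congr 1
  simp only [wt, finrank_euclideanSpace, Fintype.card_fin]
  ring

theorem geom_ineq (c : Fin m → ℝ) (hc : ∀ i, 0 < c i)
    (R : ∀ i, Matrix (Fin (nn i)) (Fin n) ℝ) (hR : ∀ i, R i * (R i)ᵀ = 1)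
    (hs : ∑ i, c i • ((R i)ᵀ * R i) = 1)
    (h : ∀ i, (Fin (nn i) → ℝ) → ℝ) (hm : ∀ i, Measurable (h i)) (h0 : ∀ i x, 0 ≤ h i x) :
    ∫⁻ w, ∏ i, ENNReal.ofReal (h i (R i *ᵥ w)) ^ (c i)
      ≤ ∏ i, (∫⁻ y, ENNReal.ofReal (h i y)) ^ (c i) := by
  have d := datum_of_matrix c hc R hR hs
  have hm' : ∀ i, Measurable fun y : EuclideanSpace ℝ (Fin (nn i)) => h i y.ofLp := fun i =>
    (hm i).comp (PiLp.volume_preserving_ofLp _).measurable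
  have hmw : ∀ i, Measurable fun y : EuclideanSpace ℝ (Fin (nn i)) =>
      h i y.ofLp * Real.exp (wt y) := fun i => (hm' i).mul measurable_wt.exp
  have key := d.ineq (g := fun i y => h i y.ofLp * Real.exp (wt y)) hmw
    (fun i x => mul_nonneg (h0 _ _) (Real.exp_pos _).le)
  have hRm : ∀ i, Measurable fun w : Fin n → ℝ => R i *ᵥ w := fun i =>
    (Continuous.matrix_mulVec continuous_const continuous_id).measurable
  have e1 : ∫⁻ x, ∏ i, ENNReal.ofReal (h i ((eclm (R i) x).ofLp) * Real.exp (wt (eclm (R i) x)))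
      ^ (c i) ∂(stdGaussian (EuclideanSpace ℝ (Fin n)))
      = ∫⁻ w, ∏ i, ENNReal.ofReal (h i (R i *ᵥ w)) ^ (c i) := by
    rw [lintegral_gauss]
    · rw [← (PiLp.volume_preserving_ofLp (Fin n)).lintegral_comp]
      · refine lintegral_congr fun x => ?_
        have : ∀ i, ENNReal.ofReal (h i ((eclm (R i) x).ofLp) * Real.exp (wt (eclm (R i) x)))
            ^ (c i) = ENNReal.ofReal (h i (R i *ᵥ x.ofLp)) ^ (c i)
              * ENNReal.ofReal (Real.exp (c i * wt (eclm (R i) x))) := fun i => by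
          rw [ENNReal.ofReal_mul (h0 _ _), ENNReal.mul_rpow_of_nonneg _ _ (hc i).le,
            ENNReal.ofReal_rpow_of_nonneg (Real.exp_pos _).le (hc i).le, ← Real.exp_mul,
            mul_comm (wt _)]
          simp [eclm_apply]
        simp_rw [this]
        rw [Finset.prod_mul_distrib, ← ENNReal.ofReal_prod_of_nonneg
          (fun i _ => (Real.exp_pos _).le), ← Real.exp_sum, mul_comm, mul_assoc,
          ← ENNReal.ofReal_mul (Real.exp_pos _).le, ← Real.exp_add]
        have : ∑ i, c i * wt (eclm (R i) x) + -wt x = 0 := by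
          have a1 := sum_dim c R hR hs
          have a2 := sum_norm c hc R hR hs x
          have : ∀ i, c i * wt (eclm (R i) x) = (c i * (nn i : ℝ)) * (Real.log (2 * Real.pi) / 2)
            + (c i * ‖eclm (R i) x‖ ^ 2) * (1 / 2) := fun i => by unfold wt; ring
          simp_rw [this]
          rw [Finset.sum_add_distrib, ← Finset.sum_mul, ← Finset.sum_mul, a1, a2]
          unfold wt; ring
        rw [this]; simp
      · exact Finset.measurable_prod _ fun i _ =>
          ((hm i).comp (hRm i)).ennreal_ofReal.pow_const _
    · exact Finset.measurable_prod _ fun i _ =>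
        ((hmw i).comp (eclm (R i)).continuous.measurable).ennreal_ofReal.pow_const _
  have e2 : ∀ i, ∫⁻ y, ENNReal.ofReal (h i y.ofLp * Real.exp (wt y))
      ∂(stdGaussian (EuclideanSpace ℝ (Fin (nn i)))) = ∫⁻ y, ENNReal.ofReal (h i y) := fun i => by
    rw [lintegral_gauss (hmw i).ennreal_ofReal,
      ← (PiLp.volume_preserving_ofLp (Fin (nn i))).lintegral_comp (hm i).ennreal_ofReal]
    refine lintegral_congr fun x => ?_
    rw [← ENNReal.ofReal_mul (Real.exp_pos _).le, mul_comm, mul_assoc, ← Real.exp_add]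
    simp
  rw [e1] at key
  simp_rw [e2] at key
  exact key

end Geometric
end BL

namespace BL
open ProbabilityTheory
open scoped RealInnerProductSpace

section Linear
variable {m n : ℕ} {nn : Fin m → ℕ}

lemma lintegral_mulVec {p : ℕ} (S : Matrix (Fin p) (Fin p) ℝ) (hS : S.det ≠ 0)
    {φ : (Fin p → ℝ) → ℝ≥0∞} (hφ : Measurable φ) :
    ∫⁻ x, φ x = ENNReal.ofReal |S.det| * ∫⁻ w, φ (S *ᵥ w) := by
  have hSm : Measurable fun w : Fin p → ℝ => S *ᵥ w :=
    (Continuous.matrix_mulVec continuous_const continuous_id).measurable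
  have h : Measure.map (fun w : Fin p → ℝ => S *ᵥ w) volume
      = ENNReal.ofReal |S.det⁻¹| • (volume : Measure (Fin p → ℝ)) :=
    Real.map_matrix_volume_pi_eq_smul_volume_pi hS
  have e : ∫⁻ w, φ (S *ᵥ w) = ENNReal.ofReal |S.det⁻¹| * ∫⁻ x, φ x := by
    rw [← lintegral_map hφ hSm, h, lintegral_smul_measure]; rfl
  rw [e, ← mul_assoc, ← ENNReal.ofReal_mul (abs_nonneg _), ← abs_mul, mul_inv_cancel₀ hS]
  simp

open scoped MatrixOrder in
lemma exists_factor {p : ℕ} {A : Matrix (Fin p) (Fin p) ℝ} (hA : A.PosDef) :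
    ∃ S : Matrix (Fin p) (Fin p) ℝ, A = S * Sᵀ ∧ S.det ≠ 0 := by
  have h1 : CFC.sqrt A * CFC.sqrt A = A := CFC.sqrt_mul_sqrt_self A hA.posSemidef.nonneg
  have h2 : (CFC.sqrt A)ᵀ = CFC.sqrt A := by
    have := (Matrix.nonneg_iff_posSemidef.1 (CFC.sqrt_nonneg A)).isHermitian
    rwa [Matrix.IsHermitian, conjTranspose_eq_transpose_of_trivial] at this
  refine ⟨CFC.sqrt A, by rw [h2, h1], fun h => ?_⟩
  have := hA.det_pos
  rw [← h1, det_mul, h] at this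
  simp at this

lemma quad_factor {p : ℕ} {S : Matrix (Fin p) (Fin p) ℝ} (hS : S.det ≠ 0) (w : Fin p → ℝ) :
    (S * Sᵀ)⁻¹ *ᵥ (S *ᵥ w) ⬝ᵥ (S *ᵥ w) = w ⬝ᵥ w := by
  have hu : IsUnit S.det := isUnit_iff_ne_zero.2 hS
  have hut : IsUnit Sᵀ.det := by rwa [det_transpose]
  rw [mulVec_mulVec, Matrix.mul_inv_rev, Matrix.mul_assoc, Matrix.nonsing_inv_mul _ hu,
    Matrix.mul_one, dotProduct_mulVec, ← mulVec_transpose, mulVec_mulVec,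
    Matrix.mul_nonsing_inv _ hut, one_mulVec]

lemma lintegral_exp {p : ℕ} {A S : Matrix (Fin p) (Fin p) ℝ} (hAS : A = S * Sᵀ)
    (hS : S.det ≠ 0) :
    ∫⁻ x : Fin p → ℝ, ENNReal.ofReal (Real.exp (-(A⁻¹ *ᵥ x ⬝ᵥ x)))
      = ENNReal.ofReal (|S.det| * Real.pi ^ ((p : ℝ) / 2)) := by
  subst hAS
  have hc : Continuous fun x : Fin p → ℝ => (S * Sᵀ)⁻¹ *ᵥ x ⬝ᵥ x :=
    Continuous.dotProduct (Continuous.matrix_mulVec continuous_const continuous_id) continuous_id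
  rw [lintegral_mulVec S hS (by fun_prop), ENNReal.ofReal_mul (abs_nonneg _)]
  congr 1
  simp_rw [quad_factor hS]
  rw [← (PiLp.volume_preserving_ofLp (Fin p)).lintegral_comp (by unfold dotProduct; fun_prop)]
  have h := GaussianFourier.integral_rexp_neg_mul_sq_norm (V := EuclideanSpace ℝ (Fin p))
    (b := 1) one_pos
  rw [finrank_euclideanSpace, Fintype.card_fin, div_one] at h
  rw [← h, ofReal_integral_eq_lintegral_ofReal]
  · refine lintegral_congr fun x => ?_
    congr 2
    rw [← real_inner_self_eq_norm_sq, EuclideanSpace.inner_eq_star_dotProduct, star_trivial]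
    ring
  · by_contra hcon
    rw [integral_undef hcon] at h
    have : 0 < Real.pi ^ ((p : ℝ) / 2) := by positivity
    linarith
  · exact Filter.Eventually.of_forall fun x => (Real.exp_pos _).le

lemma block_eq (U : ∀ i, Matrix (Fin (nn i)) (Fin n) ℝ)
    (bigU : Matrix (Σ i : Fin m, Fin (nn i)) (Fin n) ℝ)
    (hbigU : ∀ a k, bigU a k = U a.1 a.2 k)
    (c : Fin m → ℝ) (A : Matrix (Fin n) (Fin n) ℝ)
    (DA : Matrix (Σ i : Fin m, Fin (nn i)) (Σ i : Fin m, Fin (nn i)) ℝ)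
    (hDA : ∀ a b, DA a b = if a.1 = b.1 then (bigU * A * bigUᵀ) a b else 0)
    (hdet : ∀ i, (U i * A * (U i)ᵀ).det ≠ 0) :
    bigUᵀ * ((Matrix.diagonal fun a : Σ i : Fin m, Fin (nn i) => c a.1) * DA⁻¹) * bigU
      = ∑ i, c i • ((U i)ᵀ * (U i * A * (U i)ᵀ)⁻¹ * U i) := by
  have h1 : DA = blockDiagonal' (fun i => U i * A * (U i)ᵀ) := by
    ext ⟨i, x⟩ ⟨j, y⟩
    rw [hDA]
    by_cases h : i = j
    · subst h
      rw [if_pos rfl, blockDiagonal'_apply_eq]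
      simp [Matrix.mul_apply, hbigU]
    · rw [if_neg h, blockDiagonal'_apply_ne _ _ _ h]
  have h2 : DA⁻¹ = blockDiagonal' (fun i => (U i * A * (U i)ᵀ)⁻¹) := by
    refine Matrix.inv_eq_right_inv ?_
    rw [h1, ← blockDiagonal'_mul, ← blockDiagonal'_one]
    congr 1
    funext i
    exact Matrix.mul_nonsing_inv _ (isUnit_iff_ne_zero.2 (hdet i))
  rw [h2]
  have h3 : ∀ N : ∀ i, Matrix (Fin (nn i)) (Fin (nn i)) ℝ,
      (Matrix.diagonal fun a : Σ i : Fin m, Fin (nn i) => c a.1) * blockDiagonal' N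
        = blockDiagonal' fun i => c i • N i := fun N => by
    ext ⟨i, x⟩ ⟨j, y⟩
    rw [diagonal_mul]
    by_cases h : i = j
    · subst h
      simp [blockDiagonal'_apply_eq]
    · simp [blockDiagonal'_apply_ne _ _ _ h]
  rw [h3]
  suffices h4 : ∀ N : ∀ i, Matrix (Fin (nn i)) (Fin (nn i)) ℝ,
      bigUᵀ * (blockDiagonal' fun i => c i • N i) * bigU = ∑ i, c i • ((U i)ᵀ * N i * U i) from
    h4 _
  intro N
  ext k l
  simp only [Matrix.mul_apply, Matrix.sum_apply, Matrix.smul_apply, transpose_apply,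
    hbigU, Fintype.sum_sigma, smul_eq_mul]
  refine Finset.sum_congr rfl fun j _ => ?_
  rw [Finset.mul_sum]
  refine Finset.sum_congr rfl fun y _ => ?_
  rw [← mul_assoc]
  congr 1
  rw [Finset.sum_eq_single j, Finset.mul_sum]
  · refine Finset.sum_congr rfl fun x _ => ?_
    rw [blockDiagonal'_apply_eq, Matrix.smul_apply, smul_eq_mul]
    ring
  · intro i _ hij
    refine Finset.sum_eq_zero fun x _ => ?_
    rw [blockDiagonal'_apply_ne _ _ _ hij]; simp
  · simp

lemma posDef_block (U : Matrix (Fin m) (Fin n) ℝ) (hU : U.rank = m)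
    {A : Matrix (Fin n) (Fin n) ℝ} (hA : A.PosDef) : (U * A * Uᵀ).PosDef := by
  rw [← conjTranspose_eq_transpose_of_trivial]
  refine hA.mul_mul_conjTranspose_same ?_
  rw [Matrix.vecMul_injective_iff, linearIndependent_iff_card_eq_finrank_span, Set.finrank,
    ← Matrix.rank_eq_finrank_span_row, hU, Fintype.card_fin]

end Linear
end BL

namespace BL

section Final
variable {m n : ℕ} {nn : Fin m → ℕ}

lemma geom_of_factor (c : Fin m → ℝ) (U : ∀ i, Matrix (Fin (nn i)) (Fin n) ℝ)
    (S : Matrix (Fin n) (Fin n) ℝ) (hS : S.det ≠ 0)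
    (T : ∀ i, Matrix (Fin (nn i)) (Fin (nn i)) ℝ) (hT : ∀ i, (T i).det ≠ 0)
    (hST : ∀ i, U i * (S * Sᵀ) * (U i)ᵀ = T i * (T i)ᵀ)
    (hsum : ∑ i, c i • ((U i)ᵀ * (T i * (T i)ᵀ)⁻¹ * U i) = (S * Sᵀ)⁻¹) :
    (∀ i, ((T i)⁻¹ * U i * S) * ((T i)⁻¹ * U i * S)ᵀ = 1) ∧
    ∑ i, c i • (((T i)⁻¹ * U i * S)ᵀ * ((T i)⁻¹ * U i * S)) = 1 := by
  have huS : IsUnit S.det := isUnit_iff_ne_zero.2 hS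
  have huSt : IsUnit Sᵀ.det := by rwa [det_transpose]
  have huT : ∀ i, IsUnit (T i).det := fun i => isUnit_iff_ne_zero.2 (hT i)
  have huTt : ∀ i, IsUnit (T i)ᵀ.det := fun i => by rw [det_transpose]; exact huT i
  constructor
  · intro i
    calc ((T i)⁻¹ * U i * S) * ((T i)⁻¹ * U i * S)ᵀ
        = (T i)⁻¹ * (U i * (S * Sᵀ) * (U i)ᵀ) * ((T i)⁻¹)ᵀ := by
          simp only [transpose_mul, Matrix.mul_assoc]
      _ = ((T i)⁻¹ * T i) * ((T i)ᵀ * ((T i)ᵀ)⁻¹) := by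
          rw [hST, transpose_nonsing_inv]; simp only [Matrix.mul_assoc]
      _ = 1 := by rw [nonsing_inv_mul _ (huT i), mul_nonsing_inv _ (huTt i), Matrix.mul_one]
  · have : ∀ i, c i • (((T i)⁻¹ * U i * S)ᵀ * ((T i)⁻¹ * U i * S))
        = Sᵀ * (c i • ((U i)ᵀ * (T i * (T i)ᵀ)⁻¹ * U i)) * S := fun i => by
      rw [Matrix.mul_smul, Matrix.smul_mul, Matrix.mul_inv_rev]
      simp only [transpose_mul, Matrix.mul_assoc, transpose_nonsing_inv]
    simp_rw [this]
    rw [← Finset.sum_mul, ← Finset.mul_sum, hsum, Matrix.mul_inv_rev, ← Matrix.mul_assoc,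
      mul_nonsing_inv _ huSt, Matrix.one_mul, nonsing_inv_mul _ huS]

lemma const_eq (c : Fin m → ℝ) (s : ℝ) (t : Fin m → ℝ) :
    √(s * s / ∏ i, (t i * t i) ^ (c i)) = |s| * ∏ i, (|t i|⁻¹) ^ (c i) := by
  have h : s * s / ∏ i, (t i * t i) ^ (c i) = (|s| * ∏ i, (|t i|⁻¹) ^ (c i)) ^ 2 := by
    rw [mul_pow, sq_abs, ← Finset.prod_pow, div_eq_mul_inv, ← Finset.prod_inv_distrib, sq]
    congr 1
    refine Finset.prod_congr rfl fun i _ => ?_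
    rw [Real.inv_rpow (abs_nonneg _), inv_pow, ← abs_mul_abs_self (t i),
      Real.mul_rpow (abs_nonneg _) (abs_nonneg _), sq]
  rw [h, Real.sqrt_sq]
  exact mul_nonneg (abs_nonneg _) (Finset.prod_nonneg fun i _ =>
    Real.rpow_nonneg (inv_nonneg.2 (abs_nonneg _)) _)

end Final
end BL

/-- **Brascamp-Lieb inequality (Theorem 7.1(i), Gaussian-extremizable form)**:
under (A1) and (A2),
`∫ ∏ fᵢ(Uᵢx) dx ≤ (det A / ∏ det(Aᵢ)^{cᵢ})^{1/2} ∏ ‖fᵢ‖_{1/cᵢ}`, with equality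
for `fᵢ(x) = exp(-cᵢ⟨Aᵢ⁻¹x, x⟩)`. Here `C_A = diag(cᵢ Aᵢ⁻¹)` is expressed as
`diag(cᵢ) * (blockdiag Aᵢ)⁻¹`. -/
theorem stmt17
    (m n : ℕ) (hm : 0 < m) (hn : 0 < n)
    (nn : Fin m → ℕ) (hnn : ∀ i, 0 < nn i)
    (U : ∀ i, Matrix (Fin (nn i)) (Fin n) ℝ) (hUrank : ∀ i, (U i).rank = nn i)
    (bigU : Matrix (Σ i : Fin m, Fin (nn i)) (Fin n) ℝ)
    (hbigU : ∀ a k, bigU a k = U a.1 a.2 k)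
    (c : Fin m → ℝ) (hc : ∀ i, 0 < c i)
    (A : Matrix (Fin n) (Fin n) ℝ) (hA : A.PosDef)
    (DA : Matrix (Σ i : Fin m, Fin (nn i)) (Σ i : Fin m, Fin (nn i)) ℝ)
    (hDA : ∀ a b, DA a b = if a.1 = b.1 then (bigU * A * bigUᵀ) a b else 0)
    (hA2 : bigUᵀ * ((Matrix.diagonal fun a : Σ i : Fin m, Fin (nn i) => c a.1)
        * DA⁻¹) * bigU = A⁻¹) :
    (∀ f : ∀ i, (Fin (nn i) → ℝ) → ℝ, (∀ i, Measurable (f i)) →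
      (∀ i x, 0 ≤ f i x) →
      ∫⁻ x, ∏ i, ENNReal.ofReal (f i ((U i).mulVec x))
        ≤ ENNReal.ofReal
            (Real.sqrt (A.det / ∏ i, (U i * A * (U i)ᵀ).det ^ (c i)))
          * ∏ i, (∫⁻ z, ENNReal.ofReal (f i z) ^ (1 / c i)) ^ (c i)) ∧
    (∫⁻ x, ∏ i, ENNReal.ofReal
        (Real.exp (-(c i) *
          (((U i * A * (U i)ᵀ)⁻¹).mulVec ((U i).mulVec x) ⬝ᵥ (U i).mulVec x)))
      = ENNReal.ofReal
          (Real.sqrt (A.det / ∏ i, (U i * A * (U i)ᵀ).det ^ (c i)))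
        * ∏ i, (∫⁻ z, ENNReal.ofReal
            (Real.exp (-(c i) * (((U i * A * (U i)ᵀ)⁻¹).mulVec z ⬝ᵥ z)))
              ^ (1 / c i)) ^ (c i)) := by
  have hAi : ∀ i, (U i * A * (U i)ᵀ).PosDef := fun i => BL.posDef_block (U i) (hUrank i) hA
  rw [BL.block_eq U bigU hbigU c A DA hDA (fun i => (hAi i).det_pos.ne')] at hA2
  obtain ⟨S, hAS, hS⟩ := BL.exists_factor hA
  choose T hAT hT using fun i => BL.exists_factor (hAi i)
  obtain ⟨hR, hRs⟩ := BL.geom_of_factor c U S hS T hT (fun i => by rw [← hAS, hAT])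
    (by simp_rw [← hAT]; rw [hA2, hAS])
  have hdim := BL.sum_dim c _ hR hRs
  have hconst : √(A.det / ∏ i, (U i * A * (U i)ᵀ).det ^ (c i))
      = |S.det| * ∏ i, (|(T i).det|⁻¹) ^ (c i) := by
    simp_rw [hAT]
    rw [hAS]
    simp only [det_mul, det_transpose]
    exact BL.const_eq c _ _
  have ht0 : ∀ i, 0 ≤ |(T i).det|⁻¹ := fun i => inv_nonneg.2 (abs_nonneg _)
  have hUm : ∀ i, Measurable fun w : Fin n → ℝ => U i *ᵥ w := fun i =>
    (Continuous.matrix_mulVec continuous_const continuous_id).measurable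
  rw [hconst, ENNReal.ofReal_mul (abs_nonneg _),
    ENNReal.ofReal_prod_of_nonneg (fun i _ => Real.rpow_nonneg (ht0 i) _)]
  constructor
  · intro f hfm hf0
    have hTm : ∀ i, Measurable fun w : Fin (nn i) → ℝ => T i *ᵥ w := fun i =>
      (Continuous.matrix_mulVec continuous_const continuous_id).measurable
    have hpm : Measurable fun x : Fin n → ℝ => ∏ i, ENNReal.ofReal (f i (U i *ᵥ x)) :=
      Finset.measurable_prod _ fun i _ => ((hfm i).comp (hUm i)).ennreal_ofReal
    rw [BL.lintegral_mulVec S hS hpm, mul_assoc, ← Finset.prod_mul_distrib]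
    gcongr ENNReal.ofReal _ * ?_
    have key := BL.geom_ineq c hc _ hR hRs (fun i y => (f i (T i *ᵥ y)) ^ (1 / c i))
      (fun i => ((hfm i).comp (hTm i)).pow_const _) (fun i x => Real.rpow_nonneg (hf0 _ _) _)
    refine le_of_eq_of_le ?_ (key.trans (le_of_eq ?_))
    · refine lintegral_congr fun w => Finset.prod_congr rfl fun i _ => ?_
      rw [ENNReal.ofReal_rpow_of_nonneg (Real.rpow_nonneg (hf0 _ _) _) (hc i).le,
        ← Real.rpow_mul (hf0 _ _), one_div_mul_cancel (hc i).ne', Real.rpow_one,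
        mulVec_mulVec, mulVec_mulVec, ← Matrix.mul_assoc, ← Matrix.mul_assoc,
        mul_nonsing_inv _ (isUnit_iff_ne_zero.2 (hT i)), Matrix.one_mul]
    · refine Finset.prod_congr rfl fun i _ => ?_
      symm
      rw [← ENNReal.ofReal_rpow_of_nonneg (ht0 i) (hc i).le,
        ← ENNReal.mul_rpow_of_nonneg _ _ (hc i).le,
        BL.lintegral_mulVec (T i) (hT i) ((hfm i).ennreal_ofReal.pow_const _), ← mul_assoc,
        ← ENNReal.ofReal_mul (ht0 i), inv_mul_cancel₀ (abs_ne_zero.2 (hT i)),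
        ENNReal.ofReal_one, one_mul]
      congr 1
      refine lintegral_congr fun y => ?_
      rw [ENNReal.ofReal_rpow_of_nonneg (hf0 _ _) (one_div_pos.2 (hc i)).le]
  · have hl : ∀ x : Fin n → ℝ, ∏ i, ENNReal.ofReal (Real.exp (-(c i) *
          (((U i * A * (U i)ᵀ)⁻¹).mulVec ((U i).mulVec x) ⬝ᵥ (U i).mulVec x)))
        = ENNReal.ofReal (Real.exp (-(A⁻¹ *ᵥ x ⬝ᵥ x))) := fun x => by
      rw [← ENNReal.ofReal_prod_of_nonneg (fun i _ => (Real.exp_pos _).le), ← Real.exp_sum]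
      congr 2
      rw [← hA2, Matrix.sum_mulVec, sum_dotProduct, ← Finset.sum_neg_distrib]
      refine Finset.sum_congr rfl fun i _ => ?_
      rw [smul_mulVec, smul_dotProduct, smul_eq_mul, neg_mul, dotProduct_mulVec,
        ← mulVec_transpose, mulVec_mulVec, mulVec_mulVec, Matrix.mul_assoc]
    have hr : ∀ i, ∀ z : Fin (nn i) → ℝ, ENNReal.ofReal
            (Real.exp (-(c i) * (((U i * A * (U i)ᵀ)⁻¹).mulVec z ⬝ᵥ z))) ^ (1 / c i)
        = ENNReal.ofReal (Real.exp (-((U i * A * (U i)ᵀ)⁻¹ *ᵥ z ⬝ᵥ z))) := fun i z => by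
      rw [ENNReal.ofReal_rpow_of_nonneg (Real.exp_pos _).le (one_div_pos.2 (hc i)).le,
        ← Real.exp_mul]
      congr 2
      have := (hc i).ne'
      field_simp
    simp_rw [hl, hr]
    rw [BL.lintegral_exp hAS hS, ENNReal.ofReal_mul (abs_nonneg _), mul_assoc,
      ← Finset.prod_mul_distrib]
    congr 1
    have hpi : ∀ i, (0 : ℝ) ≤ Real.pi ^ ((nn i : ℝ) / 2) := fun i => by positivity
    have : ∀ i, ENNReal.ofReal (|(T i).det|⁻¹ ^ (c i)) *
        (∫⁻ z : Fin (nn i) → ℝ,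
          ENNReal.ofReal (Real.exp (-((U i * A * (U i)ᵀ)⁻¹ *ᵥ z ⬝ᵥ z)))) ^ (c i)
        = ENNReal.ofReal (Real.pi ^ (c i * (nn i : ℝ) * (1 / 2))) := fun i => by
      rw [BL.lintegral_exp (hAT i) (hT i), ← ENNReal.ofReal_rpow_of_nonneg (ht0 i) (hc i).le,
        ← ENNReal.mul_rpow_of_nonneg _ _ (hc i).le, ← ENNReal.ofReal_mul (ht0 i), ← mul_assoc,
        inv_mul_cancel₀ (abs_ne_zero.2 (hT i)), one_mul,
        ENNReal.ofReal_rpow_of_nonneg (hpi i) (hc i).le, ← Real.rpow_mul Real.pi_pos.le]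
      congr 2; ring
    simp_rw [this]
    rw [← ENNReal.ofReal_prod_of_nonneg (fun i _ => Real.rpow_nonneg Real.pi_pos.le _),
      ← Real.rpow_sum_of_pos Real.pi_pos, ← Finset.sum_mul, hdim]
    congr 2; ring
end
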